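/- For every edge-critical graph H with chromatic number χ(H) ≥ 3 there exists n₀ = n₀(H) such that φ^R(n,H) = ex(n,H) for all n ≥ n₀; moreover, the only n-vertex graph G admitting a proper edge coloring χ with φ_χ^R(G,H) = φ^R(n,H) is the Turán graph T_{χ(H)−1}(n). -/

import Mathlib

namespace RainbowDecomp

variable {V : Type*} {W : Type*}

/-- The number of edges of a graph. -/
noncomputable def eCount (G : SimpleGraph V) : ℕ := G.edgeSet.ncard

/-- `χ` is a proper edge coloring of `G`: any two distinct edges of `G` sharing a vertex
receive distinct colors. -/
def ProperEdgeColoring (G : SimpleGraph V) (χ : Sym2 V → ℕ) : Prop :=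
  ∀ ⦃e f : Sym2 V⦄, e ∈ G.edgeSet → f ∈ G.edgeSet → e ≠ f →
    (∃ v, v ∈ e ∧ v ∈ f) → χ e ≠ χ f

/-- `S` is the edge set of a (sub)copy of `H` in `G`. -/
def IsCopyEdgeSet (H : SimpleGraph W) (G : SimpleGraph V) (S : Set (Sym2 V)) : Prop :=
  ∃ f : W → V, Function.Injective f ∧ (∀ ⦃a b⦄, H.Adj a b → G.Adj (f a) (f b)) ∧
    S = Sym2.map f '' H.edgeSet

/-- `G` contains a subgraph isomorphic to `H`. -/
def ContainsCopy (H : SimpleGraph W) (G : SimpleGraph V) : Prop :=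
  ∃ f : W → V, Function.Injective f ∧ ∀ ⦃a b⦄, H.Adj a b → G.Adj (f a) (f b)

/-- `P` is a partition of the edge set of `G` into `t` (nonempty) parts. -/
def IsEdgePartition (G : SimpleGraph V) {t : ℕ} (P : Fin t → Set (Sym2 V)) : Prop :=
  (∀ i, P i ⊆ G.edgeSet) ∧ ∀ e ∈ G.edgeSet, ∃! i, e ∈ P i

/-- `P` is an `H`-decomposition of `G`: every part is a single edge or the edge set of a
copy of `H`. -/
def IsHDecomp (G : SimpleGraph V) (H : SimpleGraph W) {t : ℕ}
    (P : Fin t → Set (Sym2 V)) : Prop :=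
  IsEdgePartition G P ∧ ∀ i, (∃ e, P i = {e}) ∨ IsCopyEdgeSet H G (P i)

/-- `P` is a rainbow `H`-decomposition of `G` under `χ`: every part is a single edge or
the edge set of a rainbow copy of `H`. -/
def IsRainbowHDecomp (G : SimpleGraph V) (H : SimpleGraph W) (χ : Sym2 V → ℕ) {t : ℕ}
    (P : Fin t → Set (Sym2 V)) : Prop :=
  IsEdgePartition G P ∧
    ∀ i, (∃ e, P i = {e}) ∨ (IsCopyEdgeSet H G (P i) ∧ Set.InjOn χ (P i))

/-- `φ(G,H)`, the minimum number of parts in an `H`-decomposition of `G`. -/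
noncomputable def phi (G : SimpleGraph V) (H : SimpleGraph W) : ℕ :=
  sInf {t | ∃ P : Fin t → Set (Sym2 V), IsHDecomp G H P}

/-- `φ_χ^R(G,H)`, the minimum number of parts in a rainbow `H`-decomposition of `G`
under `χ`. -/
noncomputable def phiR (G : SimpleGraph V) (H : SimpleGraph W) (χ : Sym2 V → ℕ) : ℕ :=
  sInf {t | ∃ P : Fin t → Set (Sym2 V), IsRainbowHDecomp G H χ P}

/-- `N(G,H)`, the maximum number of pairwise edge-disjoint copies of `H` in `G`. -/
noncomputable def Ncopies (G : SimpleGraph V) (H : SimpleGraph W) : ℕ :=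
  sSup {k | ∃ C : Fin k → Set (Sym2 V), (∀ i, IsCopyEdgeSet H G (C i)) ∧
    ∀ i j, i ≠ j → Disjoint (C i) (C j)}

/-- `N_χ^R(G,H)`, the maximum number of pairwise edge-disjoint rainbow copies of `H`
in `G` under `χ`. -/
noncomputable def NcopiesR (G : SimpleGraph V) (H : SimpleGraph W) (χ : Sym2 V → ℕ) : ℕ :=
  sSup {k | ∃ C : Fin k → Set (Sym2 V),
    (∀ i, IsCopyEdgeSet H G (C i) ∧ Set.InjOn χ (C i)) ∧
    ∀ i j, i ≠ j → Disjoint (C i) (C j)}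

/-- `ex(n,H)`, the maximum number of edges of an `H`-free graph on `n` vertices. -/
noncomputable def exNum (n : ℕ) (H : SimpleGraph W) : ℕ :=
  sSup {m | ∃ G : SimpleGraph (Fin n), ¬ ContainsCopy H G ∧ eCount G = m}

/-- `φ^R(n,H)`, the maximum of `φ_χ^R(G,H)` over all graphs `G` on `n` vertices and all
proper edge colorings `χ` of `G`. -/
noncomputable def phiRmax (n : ℕ) (H : SimpleGraph W) : ℕ :=
  sSup {t | ∃ G : SimpleGraph (Fin n), ∃ χ : Sym2 (Fin n) → ℕ,
    ProperEdgeColoring G χ ∧ phiR G H χ = t}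

/-- `e(A)`, the number of edges of `G` with both endpoints in `A`. -/
noncomputable def eInside (G : SimpleGraph V) (A : Set V) : ℕ :=
  {e ∈ G.edgeSet | ∀ v ∈ e, v ∈ A}.ncard

/-- `e(A,B)`, the number of edges of `G` with one endpoint in `A` and one in `B`
(counted as ordered pairs). -/
noncomputable def eBetween (G : SimpleGraph V) (A B : Set V) : ℕ :=
  {p : V × V | p.1 ∈ A ∧ p.2 ∈ B ∧ G.Adj p.1 p.2}.ncard

/-- The edge density `d(A,B)` between `A` and `B`. -/
noncomputable def density (G : SimpleGraph V) (A B : Set V) : ℝ :=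
  (eBetween G A B : ℝ) / ((A.ncard : ℝ) * (B.ncard : ℝ))

/-- The pair `(A,B)` is `ε`-regular in `G`. -/
def IsRegularPair (G : SimpleGraph V) (ε : ℝ) (A B : Set V) : Prop :=
  ∀ A' ⊆ A, ∀ B' ⊆ B, ε * (A.ncard : ℝ) ≤ (A'.ncard : ℝ) →
    ε * (B.ncard : ℝ) ≤ (B'.ncard : ℝ) →
    |density G A' B' - density G A B| ≤ ε

/-- The edges of the (transversal) clique with vertices `g 0, …, g (r-1)`. -/
def transversalEdges {r : ℕ} (g : Fin r → V) : Set (Sym2 V) :=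
  {e | ∃ k l : Fin r, k ≠ l ∧ e = s(g k, g l)}

/-- The number of rainbow transversal copies of `K_r` (one vertex in each `Vs l`)
containing the edge `uv` with `u ∈ Vs i` and `v ∈ Vs j`. -/
noncomputable def rainbowCliqueCount {r : ℕ} (G : SimpleGraph V) (χ : Sym2 V → ℕ)
    (Vs : Fin r → Set V) (i j : Fin r) (u v : V) : ℕ :=
  {g : Fin r → V | (∀ l, g l ∈ Vs l) ∧ (∀ k l, k ≠ l → G.Adj (g k) (g l)) ∧
    g i = u ∧ g j = v ∧ Set.InjOn χ (transversalEdges g)}.ncard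

/-- The number of non-rainbow transversal copies of `K_r` (one vertex in each `Vs l`)
containing the edge `uv` with `u ∈ Vs i` and `v ∈ Vs j`. -/
noncomputable def nonRainbowCliqueCount {r : ℕ} (G : SimpleGraph V) (χ : Sym2 V → ℕ)
    (Vs : Fin r → Set V) (i j : Fin r) (u v : V) : ℕ :=
  {g : Fin r → V | (∀ l, g l ∈ Vs l) ∧ (∀ k l, k ≠ l → G.Adj (g k) (g l)) ∧
    g i = u ∧ g j = v ∧ ¬ Set.InjOn χ (transversalEdges g)}.ncard

/-- The edge set of the clique on the vertex set `K`. -/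
def cliqueEdges (K : Finset V) : Set (Sym2 V) :=
  {e | ∃ u ∈ K, ∃ v ∈ K, u ≠ v ∧ e = s(u, v)}

open scoped Classical in
/-- The probability of the event `A` under the random subgraph of `G` in which every
edge `e` is retained independently with probability `q e`. -/
noncomputable def edgeSubsetProb [Fintype V] (G : SimpleGraph V) (q : Sym2 V → ℝ)
    (A : Set (Finset (Sym2 V))) : ℝ :=
  ∑ E' ∈ (Set.toFinite G.edgeSet).toFinset.powerset,
    (∏ e ∈ E', q e) * (∏ e ∈ (Set.toFinite G.edgeSet).toFinset \ E', (1 - q e)) *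
      A.indicator (fun _ => (1 : ℝ)) E'

section
open Finset
open scoped Classical

/-- `f` embeds `H` into `G` as a rainbow copy. -/
def RainbowEmb (H : SimpleGraph W) (G : SimpleGraph V) (χ : Sym2 V → ℕ) (f : W → V) : Prop :=
  Function.Injective f ∧ (∀ a b, H.Adj a b → G.Adj (f a) (f b)) ∧
    ∀ a b c d, H.Adj a b → H.Adj c d → χ s(f a, f b) = χ s(f c, f d) → s(a, b) = s(c, d)

lemma ProperEdgeColoring.eq_of_eq {G : SimpleGraph V} {χ : Sym2 V → ℕ}
    (hχ : ProperEdgeColoring G χ) {x y z : V} (hy : G.Adj x y) (hz : G.Adj x z)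
    (h : χ s(x, y) = χ s(x, z)) : y = z := by
  by_contra hne
  refine hχ (e := s(x, y)) (f := s(x, z)) hy hz ?_ ⟨x, by simp, by simp⟩ h
  intro h'
  rcases Sym2.eq_iff.1 h' with h | h
  · exact hne h.2
  · exact hne (h.2.trans h.1)

lemma ProperEdgeColoring.mono {G G' : SimpleGraph V} {χ : Sym2 V → ℕ}
    (hχ : ProperEdgeColoring G χ) (h : G' ≤ G) : ProperEdgeColoring G' χ :=
  fun _ _ he hf => hχ (SimpleGraph.edgeSet_mono h he) (SimpleGraph.edgeSet_mono h hf)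

/-- Greedy extension of a partial rainbow embedding. -/
theorem exists_rainbow_extension [Fintype W] (H : SimpleGraph W) (G : SimpleGraph V)
    (χ : Sym2 V → ℕ) (hχ : ProperEdgeColoring G χ) (S₀ : Finset W) (f₀ : W → V)
    (hinj : Set.InjOn f₀ S₀)
    (hadj : ∀ a ∈ S₀, ∀ b ∈ S₀, H.Adj a b → G.Adj (f₀ a) (f₀ b))
    (hrb : ∀ a ∈ S₀, ∀ b ∈ S₀, ∀ c ∈ S₀, ∀ d ∈ S₀, H.Adj a b → H.Adj c d →
      χ s(f₀ a, f₀ b) = χ s(f₀ c, f₀ d) → s(a, b) = s(c, d))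
    (C : W → Finset V) (q : ℕ)
    (hC1 : ∀ w ∉ S₀, ∀ w' ∉ S₀, H.Adj w' w → ∀ y ∈ C w', #{z ∈ C w | ¬ G.Adj y z} ≤ q)
    (hC2 : ∀ w ∉ S₀, ∀ w' ∈ S₀, H.Adj w' w → ∀ z ∈ C w, G.Adj (f₀ w') z)
    (hcard : ∀ w ∉ S₀, Fintype.card W * q + Fintype.card W + Fintype.card W ^ 3 < #(C w)) :
    ∃ f, RainbowEmb H G χ f ∧ (∀ w ∈ S₀, f w = f₀ w) ∧ ∀ w ∉ S₀, f w ∈ C w := by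
  have key : ∀ T : Finset W, T ⊆ S₀ᶜ → ∃ f : W → V, Set.InjOn f ↑(S₀ ∪ T) ∧
      (∀ a ∈ S₀ ∪ T, ∀ b ∈ S₀ ∪ T, H.Adj a b → G.Adj (f a) (f b)) ∧
      (∀ a ∈ S₀ ∪ T, ∀ b ∈ S₀ ∪ T, ∀ c ∈ S₀ ∪ T, ∀ d ∈ S₀ ∪ T, H.Adj a b → H.Adj c d →
        χ s(f a, f b) = χ s(f c, f d) → s(a, b) = s(c, d)) ∧
      (∀ w ∈ S₀, f w = f₀ w) ∧ ∀ w ∈ T, f w ∈ C w := by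
    intro T
    induction T using Finset.induction_on with
    | empty =>
      intro _
      exact ⟨f₀, by simpa using hinj, by simpa using hadj, by simpa using hrb, by simp, by simp⟩
    | insert w T hwT ih =>
      intro hT
      obtain ⟨f, h1, h2, h3, h4, h5⟩ := ih ((subset_insert _ _).trans hT)
      have hw0 : w ∉ S₀ := by simpa using hT (mem_insert_self w T)
      have hT0 : ∀ x ∈ T, x ∉ S₀ := fun x hx => by simpa using hT (mem_insert_of_mem hx)
      have hwS : w ∉ S₀ ∪ T := by simp [hw0, hwT]
      set B1 : Finset V := univ.image f
      set B2 : Finset V := (T.filter (fun w' => H.Adj w' w)).biUnion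
        (fun w' => {z ∈ C w | ¬ G.Adj (f w') z})
      set B3 : Finset V := (univ : Finset (W × W × W)).biUnion
        (fun p => {z ∈ C w | G.Adj (f p.1) z ∧ χ s(f p.1, z) = χ s(f p.2.1, f p.2.2)})
      have hB1 : #B1 ≤ Fintype.card W := card_image_le
      have hB2 : #B2 ≤ Fintype.card W * q := by
        refine (card_biUnion_le_card_mul _ _ q ?_).trans
          (Nat.mul_le_mul_right _ (card_le_univ _))
        intro w' hw'
        rw [mem_filter] at hw'
        exact hC1 w hw0 w' (hT0 _ hw'.1) hw'.2 _ (h5 _ hw'.1)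
      have hB3 : #B3 ≤ Fintype.card W ^ 3 := by
        refine (card_biUnion_le_card_mul _ _ 1 ?_).trans ?_
        · intro p _
          rw [card_le_one]
          intro y hy z hz
          rw [mem_filter] at hy hz
          exact hχ.eq_of_eq hy.2.1 hz.2.1 (hy.2.2.trans hz.2.2.symm)
        · simp only [card_univ, Fintype.card_prod, mul_one]
          exact le_of_eq (by ring)
      obtain ⟨z, hz, hzB⟩ : ∃ z ∈ C w, z ∉ B1 ∪ B2 ∪ B3 := by
        by_contra! hcon
        have : #(C w) ≤ #(B1 ∪ B2 ∪ B3) := card_le_card hcon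
        have h6 := card_union_le (B1 ∪ B2) B3
        have h7 := card_union_le B1 B2
        have := hcard w hw0
        omega
      simp only [mem_union, not_or] at hzB
      obtain ⟨⟨hz1, hz2⟩, hz3⟩ := hzB
      have hz1' : ∀ x, f x ≠ z := by
        intro x hx; exact hz1 (mem_image.2 ⟨x, mem_univ _, hx⟩)
      have hz2' : ∀ x ∈ S₀ ∪ T, H.Adj x w → G.Adj (f x) z := by
        intro x hx hxw
        rcases mem_union.1 hx with hx | hx
        · rw [h4 x hx]; exact hC2 w hw0 x hx hxw z hz
        · by_contra hn
          exact hz2 (mem_biUnion.2 ⟨x, mem_filter.2 ⟨hx, hxw⟩, mem_filter.2 ⟨hz, hn⟩⟩)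
      have hz3' : ∀ x a b, G.Adj (f x) z → χ s(f x, z) ≠ χ s(f a, f b) := by
        intro x a b hx he
        exact hz3 (mem_biUnion.2 ⟨(x, a, b), mem_univ _, mem_filter.2 ⟨hz, hx, he⟩⟩)
      have hne : ∀ x ∈ S₀ ∪ T, x ≠ w := fun x hx h => hwS (h ▸ hx)
      have hup : ∀ x ∈ S₀ ∪ T, Function.update f w z x = f x := fun x hx =>
        Function.update_of_ne (hne x hx) _ _
      have hupw : Function.update f w z w = z := Function.update_self _ _ _
      have hSi : S₀ ∪ insert w T = insert w (S₀ ∪ T) := by ext; simp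
      refine ⟨Function.update f w z, ?_, ?_, ?_, ?_, ?_⟩
      · rw [hSi]
        intro x hx y hy hxy
        rw [mem_coe, mem_insert] at hx hy
        rcases hx with rfl | hx <;> rcases hy with rfl | hy
        · rfl
        · rw [hupw, hup y hy] at hxy; exact absurd hxy.symm (hz1' y)
        · rw [hupw, hup x hx] at hxy; exact absurd hxy (hz1' x)
        · rw [hup x hx, hup y hy] at hxy; exact h1 hx hy hxy
      · rw [hSi]
        intro x hx y hy hxy
        rw [mem_insert] at hx hy
        rcases hx with rfl | hx <;> rcases hy with rfl | hy
        · exact absurd hxy (H.loopless.irrefl _)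
        · rw [hupw, hup y hy]; exact (hz2' y hy hxy.symm).symm
        · rw [hupw, hup x hx]; exact hz2' x hx hxy
        · rw [hup x hx, hup y hy]; exact h2 x hx y hy hxy
      · rw [hSi]
        have hred : ∀ a ∈ insert w (S₀ ∪ T), ∀ b ∈ insert w (S₀ ∪ T), H.Adj a b →
            (a ∈ S₀ ∪ T ∧ b ∈ S₀ ∪ T) ∨ ∃ x ∈ S₀ ∪ T, s(a, b) = s(x, w) ∧ H.Adj x w := by
          intro a ha b hb hab
          rw [mem_insert] at ha hb
          rcases ha with rfl | ha <;> rcases hb with rfl | hb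
          · exact absurd hab (H.loopless.irrefl _)
          · exact Or.inr ⟨b, hb, Sym2.eq_swap, hab.symm⟩
          · exact Or.inr ⟨a, ha, rfl, hab⟩
          · exact Or.inl ⟨ha, hb⟩
        have hmap : ∀ a b : W, s(Function.update f w z a, Function.update f w z b)
            = Sym2.map (Function.update f w z) s(a, b) := fun _ _ => rfl
        intro a ha b hb c hc d hd hab hcd he
        rcases hred a ha b hb hab with ⟨ha', hb'⟩ | ⟨x, hx, hxe, hxw⟩ <;>
        rcases hred c hc d hd hcd with ⟨hc', hd'⟩ | ⟨y, hy, hye, hyw⟩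
        · rw [hup a ha', hup b hb', hup c hc', hup d hd'] at he
          exact h3 a ha' b hb' c hc' d hd' hab hcd he
        · rw [hup a ha', hup b hb', hmap, hye, Sym2.map_mk, hupw, hup y hy] at he
          exact absurd he.symm (hz3' y a b (hz2' y hy hyw))
        · rw [hup c hc', hup d hd', hmap, hxe, Sym2.map_mk, hupw, hup x hx] at he
          exact absurd he (hz3' x c d (hz2' x hx hxw))
        · rw [hmap, hmap, hxe, hye, Sym2.map_mk, Sym2.map_mk, hupw, hup x hx, hup y hy] at he
          have := hχ.eq_of_eq (hz2' x hx hxw).symm (hz2' y hy hyw).symm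
            (by rw [Sym2.eq_swap, he, Sym2.eq_swap])
          rw [hxe, hye, h1 hx hy this]
      · intro x hx
        rw [hup x (mem_union_left _ hx), h4 x hx]
      · intro x hx
        rw [mem_insert] at hx
        rcases hx with rfl | hx
        · rw [hupw]; exact hz
        · rw [hup x (mem_union_right _ hx)]; exact h5 x hx
  obtain ⟨f, h1, h2, h3, h4, h5⟩ := key S₀ᶜ Subset.rfl
  have hu : ∀ x, x ∈ S₀ ∪ S₀ᶜ := by simp
  refine ⟨f, ⟨?_, fun a b => h2 a (hu a) b (hu b),
    fun a b c d => h3 a (hu a) b (hu b) c (hu c) d (hu d)⟩, h4, fun w hw => h5 w (by simpa using hw)⟩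
  intro x y hxy
  exact h1 (by simp) (by simp) hxy

end

section
open Finset
open scoped Classical

/-- The minimum degree form of the Erdős–Stone theorem inside a vertex subset. -/
theorem exists_blowup_of_degree.{u} {ε : ℝ} (hε : 0 < ε) (r t : ℕ) :
    ∃ N₀ : ℕ, ∀ {V : Type u} (G : SimpleGraph V) (A : Finset V), N₀ ≤ #A →
      (∀ v ∈ A, (1 - 1 / (r : ℝ) + ε) * #A ≤ #{w ∈ A | G.Adj v w}) →
      ∃ P : Fin (r + 1) → Finset V, (∀ i, P i ⊆ A ∧ #(P i) = t) ∧
        ∀ i j, i ≠ j → ∀ u ∈ P i, ∀ v ∈ P j, G.Adj u v := by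
  obtain ⟨N₀, hN⟩ := Filter.eventually_atTop.1
    (SimpleGraph.eventually_completeEquipartiteGraph_isContained_of_minDegree hε r t)
  refine ⟨N₀ + 1, fun {V} G A hA hdeg => ?_⟩
  let e : Fin #A ≃ A := A.equivFin.symm
  let g : Fin #A → V := fun i => (e i : V)
  have hg : Function.Injective g := Subtype.val_injective.comp e.injective
  let G' : SimpleGraph (Fin #A) := G.comap g
  have : Nonempty (Fin #A) := ⟨⟨0, by omega⟩⟩
  have hmin : (G'.minDegree : ℝ) ≥ (1 - 1 / (r : ℝ) + ε) * #A := by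
    obtain ⟨v, hv⟩ := G'.exists_minimal_degree_vertex
    rw [hv, ← SimpleGraph.card_neighborFinset_eq_degree]
    refine (hdeg (g v) (e v).2).trans ?_
    rw [Nat.cast_le, ← card_image_of_injective (G'.neighborFinset v) hg]
    apply card_le_card
    intro w hw
    rw [mem_filter] at hw
    refine mem_image.2 ⟨e.symm ⟨w, hw.1⟩, ?_, by simp [g]⟩
    rw [SimpleGraph.mem_neighborFinset]
    simpa [G', g] using hw.2
  obtain ⟨φ⟩ := hN #A (by omega) hmin
  refine ⟨fun i => univ.image (fun j => g (φ (i, j))), fun i => ⟨?_, ?_⟩, ?_⟩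
  · intro v hv
    obtain ⟨j, -, rfl⟩ := mem_image.1 hv
    exact (e _).2
  · rw [card_image_of_injective, card_univ, Fintype.card_fin]
    intro j j' h
    have := φ.injective (hg h)
    simpa using this
  · intro i j hij u hu v hv
    obtain ⟨a, -, rfl⟩ := mem_image.1 hu
    obtain ⟨b, -, rfl⟩ := mem_image.1 hv
    exact φ.toHom.map_rel (a := (i, a)) (b := (j, b)) hij

end

section
open Finset
open scoped Classical

/-- The degree of a vertex. -/
noncomputable def dg [Fintype V] (G : SimpleGraph V) (v : V) : ℕ := #{w | G.Adj v w}

/-- The edges of the copy of `H` given by `f`. -/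
def imgE (H : SimpleGraph W) (f : W → V) : Set (Sym2 V) := Sym2.map f '' H.edgeSet

/-- A family of edge-disjoint rainbow copies. -/
def IsPacking (H : SimpleGraph W) (G : SimpleGraph V) (χ : Sym2 V → ℕ)
    (F : Finset (W → V)) : Prop :=
  (∀ f ∈ F, RainbowEmb H G χ f) ∧ ∀ f ∈ F, ∀ g ∈ F, f ≠ g → Disjoint (imgE H f) (imgE H g)

/-- The edges covered by a family of copies. -/
def usedE (H : SimpleGraph W) (F : Finset (W → V)) : Set (Sym2 V) := ⋃ f ∈ F, imgE H f

/-- The graph that remains after removing the edges of a family of copies. -/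
def restG (H : SimpleGraph W) (G : SimpleGraph V) (F : Finset (W → V)) : SimpleGraph V :=
  G.deleteEdges (usedE H F)

/-- There are `N` edge-disjoint rainbow copies. -/
def HasPack (H : SimpleGraph W) (G : SimpleGraph V) (χ : Sym2 V → ℕ) (N : ℕ) : Prop :=
  ∃ F : Finset (W → V), IsPacking H G χ F ∧ #F = N

variable {H : SimpleGraph W} {G : SimpleGraph V} {χ : Sym2 V → ℕ}

lemma mk_mem_imgE {f : W → V} {x y : V} :
    s(x, y) ∈ imgE H f ↔ ∃ a b, H.Adj a b ∧ f a = x ∧ f b = y := by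
  constructor
  · rintro ⟨e, he, h⟩
    induction e with | _ a b
    rw [Sym2.map_mk, Sym2.eq_iff] at h
    rcases h with h | h
    · exact ⟨a, b, he, h⟩
    · exact ⟨b, a, SimpleGraph.Adj.symm he, h.2, h.1⟩
  · rintro ⟨a, b, h, rfl, rfl⟩
    exact ⟨s(a, b), h, rfl⟩

lemma mem_usedE {F : Finset (W → V)} {e : Sym2 V} :
    e ∈ usedE H F ↔ ∃ f ∈ F, e ∈ imgE H f := by
  simp [usedE]

lemma restG_adj {F : Finset (W → V)} {x y : V} :
    (restG H G F).Adj x y ↔ G.Adj x y ∧ s(x, y) ∉ usedE H F := by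
  simp [restG]

lemma restG_le (F : Finset (W → V)) : restG H G F ≤ G := SimpleGraph.deleteEdges_le _

lemma RainbowEmb.imgE_subset {f : W → V} (hf : RainbowEmb H G χ f) :
    imgE H f ⊆ G.edgeSet := by
  rintro e ⟨e', he', rfl⟩
  induction e' with | _ a b
  exact hf.2.1 a b he'

lemma RainbowEmb.mono {G' : SimpleGraph V} (h : G' ≤ G) {f : W → V}
    (hf : RainbowEmb H G' χ f) : RainbowEmb H G χ f :=
  ⟨hf.1, fun a b hab => h (hf.2.1 a b hab), hf.2.2⟩

lemma ncard_imgE {f : W → V} (hf : Function.Injective f) : (imgE H f).ncard = eCount H :=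
  Set.ncard_image_of_injective _ (Sym2.map.injective hf)

lemma isPacking_empty : IsPacking H G χ ∅ := ⟨by simp, by simp⟩

lemma hasPack_zero : HasPack H G χ 0 := ⟨∅, isPacking_empty, rfl⟩

lemma IsPacking.usedE_subset {F : Finset (W → V)} (hF : IsPacking H G χ F) :
    usedE H F ⊆ G.edgeSet := by
  intro e he
  obtain ⟨f, hf, h⟩ := mem_usedE.1 he
  exact (hF.1 f hf).imgE_subset h

lemma IsPacking.union {F F' : Finset (W → V)} (hF : IsPacking H G χ F)
    (hF' : IsPacking H (restG H G F) χ F') : IsPacking H G χ (F ∪ F') := by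
  have hd : ∀ f ∈ F, ∀ g ∈ F', Disjoint (imgE H f) (imgE H g) := by
    intro f hf g hg
    rw [Set.disjoint_left]
    intro e he he'
    have := (hF'.1 g hg).imgE_subset he'
    rw [restG, SimpleGraph.edgeSet_deleteEdges] at this
    exact this.2 (mem_usedE.2 ⟨f, hf, he⟩)
  refine ⟨fun f hf => ?_, fun f hf g hg hne => ?_⟩
  · rcases mem_union.1 hf with h | h
    · exact hF.1 f h
    · exact (hF'.1 f h).mono (restG_le F)
  · rcases mem_union.1 hf with h | h <;> rcases mem_union.1 hg with h' | h'
    · exact hF.2 f h g h' hne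
    · exact hd f h g h'
    · exact (hd g h' f h).symm
    · exact hF'.2 f h g h' hne

lemma RainbowEmb.imgE_nonempty {f : W → V} (hH : 0 < eCount H) (hf : RainbowEmb H G χ f) :
    (imgE H f).Nonempty := by
  rw [Set.nonempty_iff_ne_empty]
  intro h
  rw [← ncard_imgE hf.1, h] at hH
  simp at hH

lemma IsPacking.disjoint {F F' : Finset (W → V)} (hH : 0 < eCount H)
    (hF : IsPacking H G χ F) (hF' : IsPacking H (restG H G F) χ F') : Disjoint F F' := by
  rw [Finset.disjoint_left]
  intro f hf hf'
  obtain ⟨e, he⟩ := (hF.1 f hf).imgE_nonempty hH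
  have := (hF'.1 f hf').imgE_subset he
  rw [restG, SimpleGraph.edgeSet_deleteEdges] at this
  exact this.2 (mem_usedE.2 ⟨f, hf, he⟩)

lemma IsPacking.hasPack_add {F : Finset (W → V)} {N : ℕ} (hH : 0 < eCount H)
    (hF : IsPacking H G χ F) (hN : HasPack H (restG H G F) χ N) : HasPack H G χ (#F + N) := by
  obtain ⟨F', h1, rfl⟩ := hN
  exact ⟨F ∪ F', hF.union h1, card_union_of_disjoint (hF.disjoint hH h1)⟩

lemma IsPacking.insert {F : Finset (W → V)} {f : W → V} (hH : 0 < eCount H)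
    (hF : IsPacking H G χ F) (hf : RainbowEmb H (restG H G F) χ f) :
    IsPacking H G χ (insert f F) ∧ f ∉ F := by
  have h : IsPacking H (restG H G F) χ {f} := by
    refine ⟨fun g hg => ?_, fun g hg g' hg' hne => ?_⟩
    · rw [mem_singleton.1 hg]; exact hf
    · rw [mem_singleton.1 hg, mem_singleton.1 hg'] at hne; exact absurd rfl hne
  have := hF.union h
  refine ⟨by rwa [union_comm, ← insert_eq] at this, fun hfF => ?_⟩
  exact Finset.disjoint_left.1 (hF.disjoint hH h) hfF (mem_singleton_self f)

lemma ncard_usedE [Fintype W] (F : Finset (W → V)) (hF : ∀ f ∈ F, Function.Injective f)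
    (hd : ∀ f ∈ F, ∀ g ∈ F, f ≠ g → Disjoint (imgE H f) (imgE H g)) :
    (usedE H F).ncard = eCount H * #F ∧ (usedE H F).Finite := by
  induction F using Finset.induction_on with
  | empty => simp [usedE]
  | insert f F hf ih =>
    obtain ⟨h1, h2⟩ := ih (fun g hg => hF g (mem_insert_of_mem hg))
      (fun g hg g' hg' => hd g (mem_insert_of_mem hg) g' (mem_insert_of_mem hg'))
    have hu : usedE H (insert f F) = imgE H f ∪ usedE H F := by
      simp [usedE]
    have hfin : (imgE H f).Finite := (Set.toFinite _).image _
    rw [hu]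
    refine ⟨?_, hfin.union h2⟩
    rw [Set.ncard_union_eq ?_ hfin h2, h1, ncard_imgE (hF f (mem_insert_self _ _)),
      card_insert_of_notMem hf]
    · ring
    · rw [Set.disjoint_left]
      intro e he he'
      obtain ⟨g, hg, heg⟩ := mem_usedE.1 he'
      exact Set.disjoint_left.1 (hd f (mem_insert_self _ _) g (mem_insert_of_mem hg)
        (fun h => hf (h ▸ hg))) he heg

lemma IsPacking.ncard_usedE [Fintype W] {F : Finset (W → V)}
    (hF : IsPacking H G χ F) : (usedE H F).ncard = eCount H * #F :=
  (RainbowDecomp.ncard_usedE F (fun f hf => (hF.1 f hf).1) hF.2).1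

lemma IsPacking.eCount_restG [Fintype W] [Fintype V] {F : Finset (W → V)}
    (hF : IsPacking H G χ F) : eCount (restG H G F) + eCount H * #F = eCount G := by
  rw [eCount, restG, SimpleGraph.edgeSet_deleteEdges, ← hF.ncard_usedE]
  exact Set.ncard_sdiff_add_ncard_of_subset hF.usedE_subset (Set.toFinite _)

lemma IsPacking.phiR_add_le [Fintype W] [Fintype V] {F : Finset (W → V)} (hH : 0 < eCount H)
    (hF : IsPacking H G χ F) : phiR G H χ + (eCount H - 1) * #F ≤ eCount G := by
  let ι := F ⊕ ↥(G.edgeSet \ usedE H F)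
  let e := Fintype.equivFin ι
  let Q : ι → Set (Sym2 V) := Sum.elim (fun f => imgE H f.1) (fun x => {x.1})
  have hmem : ∃ P : Fin (Fintype.card ι) → Set (Sym2 V), IsRainbowHDecomp G H χ P := by
    refine ⟨fun i => Q (e.symm i), ⟨?_, ?_⟩, ?_⟩
    · intro i
      change Q (e.symm i) ⊆ G.edgeSet
      rcases h : e.symm i with f | x
      · exact (hF.1 f.1 f.2).imgE_subset
      · simpa [Q] using x.2.1
    · intro x hx
      by_cases hu : x ∈ usedE H F
      · obtain ⟨f, hf, hxf⟩ := mem_usedE.1 hu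
        refine ⟨e (Sum.inl ⟨f, hf⟩), by simpa [Q] using hxf, ?_⟩
        intro i hi
        change x ∈ Q (e.symm i) at hi
        rw [← e.symm_apply_eq]
        rcases h : e.symm i with g | y
        · rw [h] at hi
          simp only [Q, Sum.elim_inl] at hi
          congr 1
          by_contra hne
          exact Set.disjoint_left.1 (hF.2 f hf g.1 g.2
            (fun h => hne (Subtype.ext h.symm))) hxf hi
        · rw [h] at hi
          simp only [Q, Sum.elim_inr, Set.mem_singleton_iff] at hi
          exact absurd (hi ▸ hu) y.2.2
      · refine ⟨e (Sum.inr ⟨x, hx, hu⟩), by simp [Q], ?_⟩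
        intro i hi
        change x ∈ Q (e.symm i) at hi
        rw [← e.symm_apply_eq]
        rcases h : e.symm i with g | y
        · rw [h] at hi
          simp only [Q, Sum.elim_inl] at hi
          exact absurd (mem_usedE.2 ⟨g.1, g.2, hi⟩) hu
        · rw [h] at hi
          simp only [Q, Sum.elim_inr, Set.mem_singleton_iff] at hi
          congr 1
          exact Subtype.ext hi.symm
    · intro i
      change (∃ x, Q (e.symm i) = {x}) ∨ IsCopyEdgeSet H G (Q (e.symm i)) ∧
        Set.InjOn χ (Q (e.symm i))
      rcases h : e.symm i with f | x
      · right
        have hf := hF.1 f.1 f.2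
        refine ⟨⟨f.1, hf.1, fun a b => hf.2.1 a b, rfl⟩, ?_⟩
        rintro _ ⟨x, hx, rfl⟩ _ ⟨y, hy, rfl⟩ hxy
        induction x with | _ a b
        induction y with | _ c d
        exact congrArg _ (hf.2.2 a b c d hx hy hxy)
      · exact Or.inl ⟨x.1, rfl⟩
  have h1 : phiR G H χ ≤ Fintype.card ι := Nat.sInf_le hmem
  have h2 : Fintype.card ι = #F + (G.edgeSet \ usedE H F).ncard := by
    rw [Fintype.card_sum, Fintype.card_coe, ← Nat.card_eq_fintype_card, Nat.card_coe_set_eq]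
  have h3 := hF.eCount_restG
  rw [eCount, restG, SimpleGraph.edgeSet_deleteEdges] at h3
  have h4 : eCount H * #F = (eCount H - 1) * #F + #F := by
    obtain ⟨k, hk⟩ : ∃ k, eCount H = k + 1 := ⟨eCount H - 1, by omega⟩
    rw [hk]; simp; ring
  omega

lemma phiR_eq_of_free [Fintype W] [Fintype V] (hH : 0 < eCount H)
    (hfree : ¬ ContainsCopy H G) : phiR G H χ = eCount G := by
  have h0 := (isPacking_empty (H := H) (G := G) (χ := χ)).phiR_add_le hH
  refine le_antisymm (by simpa using h0) ?_
  have hne : {t | ∃ P : Fin t → Set (Sym2 V), IsRainbowHDecomp G H χ P}.Nonempty := by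
    by_contra hcon
    rw [Set.not_nonempty_iff_eq_empty] at hcon
    let e := Fintype.equivFin G.edgeSet
    have : Fintype.card G.edgeSet ∈
        {t | ∃ P : Fin t → Set (Sym2 V), IsRainbowHDecomp G H χ P} := by
      refine ⟨fun i => {(e.symm i).1}, ⟨fun i => by simp, fun x hx =>
        ⟨e ⟨x, hx⟩, by simp, fun i hi => ?_⟩⟩, fun i => Or.inl ⟨_, rfl⟩⟩
      rw [← e.symm_apply_eq]
      exact Subtype.ext (Set.mem_singleton_iff.1 hi).symm
    rw [hcon] at this
    exact this
  obtain ⟨P, ⟨h1, h2⟩, h3⟩ := Nat.sInf_mem hne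
  change eCount G ≤ sInf {t | ∃ P : Fin t → Set (Sym2 V), IsRainbowHDecomp G H χ P}
  have h3' : ∀ i, ∃ e, P i = {e} := fun i => (h3 i).resolve_right fun h => by
    obtain ⟨⟨f, hf, hf', -⟩, -⟩ := h
    exact hfree ⟨f, hf, hf'⟩
  choose p hp using h3'
  have : G.edgeSet ⊆ ↑(univ.image p) := by
    intro x hx
    obtain ⟨i, hi, -⟩ := h2 x hx
    rw [hp i] at hi
    simp only [coe_image, coe_univ, Set.image_univ, Set.mem_range]
    exact ⟨i, (Set.mem_singleton_iff.1 hi).symm⟩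
  have h5 := Set.ncard_le_ncard this (Set.toFinite _)
  rw [Set.ncard_coe_finset] at h5
  exact h5.trans (card_image_le.trans (by simp))

end

section
open Finset
open scoped Classical
variable {H : SimpleGraph W} {G : SimpleGraph V} {χ : Sym2 V → ℕ}

lemma dg_eq_degree [Fintype V] (G : SimpleGraph V) (v : V) : dg G v = G.degree v := by
  rw [dg, ← SimpleGraph.card_neighborFinset_eq_degree]
  congr 1
  ext w
  simp

lemma eCount_eq_card [Fintype V] (G : SimpleGraph V) : eCount G = #G.edgeFinset := by
  rw [eCount, ← SimpleGraph.coe_edgeFinset, Set.ncard_coe_finset]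

lemma sum_dg [Fintype V] (G : SimpleGraph V) : ∑ v, dg G v = 2 * eCount G := by
  simp_rw [dg_eq_degree, eCount_eq_card, SimpleGraph.sum_degrees_eq_twice_card_edges]

lemma dg_le_card [Fintype V] (G : SimpleGraph V) (v : V) : dg G v ≤ Fintype.card V := by
  rw [dg]; exact card_le_univ _

lemma two_mul_eCount_le [Fintype V] (G : SimpleGraph V) :
    2 * eCount G ≤ Fintype.card V ^ 2 := by
  rw [← sum_dg, sq]
  refine (sum_le_sum fun v _ => dg_le_card G v).trans ?_
  simp

lemma eCount_le_sq [Fintype V] (G : SimpleGraph V) : eCount G ≤ Fintype.card V ^ 2 := by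
  have := two_mul_eCount_le G
  omega

/-- Deleting a vertex. -/
abbrev delV (G : SimpleGraph V) (x : V) : SimpleGraph ({x}ᶜ : Set V) := G.induce {x}ᶜ

lemma eCount_delV [Fintype V] (G : SimpleGraph V) (x : V) :
    eCount (delV G x) + dg G x = eCount G := by
  have h := SimpleGraph.card_edgeFinset_induce_compl_singleton G x
  have h2 := SimpleGraph.degree_le_card_edgeFinset G x
  rw [eCount_eq_card, eCount_eq_card, dg_eq_degree]
  convert Nat.sub_add_cancel h2 using 2
  rw [← SimpleGraph.card_edgeFinset_deleteIncidenceSet]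
  convert h

lemma card_delV [Fintype V] (x : V) :
    Fintype.card ({x}ᶜ : Set V) + 1 = Fintype.card V := by
  have : 0 < Fintype.card V := Fintype.card_pos_iff.2 ⟨x⟩
  have h : Fintype.card ({x}ᶜ : Set V) = Fintype.card V - 1 := by
    rw [Fintype.card_compl_set]; simp
  omega

lemma dg_le_dg_delV_add_one [Fintype V] (G : SimpleGraph V) (x : V) (v : ({x}ᶜ : Set V)) :
    dg G v ≤ dg (delV G x) v + 1 := by
  have : ({w | G.Adj v w} : Finset V) ⊆
      insert x (image Subtype.val ({w | (delV G x).Adj v w} : Finset ({x}ᶜ : Set V))) := by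
    intro w hw
    rw [mem_insert]
    by_cases hx : w = x
    · exact Or.inl hx
    · exact Or.inr (mem_image.2 ⟨⟨w, hx⟩, by simpa using hw, rfl⟩)
  refine (card_le_card this).trans ((card_insert_le _ _).trans ?_)
  exact Nat.add_le_add_right card_image_le _

lemma ProperEdgeColoring.comap {V' : Type*} (hχ : ProperEdgeColoring G χ) (g : V' → V)
    (hg : Function.Injective g) :
    ProperEdgeColoring (G.comap g) (χ ∘ Sym2.map g) := by
  intro e f he hf hne hv
  obtain ⟨v, hv1, hv2⟩ := hv
  refine hχ ?_ ?_ (fun h => hne (Sym2.map.injective hg h))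
    ⟨g v, Sym2.mem_map.2 ⟨v, hv1, rfl⟩, Sym2.mem_map.2 ⟨v, hv2, rfl⟩⟩
  · induction e with | _ a b
    exact he
  · induction f with | _ a b
    exact hf

lemma imgE_comp {V' : Type*} (g : V' → V) (f : W → V') :
    imgE H (g ∘ f) = Sym2.map g '' imgE H f := by
  rw [imgE, imgE, Set.image_image, Sym2.map_comp]
  rfl

lemma HasPack.of_comap {V' : Type*} (g : V' → V) (hg : Function.Injective g) {N : ℕ}
    (h : HasPack H (G.comap g) (χ ∘ Sym2.map g) N) : HasPack H G χ N := by
  obtain ⟨F, ⟨h1, h2⟩, rfl⟩ := h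
  have hinj : Function.Injective (fun f : W → V' => g ∘ f) := fun f f' h =>
    funext fun w => hg (congrFun h w)
  refine ⟨F.image (fun f => g ∘ f), ⟨?_, ?_⟩, card_image_of_injective _ hinj⟩
  · intro f' hf'
    obtain ⟨f, hf, rfl⟩ := mem_image.1 hf'
    obtain ⟨h3, h4, h5⟩ := h1 f hf
    exact ⟨hg.comp h3, h4, h5⟩
  · intro f' hf' k' hk' hne
    obtain ⟨f, hf, rfl⟩ := mem_image.1 hf'
    obtain ⟨k, hk, rfl⟩ := mem_image.1 hk'
    rw [imgE_comp, imgE_comp]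
    exact (Set.disjoint_image_iff (Sym2.map.injective hg)).2
      (h2 f hf k hk fun h => hne (by rw [h]))

/-- The number of edges of the Turán graph. -/
noncomputable def tn (s n : ℕ) : ℕ := eCount (SimpleGraph.turanGraph n s)

lemma tn_eq (s n : ℕ) (hs : 0 < s) :
    (tn s n : ℝ) = (1 - 1 / (s : ℝ)) * n ^ 2 / 2 - (n % s : ℕ) * (s - (n % s : ℕ)) / (2 * s) := by
  have h := SimpleGraph.card_edgeFinset_turanGraph (n := n) (r := s)
  have h' : tn s n = (n ^ 2 - (n % s) ^ 2) * (s - 1) / (2 * s) + (n % s).choose 2 := by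
    rw [← h, tn, eCount_eq_card]
    congr!
  obtain ⟨p, rfl⟩ : ∃ p, s = p + 1 := ⟨s - 1, by omega⟩
  set ρ := n % (p + 1) with hρ
  obtain ⟨m, hm⟩ : ∃ m, n = (p + 1) * m + ρ := ⟨n / (p + 1), (Nat.div_add_mod n (p + 1)).symm⟩
  have e1 : (p + 1).choose 2 * 2 = (p + 1) * p := by
    rw [Nat.choose_two_right, Nat.add_sub_cancel]
    exact Nat.div_mul_cancel (by rw [mul_comm]; exact (Nat.even_mul_succ_self p).two_dvd)
  have e2 : (n ^ 2 - ρ ^ 2) * (p + 1 - 1) =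
      2 * (p + 1) * ((p + 1).choose 2 * m ^ 2 + m * ρ * p) := by
    have : n ^ 2 - ρ ^ 2 = (p + 1) * m * ((p + 1) * m + 2 * ρ) := by
      apply Nat.sub_eq_of_eq_add
      rw [hm]; ring
    rw [this, Nat.add_sub_cancel]
    zify at e1 ⊢
    linear_combination (-((m : ℤ) ^ 2 * (p + 1))) * e1
  rw [e2, Nat.mul_div_cancel_left _ (by positivity)] at h'
  have e3 : ((ρ.choose 2 : ℕ) : ℝ) = ρ * (ρ - 1) / 2 := Nat.cast_choose_two ℝ ρ
  have e4 : (((p + 1).choose 2 : ℕ) : ℝ) = (p + 1) * p / 2 := by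
    rw [Nat.cast_choose_two]; push_cast; ring
  have hn : (n : ℝ) = (p + 1) * m + ρ := by exact_mod_cast hm
  rw [h', hn]
  push_cast
  rw [e3, e4]
  field_simp
  ring

lemma tn_le (s n : ℕ) (hs : 0 < s) : (tn s n : ℝ) ≤ (1 - 1 / (s : ℝ)) * n ^ 2 / 2 := by
  rw [tn_eq s n hs]
  have : (0 : ℝ) ≤ (n % s : ℕ) * (s - (n % s : ℕ)) / (2 * s) := by
    have : ((n % s : ℕ) : ℝ) ≤ s := by exact_mod_cast (Nat.mod_lt n hs).le
    have : (0 : ℝ) ≤ s - (n % s : ℕ) := by linarith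
    positivity
  linarith

lemma le_tn (s n : ℕ) (hs : 0 < s) : (1 - 1 / (s : ℝ)) * n ^ 2 / 2 - s ≤ (tn s n : ℝ) := by
  rw [tn_eq s n hs]
  have hs' : (0 : ℝ) < s := by exact_mod_cast hs
  have : ((n % s : ℕ) : ℝ) * (s - (n % s : ℕ)) / (2 * s) ≤ s := by
    have h1 : ((n % s : ℕ) : ℝ) ≤ s := by exact_mod_cast (Nat.mod_lt n hs).le
    have h2 : (0 : ℝ) ≤ (n % s : ℕ) := by positivity
    rw [div_le_iff₀ (by positivity)]
    nlinarith
  linarith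

end

section
open Finset
open scoped Classical
variable {H : SimpleGraph W} {G : SimpleGraph V} {χ : Sym2 V → ℕ}

/-- The degree of `v` in the copy of `H` given by `f`. -/
noncomputable def udg [Fintype V] (H : SimpleGraph W) (f : W → V) (v : V) : ℕ :=
  #{w | s(v, w) ∈ imgE H f}

lemma udg_apply [Fintype V] [Fintype W] {f : W → V} (hf : Function.Injective f) (u : W) :
    udg H f (f u) = dg H u := by
  rw [udg, dg, ← card_image_of_injective _ hf]
  congr 1
  ext w
  simp only [mem_filter, mem_univ, true_and, mem_image, mk_mem_imgE]
  constructor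
  · rintro ⟨p, q, hpq, h1, rfl⟩
    exact ⟨q, hf h1 ▸ hpq, rfl⟩
  · rintro ⟨q, hq, rfl⟩
    exact ⟨u, q, hq, rfl, rfl⟩

lemma udg_of_notMem [Fintype V] {f : W → V} {v : V} (h : ∀ u, f u ≠ v) : udg H f v = 0 := by
  rw [udg, card_eq_zero, filter_eq_empty_iff]
  intro w _ hw
  obtain ⟨p, q, -, h1, -⟩ := mk_mem_imgE.1 hw
  exact h p h1

lemma udg_le [Fintype V] [Fintype W] {f : W → V} (hf : Function.Injective f) (v : V) :
    udg H f v ≤ Fintype.card W := by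
  by_cases h : ∃ u, f u = v
  · obtain ⟨u, rfl⟩ := h
    rw [udg_apply hf]
    exact dg_le_card H u
  · rw [udg_of_notMem fun u hu => h ⟨u, hu⟩]
    exact Nat.zero_le _

lemma card_usedE_nbrs [Fintype V] {F : Finset (W → V)} (hF : IsPacking H G χ F) (v : V) :
    #{w | s(v, w) ∈ usedE H F} = ∑ f ∈ F, udg H f v := by
  have : ({w | s(v, w) ∈ usedE H F} : Finset V) =
      F.biUnion fun f => ({w | s(v, w) ∈ imgE H f} : Finset V) := by
    ext w
    simp [mem_usedE]
  rw [this, card_biUnion]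
  · rfl
  · intro f hf g hg hne
    rw [Function.onFun, Finset.disjoint_left]
    intro w hw hw'
    exact Set.disjoint_left.1 (hF.2 f hf g hg hne) (mem_filter.1 hw).2 (mem_filter.1 hw').2

lemma IsPacking.dg_restG [Fintype V] {F : Finset (W → V)} (hF : IsPacking H G χ F) (v : V) :
    dg (restG H G F) v + ∑ f ∈ F, udg H f v = dg G v := by
  rw [← card_usedE_nbrs hF, dg, dg, ← card_union_of_disjoint]
  · congr 1
    ext w
    simp only [mem_union, mem_filter, mem_univ, true_and, restG_adj]
    constructor
    · rintro (h | h)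
      · exact h.1
      · exact hF.usedE_subset h
    · intro h
      by_cases hu : s(v, w) ∈ usedE H F
      · exact Or.inr hu
      · exact Or.inl ⟨h, hu⟩
  · rw [Finset.disjoint_left]
    intro w hw hw'
    exact (restG_adj.1 (mem_filter.1 hw).2).2 (mem_filter.1 hw').2

lemma sum_udg_center [Fintype V] [Fintype W] {F : Finset (W → V)} (hF : IsPacking H G χ F)
    {a : W} {x : V} (hx : ∀ f ∈ F, f a = x) : ∑ f ∈ F, udg H f x = dg H a * #F := by
  rw [sum_congr rfl (g := fun _ => dg H a), sum_const, smul_eq_mul, mul_comm]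
  intro f hf
  rw [← hx f hf, udg_apply (hF.1 f hf).1]

lemma IsPacking.eCount_delV [Fintype V] [Fintype W] {F : Finset (W → V)}
    (hF : IsPacking H G χ F) {a : W} {x : V} (hx : ∀ f ∈ F, f a = x) :
    eCount (delV (restG H G F) x) + eCount H * #F + dg G x = eCount G + dg H a * #F := by
  have h1 := RainbowDecomp.eCount_delV (restG H G F) x
  have h2 := hF.eCount_restG
  have h3 := hF.dg_restG x
  rw [sum_udg_center hF hx] at h3
  omega

lemma IsPacking.hasPack_delV {F : Finset (W → V)} (hH : 0 < eCount H)
    (hF : IsPacking H G χ F) {x : V} {N : ℕ}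
    (hN : HasPack H (delV (restG H G F) x) (χ ∘ Sym2.map Subtype.val) N) :
    HasPack H G χ (#F + N) :=
  hF.hasPack_add hH (hN.of_comap _ Subtype.val_injective)

lemma exists_min_dg [Fintype V] [Nonempty V] (G : SimpleGraph V) : ∃ x, ∀ v, dg G x ≤ dg G v := by
  obtain ⟨x, -, hx⟩ := exists_min_image (univ : Finset V) (dg G) univ_nonempty
  exact ⟨x, fun v => hx v (mem_univ v)⟩

lemma tau_le_of_le (s n : ℕ) (hs : 0 < s) : 0 ≤ (1 - 1 / (s : ℝ)) * n ^ 2 / 2 := by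
  have : 1 / (s : ℝ) ≤ 1 := by
    rw [div_le_one (by exact_mod_cast hs)]; exact_mod_cast hs
  have : 0 ≤ 1 - 1 / (s : ℝ) := by linarith
  positivity

/-- There are rainbow packings that leave only few edges, counted with weight `γ` for the
members of the packing. -/
def PackBound (H : SimpleGraph W) (s : ℕ) (γ : ℝ) : Prop :=
  ∀ ε : ℝ, 0 < ε → ∃ C : ℝ, ∀ (V : Type) [Fintype V] (G : SimpleGraph V) (χ : Sym2 V → ℕ),
    ProperEdgeColoring G χ → ∃ N : ℕ, HasPack H G χ N ∧
      (eCount G : ℝ) - (eCount H - 1 - γ) * N ≤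
        (1 - 1 / (s : ℝ)) * (Fintype.card V : ℝ) ^ 2 / 2 + ε * (Fintype.card V : ℝ) ^ 2 + C

theorem packBound_of_step [Fintype W] (hH : 0 < eCount H) (s : ℕ) (hs : 0 < s) (γ : ℝ) (a : W)
    (hstep : ∀ ε : ℝ, 0 < ε → ∃ n₀ : ℕ, ∀ (V : Type) [Fintype V] (G : SimpleGraph V)
      (χ : Sym2 V → ℕ), ProperEdgeColoring G χ → n₀ ≤ Fintype.card V →
      (∃ N : ℕ, HasPack H G χ N ∧ (eCount G : ℝ) - (eCount H - 1 - γ) * N ≤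
        (1 - 1 / (s : ℝ)) * (Fintype.card V : ℝ) ^ 2 / 2 + ε * (Fintype.card V : ℝ) ^ 2) ∨
      ∃ (x : V) (F : Finset (W → V)), IsPacking H G χ F ∧ (∀ f ∈ F, f a = x) ∧
        (dg G x : ℝ) - (dg H a - 1 - γ) * #F ≤
          (1 - 1 / (s : ℝ)) * Fintype.card V + ε * Fintype.card V) :
    PackBound H s γ := by
  intro ε hε
  obtain ⟨n₀, hn₀⟩ := hstep (ε / 2) (by positivity)
  obtain ⟨m₀, hm₀⟩ := exists_nat_gt (1 / ε * 2)
  refine ⟨((max n₀ (m₀ + 1) : ℕ) : ℝ) ^ 2, ?_⟩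
  suffices h : ∀ n : ℕ, ∀ (V : Type) [Fintype V] (G : SimpleGraph V) (χ : Sym2 V → ℕ),
      Fintype.card V = n → ProperEdgeColoring G χ → ∃ N : ℕ, HasPack H G χ N ∧
      (eCount G : ℝ) - (eCount H - 1 - γ) * N ≤
        (1 - 1 / (s : ℝ)) * (n : ℝ) ^ 2 / 2 + ε * (n : ℝ) ^ 2 +
          ((max n₀ (m₀ + 1) : ℕ) : ℝ) ^ 2 by
    intro V _ G χ hχ
    exact h _ V G χ rfl hχ
  intro n
  induction n with
  | zero =>
    intro V _ G χ hn hχ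
    refine ⟨0, hasPack_zero, ?_⟩
    have := eCount_le_sq G
    rw [hn] at this
    have : eCount G = 0 := by simpa using this
    rw [this]
    simp
  | succ n ih =>
    intro V _ G χ hn hχ
    by_cases hsm : n + 1 < max n₀ (m₀ + 1)
    · refine ⟨0, hasPack_zero, ?_⟩
      have h1 : (eCount G : ℝ) ≤ ((n + 1 : ℕ) : ℝ) ^ 2 := by
        have := eCount_le_sq G
        rw [hn] at this
        exact_mod_cast this
      have h2 : ((n + 1 : ℕ) : ℝ) ^ 2 ≤ ((max n₀ (m₀ + 1) : ℕ) : ℝ) ^ 2 := by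
        have : ((n + 1 : ℕ) : ℝ) ≤ ((max n₀ (m₀ + 1) : ℕ) : ℝ) := by exact_mod_cast hsm.le
        gcongr
      have h3 := tau_le_of_le s (n + 1) hs
      have h4 : 0 ≤ ε * ((n + 1 : ℕ) : ℝ) ^ 2 := by positivity
      simp only [Nat.cast_zero, mul_zero, sub_zero]
      linarith
    · push Not at hsm
      have hn1 : n₀ ≤ n + 1 := (le_max_left _ _).trans hsm
      have hn2 : m₀ + 1 ≤ n + 1 := (le_max_right _ _).trans hsm
      rcases hn₀ V G χ hχ (by omega) with ⟨N, hN, h⟩ | ⟨x, F, hF, hx, h⟩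
      · refine ⟨N, hN, h.trans ?_⟩
        rw [hn]
        have : ε / 2 * ((n + 1 : ℕ) : ℝ) ^ 2 ≤ ε * ((n + 1 : ℕ) : ℝ) ^ 2 := by
          gcongr; linarith
        have : (0 : ℝ) ≤ ((max n₀ (m₀ + 1) : ℕ) : ℝ) ^ 2 := by positivity
        linarith
      · have hχ' : ProperEdgeColoring (delV (restG H G F) x) (χ ∘ Sym2.map Subtype.val) :=
          (hχ.mono (restG_le F)).comap _ Subtype.val_injective
        have hc := card_delV x
        obtain ⟨N, hN, hb⟩ := ih ({x}ᶜ : Set V) _ _ (by omega) hχ'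
        refine ⟨#F + N, hF.hasPack_delV hH hN, ?_⟩
        have he : (eCount (delV (restG H G F) x) : ℝ) + eCount H * #F + dg G x =
            eCount G + dg H a * #F := by exact_mod_cast hF.eCount_delV hx
        have hn3 : 1 / ε * 2 ≤ (n : ℝ) := hm₀.le.trans (by exact_mod_cast (by omega : m₀ ≤ n))
        have hn4 : 2 ≤ ε * n := by
          calc 2 = ε * (1 / ε * 2) := by field_simp
            _ ≤ ε * n := by gcongr
        rw [hn] at h
        generalize ((max n₀ (m₀ + 1) : ℕ) : ℝ) ^ 2 = M at hb ⊢
        push_cast at h ⊢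
        have h1s : 0 ≤ 1 / (s : ℝ) := by positivity
        have h1s' : 1 / (s : ℝ) ≤ 1 := by
          rw [div_le_one (by exact_mod_cast hs)]; exact_mod_cast hs
        generalize 1 / (s : ℝ) = q at *
        have e1 : (1 - q) * ((n : ℝ) + 1) ≤ (1 - q) * ((n + 1) ^ 2 / 2 - n ^ 2 / 2) + 1 / 2 := by
          nlinarith
        linarith
end

section
open Finset
open scoped Classical
variable {H : SimpleGraph W} {G : SimpleGraph V} {χ : Sym2 V → ℕ}

lemma IsPacking.sum_udg [Fintype V] [Fintype W] {F : Finset (W → V)} (hF : IsPacking H G χ F) :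
    ∑ v, ∑ f ∈ F, udg H f v = 2 * (eCount H * #F) := by
  have h1 := sum_dg G
  have h2 := sum_dg (restG H G F)
  have h3 := hF.eCount_restG
  have h4 : ∑ v, (dg (restG H G F) v + ∑ f ∈ F, udg H f v) = ∑ v, dg G v :=
    sum_congr rfl fun v _ => hF.dg_restG v
  rw [sum_add_distrib] at h4
  omega

lemma card_filter_mul_le {ι : Type*} (A : Finset ι) (g : ι → ℕ) (t : ℝ) :
    (#{y ∈ A | t ≤ (g y : ℝ)} : ℝ) * t ≤ ∑ y ∈ A, g y := by
  rw [← nsmul_eq_mul]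
  push_cast
  calc _ ≤ ∑ y ∈ A with t ≤ (g y : ℝ), (g y : ℝ) :=
        card_nsmul_le_sum _ _ _ fun y hy => (mem_filter.1 hy).2
    _ ≤ _ := sum_le_sum_of_subset_of_nonneg (filter_subset _ _) fun _ _ _ => by positivity

lemma dg_inter [Fintype V] (G : SimpleGraph V) (A : Finset V) (y : V) :
    #A + dg G y ≤ #{w ∈ A | G.Adj y w} + Fintype.card V := by
  have h1 : #{w ∈ A | G.Adj y w} = #(A ∩ ({w | G.Adj y w} : Finset V)) := by
    congr 1; ext w; simp
  have h2 := card_union_add_card_inter A ({w | G.Adj y w} : Finset V)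
  have h3 := card_le_univ (A ∪ ({w | G.Adj y w} : Finset V))
  rw [h1, dg]
  omega

lemma IsPacking.exists_insert {F : Finset (W → V)} {f : W → V} (hH : 0 < eCount H)
    (hF : IsPacking H G χ F) (hf : RainbowEmb H (restG H G F) χ f) :
    ∃ F', IsPacking H G χ F' ∧ #F' = #F + 1 ∧ (∀ g, g ∈ F' ↔ g = f ∨ g ∈ F) ∧ f ∉ F :=
  ⟨Insert.insert f F, (hF.insert hH hf).1, card_insert_of_notMem (hF.insert hH hf).2,
    fun _ => mem_insert, (hF.insert hH hf).2⟩

/-- Many edge-disjoint rainbow copies in which a given vertex of minimum degree plays the role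
of `a`. -/
theorem exists_center_packing [Fintype W] (p : ℕ) (hp : 1 ≤ p) (a : W) (ha : 0 < dg H a)
    (hH : 0 < eCount H) (c : W → Fin (p + 1))
    (hc : ∀ u v, H.Adj u v → u ≠ a → v ≠ a → c u ≠ c v) (ε : ℝ) (hε : 0 < ε) :
    ∃ n₀ : ℕ, ∀ (V : Type) [Fintype V] (G : SimpleGraph V) (χ : Sym2 V → ℕ) (x : V),
      ProperEdgeColoring G χ → n₀ ≤ Fintype.card V → (∀ v, dg G x ≤ dg G v) →
      ∃ F : Finset (W → V), IsPacking H G χ F ∧ (∀ f ∈ F, f a = x) ∧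
        dg G x - p * (Fintype.card V - dg G x : ℝ) - ε * Fintype.card V ≤ dg H a * #F := by
  have hp0 : (1 : ℝ) ≤ p := by exact_mod_cast hp
  set e₁ : ℝ := ε / (4 * p) with he₁
  have he₁p : 0 < e₁ := by positivity
  obtain ⟨N₀, hN₀⟩ := exists_blowup_of_degree.{0} he₁p p (Fintype.card W + Fintype.card W ^ 3 + 1)
  obtain ⟨n₀, hn₀⟩ := exists_nat_gt ((2 * eCount H / e₁ + N₀) * 2 / ε)
  refine ⟨n₀, fun V _ G χ x hχ hn hx => ?_⟩
  set n := Fintype.card V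
  obtain ⟨F, hF, hmax⟩ := exists_max_image
    (univ.filter fun F : Finset (W → V) => IsPacking H G χ F ∧ ∀ f ∈ F, f a = x) card
    ⟨∅, by simp [isPacking_empty]⟩
  obtain ⟨hF, hFx⟩ := (mem_filter.1 hF).2
  refine ⟨F, hF, hFx, ?_⟩
  by_contra! hlt
  set G1 := restG H G F
  have hd : (dg G1 x : ℝ) + dg H a * #F = dg G x := by
    have h1 := hF.dg_restG x
    rw [sum_udg_center hF hFx] at h1
    exact_mod_cast h1
  have hdn : (dg G x : ℝ) ≤ n := by exact_mod_cast dg_le_card G x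
  have hFn : (#F : ℝ) ≤ n := by
    have : (1 : ℝ) ≤ dg H a := by exact_mod_cast ha
    have h2 : (0 : ℝ) ≤ dg G1 x := by positivity
    have h3 : (0 : ℝ) ≤ #F := by positivity
    nlinarith
  set ud : V → ℕ := fun v => ∑ f ∈ F, udg H f v with hud
  set Bad : Finset V := {y | e₁ * n ≤ (ud y : ℝ)} with hBad
  have hnpos : (0 : ℝ) < n := by
    have : 0 < n := Fintype.card_pos_iff.2 ⟨x⟩
    exact_mod_cast this
  have hbad : (#Bad : ℝ) ≤ 2 * eCount H / e₁ := by
    have h1 := card_filter_mul_le univ ud (e₁ * n)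
    rw [hud, hF.sum_udg] at h1
    rw [le_div_iff₀ he₁p]
    have h2 : (#Bad : ℝ) * (e₁ * n) ≤ 2 * eCount H * n := by
      refine h1.trans ?_
      push_cast
      have : (eCount H : ℝ) * #F ≤ eCount H * n := by gcongr
      linarith
    have h3 : (#Bad * e₁) * n ≤ (2 * eCount H) * n := by linarith
    exact le_of_mul_le_mul_right h3 hnpos
  have hn1 : (2 * eCount H / e₁ + N₀) * 2 ≤ ε * n := by
    have : (2 * eCount H / e₁ + N₀) * 2 / ε ≤ n := hn₀.le.trans (by exact_mod_cast hn)
    rw [div_le_iff₀ hε] at this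
    linarith
  set A : Finset V := {w | G1.Adj x w ∧ w ∉ Bad} with hA
  have hAc : (dg G1 x : ℝ) ≤ #A + #Bad := by
    have : dg G1 x ≤ #A + #Bad := by
      refine (card_le_card (t := A ∪ Bad) fun w hw => ?_).trans (card_union_le _ _)
      rw [mem_union, hA, mem_filter]
      by_cases hb : w ∈ Bad
      · exact Or.inr hb
      · exact Or.inl ⟨mem_univ _, (mem_filter.1 hw).2, hb⟩
    exact_mod_cast this
  have hAn : (#A : ℝ) ≤ n := by exact_mod_cast card_le_univ A
  have hN0r : (0 : ℝ) ≤ N₀ := by positivity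
  have hbig : (p : ℝ) * (n - dg G x) + ε * n / 2 + N₀ ≤ #A := by linarith
  have hA1 : N₀ ≤ #A := by
    have : (N₀ : ℝ) ≤ #A := by
      have : 0 ≤ (p : ℝ) * (n - dg G x) := mul_nonneg (by linarith) (by linarith)
      have : 0 ≤ ε * n / 2 := by positivity
      linarith
    exact_mod_cast this
  have hA2 : ∀ y ∈ A, (1 - 1 / (p : ℝ) + e₁) * #A ≤ #{w ∈ A | G1.Adj y w} := by
    intro y hy
    have hyb : (ud y : ℝ) < e₁ * n := by
      have := (mem_filter.1 hy).2.2
      simpa [hBad] using this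
    have h1 : (dg G1 y : ℝ) + ud y = dg G y := by exact_mod_cast hF.dg_restG y
    have h2 : (dg G x : ℝ) ≤ dg G y := by exact_mod_cast hx y
    have h3 : (#A : ℝ) + dg G1 y ≤ #{w ∈ A | G1.Adj y w} + n := by exact_mod_cast dg_inter G1 A y
    have h4 : (n : ℝ) - dg G x + ε * n / (2 * p) ≤ #A / p := by
      rw [le_div_iff₀ (by linarith)]
      have : ε * n / (2 * p) * p = ε * n / 2 := by field_simp
      linarith
    have h5 : e₁ * n + e₁ * n = ε * n / (2 * p) := by rw [he₁]; field_simp; ring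
    have h6 : e₁ * #A ≤ e₁ * n := by gcongr
    have h7 : (1 - 1 / (p : ℝ) + e₁) * #A = #A - #A / p + e₁ * #A := by ring
    rw [h7]
    linarith
  obtain ⟨P, hP, hPadj⟩ := hN₀ G1 A hA1 hA2
  have hC1 : ∀ w ∉ ({a} : Finset W), ∀ w' ∉ ({a} : Finset W), H.Adj w' w → ∀ y ∈ P (c w'),
      #{z ∈ P (c w) | ¬ G1.Adj y z} ≤ 0 := by
    intro w hw w' hw' hadj y hy
    rw [Nat.le_zero, card_eq_zero, filter_eq_empty_iff]
    intro z hz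
    rw [not_not]
    rw [mem_singleton] at hw hw'
    exact hPadj _ _ (hc _ _ hadj hw' hw) _ hy _ hz
  have hirr : ∀ u ∈ ({a} : Finset W), ∀ v ∈ ({a} : Finset W), ¬ H.Adj u v := by
    intro u hu v hv
    rw [mem_singleton] at hu hv
    rw [hu, hv]
    exact H.loopless.irrefl _
  obtain ⟨f, hf, hfa, -⟩ := exists_rainbow_extension H G1 χ (hχ.mono (restG_le F)) {a}
      (fun _ => x) (by simp) (fun u hu v hv h => absurd h (hirr u hu v hv))
      (fun u hu v hv _ _ _ _ h => absurd h (hirr u hu v hv)) (fun w => P (c w)) 0 hC1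
      (fun w _ w' _ _ z hz => (mem_filter.1 ((hP (c w)).1 hz)).2.1)
      (fun w _ => by simp only [(hP (c w)).2]; omega)
  obtain ⟨F', h1, h2, h3, -⟩ := hF.exists_insert hH hf
  have h4 := hmax F' (mem_filter.2 ⟨mem_univ _, h1, fun g hg => by
    rcases (h3 g).1 hg with rfl | hg
    · exact hfa a (mem_singleton_self a)
    · exact hFx g hg⟩)
  omega

/-- The packing bound when the critical edge has an end of degree at least three. -/
theorem packBound_of_three_le [Fintype W] (p : ℕ) (hp : 1 ≤ p) (a : W) (ha : 3 ≤ dg H a)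
    (hH : 0 < eCount H) (c : W → Fin (p + 1))
    (hc : ∀ u v, H.Adj u v → u ≠ a → v ≠ a → c u ≠ c v) (hap : p + 1 ≤ dg H a) :
    PackBound H (p + 1) (1 / 2) := by
  refine packBound_of_step hH (p + 1) (by omega) _ a fun ε hε => ?_
  obtain ⟨n₀, hn₀⟩ := exists_center_packing p hp a (by omega) hH c hc ε hε
  refine ⟨n₀ + 1, fun V _ G χ hχ hn => Or.inr ?_⟩
  have : Nonempty V := Fintype.card_pos_iff.1 (by omega)
  obtain ⟨x, hx⟩ := exists_min_dg G
  obtain ⟨F, hF, hFx, hb⟩ := hn₀ V G χ x hχ (by omega) hx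
  refine ⟨x, F, hF, hFx, ?_⟩
  have hp0 : (1 : ℝ) ≤ p := by exact_mod_cast hp
  have ha' : (3 : ℝ) ≤ dg H a := by exact_mod_cast ha
  have hap' : (p : ℝ) + 1 ≤ dg H a := by exact_mod_cast hap
  set D : ℝ := (dg H a : ℝ)
  set d : ℝ := (dg G x : ℝ)
  set n : ℝ := (Fintype.card V : ℝ) with hnn
  have hn0 : 0 ≤ n := by positivity
  have hF0 : (0 : ℝ) ≤ #F := by positivity
  push_cast
  have e1 : (1 - 1 / ((p : ℝ) + 1)) * n = p * n / (p + 1) := by field_simp; ring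
  rw [e1]
  set m := d - p * n / (p + 1) with hm
  have e2 : d - p * (n - d) = (p + 1) * m := by rw [hm]; field_simp; ring
  rw [e2] at hb
  have hg : 0 ≤ D - 1 - 1 / 2 := by linarith
  suffices m ≤ (D - 1 - 1 / 2) * #F + ε * n by linarith
  by_cases hm0 : m ≤ ε * n
  · have : 0 ≤ (D - 1 - 1 / 2) * #F := by positivity
    linarith
  · push Not at hm0
    have h3 : D * #F ≤ (p + 1) * ((D - 1 - 1 / 2) * #F) := by
      have : D ≤ (p + 1) * (D - 1 - 1 / 2) := by nlinarith
      calc D * #F ≤ ((p + 1) * (D - 1 - 1 / 2)) * #F := by gcongr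
        _ = _ := by ring
    have h4 : (p + 1) * m - ε * n ≤ (p + 1) * ((D - 1 - 1 / 2) * #F) := hb.trans h3
    have h5 : ε * n ≤ (p + 1) * (ε * n) := by
      have : 0 ≤ ε * n := by positivity
      nlinarith
    nlinarith
end

section
open Finset
open scoped Classical
variable {H : SimpleGraph W} {G : SimpleGraph V} {χ : Sym2 V → ℕ}

/-- Pigeonhole form of the Kővári–Sós–Turán theorem. -/
theorem exists_biclique.{u} (c : ℝ) (hc : 0 < c) (M : ℕ) :
    ∃ (L : ℕ) (c' : ℝ), 0 < c' ∧ ∀ {V : Type u} (G : SimpleGraph V) (S B : Finset V), L ≤ #S →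
      (∀ v ∈ S, c * #B ≤ #{w ∈ B | G.Adj v w}) →
      ∃ S' ⊆ S, ∃ B' ⊆ B, #S' = M ∧ c' * #B ≤ #B' ∧ ∀ u ∈ S', ∀ v ∈ B', G.Adj u v := by
  obtain ⟨L, hL⟩ := exists_nat_gt (2 * M / c + M)
  have hLM : M ≤ L := by
    have : (M : ℝ) ≤ L := le_trans (le_add_of_nonneg_left (by positivity)) hL.le
    exact_mod_cast this
  replace hL : 2 * M / c < L := lt_of_le_of_lt (le_add_of_nonneg_right (by positivity)) hL
  refine ⟨L, c / 2 / 2 ^ L, by positivity, fun {V} G S₀ B hS₀ hdeg => ?_⟩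
  obtain ⟨S, hS, hSL⟩ := exists_subset_card_eq hS₀
  have hL0 : (0 : ℝ) < L := lt_of_le_of_lt (by positivity) hL
  rw [div_lt_iff₀ hc] at hL
  set Nb : V → Finset V := fun z => {v ∈ S | G.Adj v z} with hNb
  have hsum : c * #B * L ≤ ∑ z ∈ B, (#(Nb z) : ℝ) := by
    have h1 : ∑ v ∈ S, #{w ∈ B | G.Adj v w} = ∑ z ∈ B, #(Nb z) := by
      simp_rw [hNb, card_filter]
      exact sum_comm
    have h2 : (L : ℝ) * (c * #B) ≤ ∑ v ∈ S, (#{w ∈ B | G.Adj v w} : ℝ) := by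
      rw [← hSL, ← nsmul_eq_mul]
      exact card_nsmul_le_sum _ _ _ fun v hv => hdeg v (hS hv)
    have h3 : ∑ v ∈ S, (#{w ∈ B | G.Adj v w} : ℝ) = ∑ z ∈ B, (#(Nb z) : ℝ) := by
      exact_mod_cast h1
    linarith
  set B1 : Finset V := {z ∈ B | M ≤ #(Nb z)} with hB1
  have hle : ∑ z ∈ B, (#(Nb z) : ℝ) ≤ L * #B1 + M * #B := by
    rw [← sum_filter_add_sum_filter_not B (fun z => M ≤ #(Nb z))]
    refine add_le_add ?_ ?_
    · rw [mul_comm, ← nsmul_eq_mul]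
      refine sum_le_card_nsmul _ _ _ fun z _ => ?_
      rw [← hSL]
      exact_mod_cast card_le_card (filter_subset _ _)
    · rw [mul_comm]
      calc _ ≤ #{z ∈ B | ¬ M ≤ #(Nb z)} • (M : ℝ) := by
            refine sum_le_card_nsmul _ _ _ fun z hz => ?_
            have := (mem_filter.1 hz).2
            exact_mod_cast (by omega : #(Nb z) ≤ M)
        _ ≤ _ := by
            rw [nsmul_eq_mul]
            gcongr
            exact filter_subset _ _
  have hB1c : c / 2 * #B ≤ #B1 := by
    have hb : (0 : ℝ) ≤ #B := by positivity
    have : (M : ℝ) * #B ≤ L * c / 2 * #B := by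
      refine mul_le_mul_of_nonneg_right ?_ hb
      linarith
    have : L * (c / 2 * #B) ≤ L * (#B1 : ℝ) := by linarith
    exact le_of_mul_le_mul_left this hL0
  rcases Finset.eq_empty_or_nonempty B1 with h0 | hne
  · rw [h0, card_empty, Nat.cast_zero] at hB1c
    have hB0 : (#B : ℝ) = 0 := by
      have hb : (0 : ℝ) ≤ #B := by positivity
      nlinarith
    obtain ⟨S', hS', hc'⟩ := exists_subset_card_eq (s := S) (n := M) (by
      rw [hSL]; exact hLM)
    exact ⟨S', hS'.trans hS, ∅, by simp, hc', by rw [hB0]; simp, by simp⟩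
  · obtain ⟨y, hy, hyc⟩ := exists_le_card_fiber_of_nsmul_le_card_of_maps_to
      (s := B1) (t := S.powerset) (f := Nb) (b := c / 2 / 2 ^ L * #B)
      (fun z _ => mem_powerset.2 (filter_subset _ _)) ⟨∅, by simp⟩ (by
        rw [card_powerset, hSL, nsmul_eq_mul]
        push_cast
        refine le_trans (le_of_eq ?_) hB1c
        field_simp)
    obtain ⟨z₀, hz₀⟩ := hne
    have hBpos : (0 : ℝ) < #B := by
      exact_mod_cast card_pos.2 ⟨z₀, (mem_filter.1 hz₀).1⟩
    have hpos : (0 : ℝ) < #{x ∈ B1 | Nb x = y} := lt_of_lt_of_le (by positivity) hyc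
    obtain ⟨z₁, hz₁⟩ := card_pos.1 (by exact_mod_cast hpos : 0 < #{x ∈ B1 | Nb x = y})
    have hyM : M ≤ #y := by
      rw [← (mem_filter.1 hz₁).2]
      exact (mem_filter.1 (mem_filter.1 hz₁).1).2
    obtain ⟨S', hS', hc'⟩ := exists_subset_card_eq hyM
    refine ⟨S', (hS'.trans (mem_powerset.1 hy)).trans hS, {x ∈ B1 | Nb x = y},
      (filter_subset _ _).trans (filter_subset _ _), hc', hyc, fun u hu v hv => ?_⟩
    have h1 := hS' hu
    rw [← (mem_filter.1 hv).2] at h1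
    exact (mem_filter.1 h1).2

/-- A set of pairwise disjoint edges of `G` inside `N`, with a chosen orientation. -/
def IsMatch (G : SimpleGraph V) (N : Finset V) (M : Finset (V × V)) : Prop :=
  (∀ p ∈ M, G.Adj p.1 p.2 ∧ p.1 ∈ N ∧ p.2 ∈ N) ∧ ∀ p ∈ M, ∀ q ∈ M, p ≠ q →
    p.1 ≠ q.1 ∧ p.1 ≠ q.2 ∧ p.2 ≠ q.1 ∧ p.2 ≠ q.2

lemma IsMatch.insert {N : Finset V} {M : Finset (V × V)} (hM : IsMatch G N M) {u v : V}
    (huv : G.Adj u v) (hu : u ∈ N) (hv : v ∈ N)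
    (hu' : ∀ p ∈ M, u ≠ p.1 ∧ u ≠ p.2) (hv' : ∀ p ∈ M, v ≠ p.1 ∧ v ≠ p.2) :
    IsMatch G N (insert (u, v) M) ∧ #(insert (u, v) M) = #M + 1 := by
  refine ⟨⟨fun p hp => ?_, fun p hp q hq hne => ?_⟩, card_insert_of_notMem fun h =>
    (hu' _ h).1 rfl⟩
  · rcases mem_insert.1 hp with rfl | hp
    · exact ⟨huv, hu, hv⟩
    · exact hM.1 p hp
  · rcases mem_insert.1 hp with rfl | hp <;> rcases mem_insert.1 hq with rfl | hq
    · exact absurd rfl hne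
    · exact ⟨(hu' q hq).1, (hu' q hq).2, (hv' q hq).1, (hv' q hq).2⟩
    · exact ⟨(hu' p hp).1.symm, (hv' p hp).1.symm, (hu' p hp).2.symm, (hv' p hp).2.symm⟩
    · exact hM.2 p hp q hq hne

lemma exists_match (G : SimpleGraph V) (N : Finset V) (q : ℕ)
    (hq : ∀ y ∈ N, q ≤ #{w ∈ N | G.Adj y w}) :
    ∃ M : Finset (V × V), IsMatch G N M ∧ (q ≤ #M ∨ #N ≤ 2 * #M + 1) := by
  obtain ⟨M, hM, hmax⟩ := exists_max_image
    ((N ×ˢ N).powerset.filter fun M : Finset (V × V) => IsMatch G N M) card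
    ⟨∅, by simp [IsMatch]⟩
  replace hM := (mem_filter.1 hM).2
  replace hmax : ∀ M', IsMatch G N M' → #M' ≤ #M := fun M' h => hmax M'
    (mem_filter.2 ⟨mem_powerset.2 fun p hp => mem_product.2 (h.1 p hp).2, h⟩)
  refine ⟨M, hM, ?_⟩
  by_contra! hcon
  set Cov := M.image Prod.fst ∪ M.image Prod.snd with hCov
  have hmem : ∀ y, y ∉ Cov → ∀ p ∈ M, y ≠ p.1 ∧ y ≠ p.2 := by
    intro y hy p hp
    rw [hCov, mem_union, not_or] at hy
    exact ⟨fun h => hy.1 (mem_image.2 ⟨p, hp, h.symm⟩),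
      fun h => hy.2 (mem_image.2 ⟨p, hp, h.symm⟩)⟩
  have hcard : #Cov ≤ 2 * #M := by
    have h1 := card_union_le (M.image Prod.fst) (M.image Prod.snd)
    have h2 := card_image_le (s := M) (f := Prod.fst)
    have h3 := card_image_le (s := M) (f := Prod.snd)
    rw [hCov]
    omega
  have hN := le_card_sdiff Cov N
  obtain ⟨u, hu, v, hv, huv⟩ := one_lt_card.1 (by omega : 1 < #(N \ Cov))
  rw [mem_sdiff] at hu hv
  have hnadj : ∀ u v, u ∈ N → u ∉ Cov → v ∈ N → v ∉ Cov → ¬ G.Adj u v := by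
    intro u v hu hu' hv hv' h
    obtain ⟨h1, h2⟩ := hM.insert h hu hv (hmem u hu') (hmem v hv')
    have := hmax _ h1
    omega
  have hdeg : ∀ u, u ∈ N → u ∉ Cov → q ≤ ∑ p ∈ M, ((if G.Adj u p.1 then 1 else 0) +
      (if G.Adj u p.2 then 1 else 0)) := by
    intro u hu hu'
    refine (hq u hu).trans ?_
    have hsub : ({w ∈ N | G.Adj u w} : Finset V) ⊆
        (M.filter fun p => G.Adj u p.1).image Prod.fst ∪
        (M.filter fun p => G.Adj u p.2).image Prod.snd := by
      intro w hw
      obtain ⟨hw1, hw2⟩ := mem_filter.1 hw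
      have hwc : w ∈ Cov := by
        by_contra hwc
        exact hnadj u w hu hu' hw1 hwc hw2
      rw [hCov, mem_union, mem_image, mem_image] at hwc
      rw [mem_union, mem_image, mem_image]
      rcases hwc with ⟨p, hp, rfl⟩ | ⟨p, hp, rfl⟩
      · exact Or.inl ⟨p, mem_filter.2 ⟨hp, hw2⟩, rfl⟩
      · exact Or.inr ⟨p, mem_filter.2 ⟨hp, hw2⟩, rfl⟩
    rw [sum_add_distrib, ← card_filter, ← card_filter]
    exact (card_le_card hsub).trans ((card_union_le _ _).trans
      (add_le_add card_image_le card_image_le))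
  have hrep : ∀ u v, u ∈ N → u ∉ Cov → v ∈ N → v ∉ Cov → u ≠ v → ∀ p ∈ M,
      ¬ (G.Adj u p.1 ∧ G.Adj v p.2) := by
    rintro u v hu hu' hv hv' huv p hp ⟨h1, h2⟩
    have hE : IsMatch G N (M.erase p) :=
      ⟨fun p' hp' => hM.1 p' (mem_of_mem_erase hp'), fun p' hp' q' hq' =>
        hM.2 p' (mem_of_mem_erase hp') q' (mem_of_mem_erase hq')⟩
    have hp12 := (hM.1 p hp).1.ne
    obtain ⟨hE1, hE2⟩ := hE.insert h1 hu (hM.1 p hp).2.1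
      (fun p' hp' => hmem u hu' p' (mem_of_mem_erase hp'))
      (fun p' hp' => by
        have := hM.2 p hp p' (mem_of_mem_erase hp') (ne_of_mem_erase hp').symm
        exact ⟨this.1, this.2.1⟩)
    obtain ⟨hE3, hE4⟩ := hE1.insert h2 hv (hM.1 p hp).2.2
      (fun p' hp' => by
        rcases mem_insert.1 hp' with rfl | hp'
        · exact ⟨huv.symm, (hmem v hv' p hp).1⟩
        · exact hmem v hv' p' (mem_of_mem_erase hp'))
      (fun p' hp' => by
        rcases mem_insert.1 hp' with rfl | hp'
        · exact ⟨(hmem u hu' p hp).2.symm, hp12.symm⟩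
        · have := hM.2 p hp p' (mem_of_mem_erase hp') (ne_of_mem_erase hp').symm
          exact ⟨this.2.2.1, this.2.2.2⟩)
    have h3 := hmax _ hE3
    have h4 := card_erase_add_one hp
    omega
  have hu2 := hdeg u hu.1 hu.2
  have hv2 := hdeg v hv.1 hv.2
  have hsum : ∑ p ∈ M, (((if G.Adj u p.1 then 1 else 0) + (if G.Adj u p.2 then 1 else 0)) +
      ((if G.Adj v p.1 then 1 else 0) + (if G.Adj v p.2 then 1 else 0))) ≤ ∑ p ∈ M, 2 := by
    refine sum_le_sum fun p hp => ?_
    have h1 := hrep u v hu.1 hu.2 hv.1 hv.2 huv p hp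
    have h2 := hrep v u hv.1 hv.2 hu.1 hu.2 huv.symm p hp
    clear hrep hdeg hnadj hmem hmax
    by_cases a1 : G.Adj u p.1 <;> by_cases a2 : G.Adj u p.2 <;> by_cases a3 : G.Adj v p.1 <;>
      by_cases a4 : G.Adj v p.2 <;> simp only [a1, a2, a3, a4, if_true, if_false, not_true,
        and_self, not_false_eq_true, and_true, and_false] at h1 h2 ⊢ <;> omega
  rw [sum_add_distrib, sum_const, smul_eq_mul] at hsum
  omega

end

section
open Finset
open scoped Classical
variable {H : SimpleGraph W} {G : SimpleGraph V} {χ : Sym2 V → ℕ}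

lemma ProperEdgeColoring.eq_of_share (hχ : ProperEdgeColoring G χ) {S₀ : Finset W} {f : W → V}
    (hinj : Set.InjOn f S₀) {u v w z : W} (hu : u ∈ S₀) (hv : v ∈ S₀) (hw : w ∈ S₀)
    (hz : z ∈ S₀) (h1 : G.Adj (f u) (f v)) (h2 : G.Adj (f w) (f z))
    (hs : u = w ∨ u = z ∨ v = w ∨ v = z) (h : χ s(f u, f v) = χ s(f w, f z)) :
    s(u, v) = s(w, z) := by
  rcases hs with rfl | rfl | rfl | rfl
  · rw [hinj hv hz (hχ.eq_of_eq h1 h2 h)]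
  · rw [Sym2.eq_swap (a := f w)] at h
    rw [hinj hv hw (hχ.eq_of_eq h1 (SimpleGraph.Adj.symm h2) h), Sym2.eq_swap]
  · rw [Sym2.eq_swap] at h
    rw [hinj hu hz (hχ.eq_of_eq (SimpleGraph.Adj.symm h1) h2 h), Sym2.eq_swap]
  · rw [Sym2.eq_swap, Sym2.eq_swap (a := f w)] at h
    rw [hinj hu hw (hχ.eq_of_eq (SimpleGraph.Adj.symm h1) (SimpleGraph.Adj.symm h2) h)]

/-- `v` is the image under `f` of a vertex outside `S₀`. -/
def Fills (S₀ : Finset W) (v : V) (f : W → V) : Prop := ∃ w, w ∉ S₀ ∧ f w = v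

/-- The number of copies in `F` in which `v` is the image of a vertex outside `S₀`. -/
noncomputable def fillCount (S₀ : Finset W) (F : Finset (W → V)) (v : V) : ℕ :=
  #{f ∈ F | Fills S₀ v f}

lemma sum_fillCount_le [Fintype V] [Fintype W] (S₀ : Finset W) (F : Finset (W → V)) :
    ∑ v, fillCount S₀ F v ≤ Fintype.card W * #F := by
  have h1 : ∀ v, fillCount S₀ F v ≤ ∑ w : W, #{f ∈ F | f w = v} := by
    intro v
    refine (card_le_card (t := univ.biUnion fun w => {f ∈ F | f w = v}) ?_).trans
      card_biUnion_le
    intro f hf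
    obtain ⟨hf, w, -, hw⟩ := mem_filter.1 hf
    exact mem_biUnion.2 ⟨w, mem_univ w, mem_filter.2 ⟨hf, hw⟩⟩
  refine (sum_le_sum fun v _ => h1 v).trans ?_
  rw [sum_comm]
  refine (sum_le_card_nsmul univ _ #F fun w _ => ?_).trans (by simp)
  exact (card_eq_sum_card_fiberwise (t := univ) fun f _ => by simp).ge

lemma fillCount_insert_le {S₀ : Finset W} {F F' : Finset (W → V)} {f : W → V}
    (hF' : ∀ g, g ∈ F' ↔ g = f ∨ g ∈ F) (v : V) :
    fillCount S₀ F' v ≤ fillCount S₀ F v + 1 ∧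
      ((∀ w, w ∉ S₀ → f w ≠ v) → fillCount S₀ F' v ≤ fillCount S₀ F v) := by
  constructor
  · refine (card_le_card (t := insert f {f ∈ F | Fills S₀ v f}) ?_).trans
      (card_insert_le _ _)
    intro g hg
    obtain ⟨h1, h2⟩ := mem_filter.1 hg
    rcases (hF' g).1 h1 with rfl | h
    · exact mem_insert_self _ _
    · exact mem_insert_of_mem (mem_filter.2 ⟨h, h2⟩)
  · intro hv
    refine card_le_card ?_
    intro g hg
    obtain ⟨h1, w, h2, h3⟩ := mem_filter.1 hg
    rcases (hF' g).1 h1 with rfl | h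
    · exact absurd h3 (hv w h2)
    · exact mem_filter.2 ⟨h, w, h2, h3⟩

lemma share_of_card_le_three {S : Finset W} (hS : #S ≤ 3) {u v w z : W} (hu : u ∈ S)
    (hv : v ∈ S) (hw : w ∈ S) (hz : z ∈ S) (huv : u ≠ v) (hwz : w ≠ z) :
    u = w ∨ u = z ∨ v = w ∨ v = z := by
  by_contra! h
  have h1 : #({u, v, w, z} : Finset W) = 4 := by
    rw [card_insert_of_notMem, card_insert_of_notMem, card_insert_of_notMem, card_singleton] <;>
      simp [huv, hwz, h]
  have h2 : ({u, v, w, z} : Finset W) ⊆ S := by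
    simp [insert_subset_iff, hu, hv, hw, hz]
  have := card_le_card h2
  omega

set_option maxHeartbeats 1000000 in
theorem exists_center_packing_two [Fintype W] (hH : 0 < eCount H) (a b b' : W)
    (hbb : b ≠ b') (hN : ∀ u, H.Adj a u ↔ u = b ∨ u = b') (c : W → Fin 2)
    (hc : ∀ u v, H.Adj u v → u ≠ a → v ≠ a → c u ≠ c v) (hcb : c b ≠ c b')
    (β : ℝ) (hβ : 0 < β) :
    ∃ K n₀ : ℕ, ∀ (V : Type) [Fintype V] (G : SimpleGraph V) (χ : Sym2 V → ℕ) (x : V),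
      ProperEdgeColoring G χ → n₀ ≤ Fintype.card V → (∀ v, dg G x ≤ dg G v) →
      (1 / 2 + β) * Fintype.card V ≤ dg G x →
      ∃ F : Finset (W → V), IsPacking H G χ F ∧ (∀ f ∈ F, f a = x) ∧
        (2 * dg G x ≤ Fintype.card V + #F ∨ dg G x ≤ 2 * #F + 1) ∧
        ∀ v, v ≠ x → ∑ f ∈ F, udg H f v ≤ K := by
  set h := Fintype.card W with hh
  obtain ⟨K₀, hK₀⟩ := exists_nat_gt (4 * h / β)
  obtain ⟨L, c', hc', hbic⟩ := exists_biclique.{0} β hβ (h + h ^ 3 + 1)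
  set K := (K₀ + 2) * h with hK
  obtain ⟨n₀, hn₀⟩ := exists_nat_gt ((3 * K + 6) * 4 / β + 4 * L + 4 * (h + h ^ 3 + 1) / c' + 1)
  refine ⟨K, n₀, fun V _ G χ x hχ hn hx hd => ?_⟩
  set n := Fintype.card V with hnn
  have hab : H.Adj a b := (hN b).2 (Or.inl rfl)
  have hab' : H.Adj a b' := (hN b').2 (Or.inr rfl)
  have hba : b ≠ a := (SimpleGraph.Adj.ne hab).symm
  have hba' : b' ≠ a := (SimpleGraph.Adj.ne hab').symm
  set N : Finset V := {w | G.Adj x w} with hNdef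
  have hNq : ∀ y ∈ N, 2 * dg G x - n ≤ #{w ∈ N | G.Adj y w} := by
    intro y _
    have h1 := dg_inter G N y
    have h2 := hx y
    have h3 : #N = dg G x := rfl
    omega
  obtain ⟨M, hM, hMc⟩ := exists_match G N (2 * dg G x - n) hNq
  set S₀ : Finset W := {a, b, b'} with hS₀
  obtain ⟨F, hFm, hmax⟩ := exists_max_image
    (univ.filter fun F : Finset (W → V) => IsPacking H G χ F ∧ (∀ f ∈ F, f a = x) ∧
      (∀ f ∈ F, (f b, f b') ∈ M) ∧
      (∀ f ∈ F, ∀ q ∈ M, s(q.1, q.2) ∈ imgE H f → q = (f b, f b')) ∧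
      ∀ v, fillCount S₀ F v ≤ K₀) card
    ⟨∅, by simp [isPacking_empty, fillCount]⟩
  obtain ⟨hF, hFx, hFM, hFe, hFK⟩ := (mem_filter.1 hFm).2
  have huniq : ∀ f ∈ F, ∀ g ∈ F, ∀ u u', H.Adj a u → H.Adj a u' → f u = g u' → f = g := by
    intro f hf g hg u u' hu hu' hfg
    by_contra hne
    refine Set.disjoint_left.1 (hF.2 f hf g hg hne) (mk_mem_imgE.2 ⟨a, u, hu, rfl, rfl⟩)
      (mk_mem_imgE.2 ⟨a, u', hu', ?_, hfg.symm⟩)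
    rw [hFx f hf, hFx g hg]
  have hused : ∀ v, v ≠ x → ∑ f ∈ F, udg H f v ≤ K := by
    intro v hv
    set R : Finset (W → V) := {f ∈ F | Fills S₀ v f} ∪
      ({f ∈ F | f b = v} ∪ {f ∈ F | f b' = v}) with hR
    have h1 : ∑ f ∈ F, udg H f v = ∑ f ∈ R, udg H f v := by
      symm
      refine sum_subset ?_ ?_
      · rw [hR]
        exact union_subset (filter_subset _ _)
          (union_subset (filter_subset _ _) (filter_subset _ _))
      · intro f hf hfR
        refine udg_of_notMem fun u hu => hfR ?_
        rw [hR, mem_union, mem_union, mem_filter, mem_filter, mem_filter]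
        by_cases hu0 : u ∈ S₀
        · rw [hS₀, mem_insert, mem_insert, mem_singleton] at hu0
          rcases hu0 with rfl | rfl | rfl
          · exact absurd (hu.symm.trans (hFx f hf)) hv
          · exact Or.inr (Or.inl ⟨hf, hu⟩)
          · exact Or.inr (Or.inr ⟨hf, hu⟩)
        · exact Or.inl ⟨hf, u, hu0, hu⟩
    have h2 : #R ≤ K₀ + 2 := by
      have e1 : #{f ∈ F | f b = v} ≤ 1 := by
        refine card_le_one.2 fun f hf g hg => ?_
        rw [mem_filter] at hf hg
        exact huniq f hf.1 g hg.1 b b hab hab (hf.2.trans hg.2.symm)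
      have e2 : #{f ∈ F | f b' = v} ≤ 1 := by
        refine card_le_one.2 fun f hf g hg => ?_
        rw [mem_filter] at hf hg
        exact huniq f hf.1 g hg.1 b' b' hab' hab' (hf.2.trans hg.2.symm)
      have e3 : #{f ∈ F | Fills S₀ v f} ≤ K₀ := hFK v
      have e4 := card_union_le {f ∈ F | Fills S₀ v f}
        ({f ∈ F | f b = v} ∪ {f ∈ F | f b' = v})
      have e5 := card_union_le {f ∈ F | f b = v} {f ∈ F | f b' = v}
      rw [hR]
      omega
    rw [h1, hK]
    refine (sum_le_card_nsmul R _ h fun f hf => udg_le (hF.1 f ?_).1 v).trans ?_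
    · rw [hR, mem_union, mem_union, mem_filter, mem_filter, mem_filter] at hf
      tauto
    · rw [smul_eq_mul]
      exact Nat.mul_le_mul_right h h2
  refine ⟨F, hF, hFx, ?_, hused⟩
  by_cases hFM' : #M ≤ #F
  · rcases hMc with h1 | h1
    · left; omega
    · right
      have : #N = dg G x := rfl
      omega
  exfalso
  push Not at hFM'
  obtain ⟨p, hpM, hp⟩ := exists_mem_notMem_of_card_lt_card
    (lt_of_le_of_lt (card_image_le (s := F) (f := fun f => (f b, f b'))) hFM')
  replace hp : ∀ f ∈ F, (f b, f b') ≠ p := fun f hf h => hp (mem_image.2 ⟨f, hf, h⟩)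
  obtain ⟨G1, hG1⟩ : ∃ G1, G1 = restG H G F := ⟨_, rfl⟩
  set ME : Set (Sym2 V) := {e | ∃ q ∈ M, q ≠ p ∧ e = s(q.1, q.2)} with hME
  obtain ⟨G2, hG2⟩ : ∃ G2, G2 = G1.deleteEdges ME := ⟨_, rfl⟩
  have hG2adj : ∀ u v, G2.Adj u v ↔ G1.Adj u v ∧ s(u, v) ∉ ME := by
    intro u v
    rw [hG2, SimpleGraph.deleteEdges_adj]
  have hG2le : G2 ≤ G1 := hG2 ▸ SimpleGraph.deleteEdges_le _
  have hχ2 : ProperEdgeColoring G2 χ := hχ.mono (hG2le.trans (hG1 ▸ restG_le F))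
  obtain ⟨hpadj, hp1N, hp2N⟩ := hM.1 p hpM
  have hp1x : G.Adj x p.1 := (mem_filter.1 hp1N).2
  have hp2x : G.Adj x p.2 := (mem_filter.1 hp2N).2
  have hxM : ∀ q ∈ M, q.1 ≠ x ∧ q.2 ≠ x := by
    intro q hq
    obtain ⟨-, h1, h2⟩ := hM.1 q hq
    exact ⟨(SimpleGraph.Adj.ne (mem_filter.1 h1).2).symm,
      (SimpleGraph.Adj.ne (mem_filter.1 h2).2).symm⟩
  have hxE : ∀ v, s(x, v) ∉ ME := by
    rintro v ⟨q, hq, -, h⟩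
    rcases Sym2.eq_iff.1 h with h | h
    · exact (hxM q hq).1 h.1.symm
    · exact (hxM q hq).2 h.1.symm
  have hxa : ∀ y, (y = p.1 ∨ y = p.2) → G2.Adj x y := by
    intro y hy
    rw [hG2adj, hG1, restG_adj]
    refine ⟨⟨?_, fun hu => ?_⟩, hxE y⟩
    · rcases hy with rfl | rfl
      exacts [hp1x, hp2x]
    · obtain ⟨f, hf, hfe⟩ := mem_usedE.1 hu
      obtain ⟨u, v, huv, h1, h2⟩ := mk_mem_imgE.1 hfe
      have hua : u = a := (hF.1 f hf).1 (h1.trans (hFx f hf).symm)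
      subst hua
      have hne := hM.2 _ (hFM f hf) p hpM (hp f hf)
      rcases (hN v).1 huv with rfl | rfl
      · rcases hy with rfl | rfl
        · exact hne.1 h2
        · exact hne.2.1 h2
      · rcases hy with rfl | rfl
        · exact hne.2.2.1 h2
        · exact hne.2.2.2 h2
  have hpp : G2.Adj p.1 p.2 := by
    rw [hG2adj, hG1, restG_adj]
    refine ⟨⟨hpadj, fun hu => ?_⟩, ?_⟩
    · obtain ⟨f, hf, hfe⟩ := mem_usedE.1 hu
      exact hp f hf (hFe f hf p hpM hfe).symm
    · rintro ⟨q, hq, hqp, h⟩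
      have h1 := hM.2 p hpM q hq (Ne.symm hqp)
      rcases Sym2.eq_iff.1 h with h | h
      · exact h1.1 h.1
      · exact h1.2.1 h.1
  have hdg2 : ∀ v, v ≠ x → dg G x ≤ dg G2 v + K + 1 := by
    intro v hv
    have h1 := hF.dg_restG v
    rw [← hG1] at h1
    have h2 := hused v hv
    have h3 := hx v
    have h4 : dg G1 v ≤ dg G2 v + #{w | s(v, w) ∈ ME} := by
      rw [dg, dg]
      refine (card_le_card (t := ({w | G2.Adj v w} : Finset V) ∪ ({w | s(v, w) ∈ ME} : Finset V)) ?_).trans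
        (card_union_le _ _)
      intro w hw
      rw [mem_union, mem_filter, mem_filter, hG2adj]
      have := (mem_filter.1 hw).2
      by_cases hE : s(v, w) ∈ ME
      · exact Or.inr ⟨mem_univ _, hE⟩
      · exact Or.inl ⟨mem_univ _, this, hE⟩
    have h5 : #{w | s(v, w) ∈ ME} ≤ 1 := by
      refine card_le_one.2 fun w hw w' hw' => ?_
      obtain ⟨q, hq, -, h6⟩ := (mem_filter.1 hw).2
      obtain ⟨q', hq', -, h7⟩ := (mem_filter.1 hw').2
      have hqq : q = q' := by
        by_contra hne
        have := hM.2 q hq q' hq' hne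
        rcases Sym2.eq_iff.1 h6 with h6 | h6 <;> rcases Sym2.eq_iff.1 h7 with h7 | h7
        · exact this.1 (h6.1.symm.trans h7.1)
        · exact this.2.1 (h6.1.symm.trans h7.1)
        · exact this.2.2.1 (h6.1.symm.trans h7.1)
        · exact this.2.2.2 (h6.1.symm.trans h7.1)
      rw [← hqq, ← h6] at h7
      exact (Sym2.congr_right.1 h7).symm
    omega
  set Sat : Finset V := {v | K₀ ≤ fillCount S₀ F v} with hSat
  have hF2 : 2 * #F ≤ n := by
    have h1 := sum_udg_center hF hFx
    have h2 := hF.dg_restG x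
    have h3 : dg H a = 2 := by
      rw [dg, card_eq_two]
      refine ⟨b, b', hbb, ?_⟩
      ext u
      simp [hN]
    have h4 := dg_le_card G x
    rw [h1, h3] at h2
    omega
  have hSatc : (#Sat : ℝ) ≤ β * n / 8 := by
    have h1 := card_filter_mul_le (univ : Finset V) (fillCount S₀ F) K₀
    have h2 : ((∑ v, fillCount S₀ F v : ℕ) : ℝ) ≤ h * (n / 2) := by
      have h3 : ((∑ v, fillCount S₀ F v : ℕ) : ℝ) ≤ (h * #F : ℕ) := by
        exact_mod_cast sum_fillCount_le S₀ F
      refine h3.trans ?_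
      push_cast
      have h4 : (2 * #F : ℝ) ≤ n := by exact_mod_cast hF2
      gcongr
      linarith
    have h3 : (#Sat : ℝ) * K₀ ≤ h * (n / 2) := by
      refine le_trans ?_ (h1.trans (by exact_mod_cast h2))
      simp only [hSat, Nat.cast_le]
      rfl
    rw [div_lt_iff₀ hβ] at hK₀
    have h4 : (0 : ℝ) < K₀ := by
      have : (0 : ℝ) ≤ h := Nat.cast_nonneg _
      by_contra h5
      nlinarith
    by_contra h5
    push Not at h5
    have : β * n / 8 * K₀ < #Sat * K₀ := by gcongr
    have : (0 : ℝ) ≤ n := Nat.cast_nonneg _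
    nlinarith
  have hnbig : (3 * K + 6) * 4 / β + 4 * L + 4 * (h + h ^ 3 + 1) / c' + 1 < (n : ℝ) :=
    hn₀.trans_le (by exact_mod_cast hn)
  have hn1 : (3 * K + 6) * 4 / β < (n : ℝ) := by
    have : 0 ≤ 4 * ((h : ℝ) + h ^ 3 + 1) / c' := by positivity
    have : (0 : ℝ) ≤ L := Nat.cast_nonneg _
    linarith
  have hn2 : 4 * (L : ℝ) < n := by
    have : 0 ≤ 4 * ((h : ℝ) + h ^ 3 + 1) / c' := by positivity
    have : 0 ≤ (3 * (K : ℝ) + 6) * 4 / β := by positivity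
    linarith
  have hn3 : 4 * ((h : ℝ) + h ^ 3 + 1) / c' < n := by
    have : (0 : ℝ) ≤ L := Nat.cast_nonneg _
    have : 0 ≤ (3 * (K : ℝ) + 6) * 4 / β := by positivity
    linarith
  rw [div_lt_iff₀ hβ] at hn1
  rw [div_lt_iff₀ hc'] at hn3
  have hAc : ∀ y, y ≠ x → ∀ A : Finset V, (∀ z, z ∈ A ↔ G2.Adj y z ∧ z ∉ Sat ∧ z ≠ x) →
      (n : ℝ) / 2 + β * n - β * n / 8 - K - 2 ≤ #A := by
    intro y hy A hA
    have h1 : dg G2 y ≤ #A + #Sat + 1 := by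
      rw [dg]
      refine (card_le_card (t := (A ∪ Sat) ∪ {x}) ?_).trans ((card_union_le _ _).trans
          (Nat.add_le_add (card_union_le _ _) (by simp)))
      intro z hz
      have := (mem_filter.1 hz).2
      simp only [mem_union, hA, mem_singleton]
      tauto
    have h2 := hdg2 y hy
    have h3 : (dg G x : ℝ) ≤ #A + #Sat + 1 + K + 1 := by
      exact_mod_cast (by omega : dg G x ≤ #A + #Sat + 1 + K + 1)
    linarith
  obtain ⟨hp1, hp2⟩ := hxM p hpM
  obtain ⟨A1, hA1⟩ : ∃ A : Finset V, ∀ z, z ∈ A ↔ G2.Adj p.2 z ∧ z ∉ Sat ∧ z ≠ x :=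
    ⟨univ.filter fun z => G2.Adj p.2 z ∧ z ∉ Sat ∧ z ≠ x, by simp⟩
  obtain ⟨A2, hA2⟩ : ∃ A : Finset V, ∀ z, z ∈ A ↔ G2.Adj p.1 z ∧ z ∉ Sat ∧ z ≠ x :=
    ⟨univ.filter fun z => G2.Adj p.1 z ∧ z ∉ Sat ∧ z ≠ x, by simp⟩
  have hA1c := hAc p.2 hp2 A1 hA1
  have hA2c := hAc p.1 hp1 A2 hA2
  have hn0 : (0 : ℝ) ≤ n := Nat.cast_nonneg _
  have hL1 : L ≤ #A1 := by
    have : (L : ℝ) ≤ #A1 := by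
      have : (0 : ℝ) ≤ K := Nat.cast_nonneg _
      nlinarith
    exact_mod_cast this
  have hdens : ∀ v ∈ A1, β * #A2 ≤ #{w ∈ A2 | G2.Adj v w} := by
    intro v hv
    rw [hA1] at hv
    have h1 := dg_inter G2 A2 v
    have h2 := hdg2 v hv.2.2
    have h3 : (#A2 : ℝ) + dg G2 v ≤ #{w ∈ A2 | G2.Adj v w} + n := by exact_mod_cast h1
    have h4 : (dg G x : ℝ) ≤ dg G2 v + K + 1 := by exact_mod_cast h2
    have h5 : (#A2 : ℝ) ≤ n := by exact_mod_cast card_le_univ A2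
    have h6 : β * #A2 ≤ β * n := by gcongr
    have : (0 : ℝ) ≤ K := Nat.cast_nonneg _
    linarith
  obtain ⟨S', hS', B', hB', hSc, hBc, hcomp⟩ := hbic G2 A1 A2 hL1 hdens
  have hBc' : h + h ^ 3 < #B' := by
    have h1 : (n : ℝ) / 4 ≤ #A2 := by
      have : (0 : ℝ) ≤ K := Nat.cast_nonneg _
      linarith
    have h2 : c' * (n / 4) ≤ c' * #A2 := by gcongr
    have h3 : (h + h ^ 3 : ℝ) < #B' := by linarith
    exact_mod_cast h3
  set f₀ : W → V := fun w => if w = a then x else if w = b then p.1 else p.2 with hf₀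
  have hfa : f₀ a = x := by simp [hf₀]
  have hfb : f₀ b = p.1 := by simp [hf₀, hba]
  have hfb' : f₀ b' = p.2 := by simp [hf₀, hba', hbb.symm]
  have hS₀m : ∀ w, w ∈ S₀ ↔ w = a ∨ w = b ∨ w = b' := by simp [hS₀]
  have hinj : Set.InjOn f₀ S₀ := by
    intro u hu v hv huv
    have hp12 : p.1 ≠ p.2 := SimpleGraph.Adj.ne hpadj
    rcases (hS₀m u).1 hu with rfl | rfl | rfl <;> rcases (hS₀m v).1 hv with rfl | rfl | rfl <;>
      first
      | rfl
      | (simp only [hfa, hfb, hfb'] at huv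
         first
         | exact absurd huv hp1
         | exact absurd huv hp2
         | exact absurd huv.symm hp1
         | exact absurd huv.symm hp2
         | exact absurd huv hp12
         | exact absurd huv.symm hp12)
  have hadj : ∀ u ∈ S₀, ∀ v ∈ S₀, H.Adj u v → G2.Adj (f₀ u) (f₀ v) := by
    intro u hu v hv huv
    rcases (hS₀m u).1 hu with rfl | rfl | rfl <;> rcases (hS₀m v).1 hv with rfl | rfl | rfl <;>
      simp only [hfa, hfb, hfb'] <;>
      first
      | exact absurd huv (H.loopless.irrefl _)
      | exact hxa _ (Or.inl rfl)
      | exact hxa _ (Or.inr rfl)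
      | exact SimpleGraph.Adj.symm (hxa _ (Or.inl rfl))
      | exact SimpleGraph.Adj.symm (hxa _ (Or.inr rfl))
      | exact hpp
      | exact SimpleGraph.Adj.symm hpp
  have hshare : ∀ u ∈ S₀, ∀ v ∈ S₀, ∀ w ∈ S₀, ∀ z ∈ S₀, u ≠ v → w ≠ z →
      u = w ∨ u = z ∨ v = w ∨ v = z := by
    intro u hu v hv w hw z hz huv hwz
    exact share_of_card_le_three (S := S₀) (by rw [hS₀]; exact card_le_three) hu hv hw hz huv hwz
  have hCb : ∀ w, w ∉ S₀ → ∀ z ∈ (if c w = c b then S' else B' : Finset V), z ∉ Sat ∧ z ≠ x := by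
    intro w _ z hz
    split_ifs at hz
    · have := hS' hz
      rw [hA1] at this
      exact this.2
    · have := hB' hz
      rw [hA2] at this
      exact this.2
  obtain ⟨f, hf, hf1, hf2⟩ := exists_rainbow_extension H G2 χ hχ2 S₀ f₀ hinj hadj
    (fun u hu v hv w hw z hz huv hwz he =>
      hχ2.eq_of_share hinj hu hv hw hz (hadj u hu v hv huv) (hadj w hw z hz hwz)
        (hshare u hu v hv w hw z hz (SimpleGraph.Adj.ne huv) (SimpleGraph.Adj.ne hwz)) he)
    (fun w => if c w = c b then S' else B') 0
    (by
      intro w hw w' hw' hww y hy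
      rw [Nat.le_zero, card_eq_zero, filter_eq_empty_iff]
      intro z hz hyz
      have hcw : c w' ≠ c w := hc w' w hww (fun h => hw' ((hS₀m _).2 (Or.inl h)))
        (fun h => hw ((hS₀m _).2 (Or.inl h)))
      by_cases h1 : c w = c b
      · have h2 : c w' ≠ c b := fun h => hcw (h.trans h1.symm)
        simp only [h1, h2, if_true, if_false] at hy hz
        exact hyz (SimpleGraph.Adj.symm (hcomp z hz y hy))
      · have h2 : c w' = c b := by omega
        simp only [h1, h2, if_true, if_false] at hy hz
        exact hyz (hcomp y hy z hz))
    (by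
      intro w hw w' hw' hww z hz
      have hwa : w ≠ a := fun h => hw ((hS₀m _).2 (Or.inl h))
      rcases (hS₀m w').1 hw' with rfl | rfl | rfl
      · exact absurd ((hS₀m w).2 (Or.inr ((hN w).1 hww))) hw
      · have h1 : c w ≠ c w' := (hc _ _ hww hba hwa).symm
        simp only [h1, if_false] at hz
        have := hB' hz
        rw [hA2] at this
        rw [hfb]
        exact this.1
      · have h1 : c w = c b := by
          have := hc _ _ hww hba' hwa
          omega
        simp only [h1, if_true] at hz
        have := hS' hz
        rw [hA1] at this
        rw [hfb']
        exact this.1)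
    (by
      intro w _
      show h * 0 + h + h ^ 3 < #(if c w = c b then S' else B')
      split_ifs <;> omega)
  have hfa' : f a = x := (hf1 a (by simp [hS₀])).trans hfa
  have hfp : (f b, f b') = p := by
    rw [hf1 b (by simp [hS₀]), hf1 b' (by simp [hS₀]), hfb, hfb']
  obtain ⟨F', hF'1, hF'2, hF'3, -⟩ := hF.exists_insert hH (hf.mono (hG1 ▸ hG2le))
  have hlt := hmax F' (mem_filter.2 ⟨mem_univ _, hF'1, ?_, ?_, ?_, ?_⟩)
  · omega
  · intro g hg
    rcases (hF'3 g).1 hg with rfl | hg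
    exacts [hfa', hFx g hg]
  · intro g hg
    rcases (hF'3 g).1 hg with rfl | hg
    exacts [hfp ▸ hpM, hFM g hg]
  · intro g hg q hq hqe
    rcases (hF'3 g).1 hg with rfl | hg
    · rw [hfp]
      by_contra hne
      have h1 := hf.imgE_subset hqe
      exact ((hG2adj _ _).1 h1).2 ⟨q, hq, hne, rfl⟩
    · exact hFe g hg q hq hqe
  · intro v
    have h1 := fillCount_insert_le hF'3 (S₀ := S₀) v
    by_cases hv : v ∈ Sat
    · exact (h1.2 fun w hw hwv => ((hCb w hw _ (hf2 w hw)).1 (hwv ▸ hv))).trans (hFK v)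
    · have : ¬ K₀ ≤ fillCount S₀ F v := by simpa [hSat] using hv
      omega
end

section
open Finset
open scoped Classical
variable {H : SimpleGraph W} {G : SimpleGraph V} {χ : Sym2 V → ℕ}

/-- The conclusion of `exists_center_packing_two`, for every density excess. -/
def CenterPackTwo (H : SimpleGraph W) (a : W) : Prop :=
  ∀ β : ℝ, 0 < β → ∃ K n₀ : ℕ, ∀ (V : Type) [Fintype V] (G : SimpleGraph V) (χ : Sym2 V → ℕ)
    (x : V), ProperEdgeColoring G χ → n₀ ≤ Fintype.card V → (∀ v, dg G x ≤ dg G v) →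
      (1 / 2 + β) * Fintype.card V ≤ dg G x →
      ∃ F : Finset (W → V), IsPacking H G χ F ∧ (∀ f ∈ F, f a = x) ∧
        (2 * dg G x ≤ Fintype.card V + #F ∨ dg G x ≤ 2 * #F + 1) ∧
        ∀ v, v ≠ x → ∑ f ∈ F, udg H f v ≤ K

lemma CenterPackTwo.exists_step [Fintype W] {a : W} (hcp : CenterPackTwo H a) (ha : dg H a = 2)
    {γ : ℝ} (hγ0 : 0 ≤ γ) (hγ1 : γ ≤ 1 / 2) {ε : ℝ} (hε : 0 < ε) :
    ∃ n₀ : ℕ, ∀ (V : Type) [Fintype V] (G : SimpleGraph V) (χ : Sym2 V → ℕ) (x : V),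
      ProperEdgeColoring G χ → n₀ ≤ Fintype.card V → (∀ v, dg G x ≤ dg G v) →
      dg G x * (1 + γ) ≤ Fintype.card V →
      ∃ F : Finset (W → V), IsPacking H G χ F ∧ (∀ f ∈ F, f a = x) ∧
        (dg G x : ℝ) - (dg H a - 1 - γ) * #F ≤
          (1 - 1 / ((2 : ℕ) : ℝ)) * Fintype.card V + ε * Fintype.card V := by
  obtain ⟨K, n₀, hK⟩ := hcp ε hε
  obtain ⟨n₁, hn₁⟩ := exists_nat_gt (1 / ε)
  refine ⟨max n₀ n₁, fun V _ G χ x hχ hn hx hd => ?_⟩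
  have hn1 : (1 : ℝ) ≤ ε * Fintype.card V := by
    have : (n₁ : ℝ) ≤ Fintype.card V := by exact_mod_cast (le_max_right _ _).trans hn
    rw [div_lt_iff₀ hε] at hn₁
    nlinarith
  have ha' : (dg H a : ℝ) = 2 := by exact_mod_cast ha
  rw [ha']
  push_cast
  have hn0 : (0 : ℝ) ≤ Fintype.card V := Nat.cast_nonneg _
  by_cases hlow : (1 / 2 + ε) * Fintype.card V ≤ dg G x
  · obtain ⟨F, hF, hFx, hc, -⟩ := hK V G χ x hχ ((le_max_left _ _).trans hn) hx hlow
    refine ⟨F, hF, hFx, ?_⟩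
    rcases hc with hc | hc
    · have : (2 * dg G x : ℝ) ≤ Fintype.card V + #F := by exact_mod_cast hc
      have : (1 - γ) * (2 * dg G x - Fintype.card V) ≤ (1 - γ) * #F := by
        gcongr <;> linarith
      nlinarith
    · have : (dg G x : ℝ) ≤ 2 * #F + 1 := by exact_mod_cast hc
      have : (1 - γ) * (dg G x - 1) ≤ (1 - γ) * (2 * #F) := by
        gcongr <;> linarith
      nlinarith
  · refine ⟨∅, isPacking_empty, by simp, ?_⟩
    simp only [card_empty, Nat.cast_zero, mul_zero, sub_zero]
    push Not at hlow
    linarith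

lemma CenterPackTwo.packBound_zero [Fintype W] {a : W} (hcp : CenterPackTwo H a)
    (ha : dg H a = 2) (hH : 0 < eCount H) : PackBound H 2 0 := by
  refine packBound_of_step hH 2 (by omega) _ a fun ε hε => ?_
  obtain ⟨n₀, hn₀⟩ := hcp.exists_step ha le_rfl (by norm_num) hε
  refine ⟨n₀ + 1, fun V _ G χ hχ hn => Or.inr ?_⟩
  have : Nonempty V := Fintype.card_pos_iff.1 (by omega)
  obtain ⟨x, hx⟩ := exists_min_dg G
  obtain ⟨F, hF, hFx, hb⟩ := hn₀ V G χ x hχ (by omega) hx (by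
    have : (dg G x : ℝ) ≤ Fintype.card V := by exact_mod_cast dg_le_card G x
    linarith)
  exact ⟨x, F, hF, hFx, hb⟩

/-- Deleting one vertex of a dense graph after packing copies centred at it. -/
lemma CenterPackTwo.exists_peel [Fintype W] {a : W} (hcp : CenterPackTwo H a)
    (ha : dg H a = 2) (hH : 3 ≤ eCount H) :
    ∃ K n₀ : ℕ, ∀ (V : Type) [Fintype V] (G : SimpleGraph V) (χ : Sym2 V → ℕ),
      ProperEdgeColoring G χ → n₀ ≤ Fintype.card V → 0 < Fintype.card V →
      (∀ v, (3 / 4 : ℝ) * Fintype.card V ≤ dg G v) →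
      ∃ (V' : Type) (_ : Fintype V') (G' : SimpleGraph V') (χ' : Sym2 V' → ℕ) (d j : ℕ),
        ProperEdgeColoring G' χ' ∧ Fintype.card V' + 1 = Fintype.card V ∧
        (∀ N, HasPack H G' χ' N → HasPack H G χ (j + N)) ∧
        (∀ D : ℕ, (∀ v, D + (K + 1) ≤ dg G v) → ∀ v, D ≤ dg G' v) ∧
        d * Fintype.card V ≤ 2 * eCount G ∧ d ≤ 2 * j + 1 ∧
        (3 / 4 : ℝ) * Fintype.card V ≤ d ∧
        eCount G' + eCount H * j + d = eCount G + 2 * j := by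
  obtain ⟨K, n₀, hK⟩ := hcp (1 / 4) (by norm_num)
  refine ⟨K, n₀, fun V _ G χ hχ hn hpos hdeg => ?_⟩
  have : Nonempty V := Fintype.card_pos_iff.1 hpos
  obtain ⟨x, hx⟩ := exists_min_dg G
  obtain ⟨F, hF, hFx, hb, hu⟩ := hK V G χ x hχ hn hx (by
    have := hdeg x
    norm_num at this ⊢
    linarith)
  refine ⟨({x}ᶜ : Set V), inferInstance, delV (restG H G F) x, χ ∘ Sym2.map Subtype.val,
    dg G x, #F, (hχ.mono (restG_le F)).comap _ Subtype.val_injective, card_delV x,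
    fun N hN => hF.hasPack_delV (by omega) hN, ?_, ?_, ?_, hdeg x, ?_⟩
  · intro D hD v
    have h1 := dg_le_dg_delV_add_one (restG H G F) x v
    have h2 := hF.dg_restG v
    have h3 := hu v v.2
    have h4 := hD v
    omega
  · rw [← sum_dg, mul_comm, ← smul_eq_mul]
    exact card_nsmul_le_sum univ _ _ fun v _ => hx v
  · rcases hb with hb | hb
    · have h1 : (3 / 4 : ℝ) * Fintype.card V ≤ dg G x := hdeg x
      have h2 : 3 * Fintype.card V ≤ 4 * dg G x := by
        have : (3 : ℝ) * Fintype.card V ≤ 4 * dg G x := by linarith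
        exact_mod_cast this
      omega
    · exact hb
  · have := hF.eCount_delV hFx
    rw [ha] at this
    exact this

lemma CenterPackTwo.exists_pack_of_dense_aux [Fintype W] {a : W} (hcp : CenterPackTwo H a)
    (ha : dg H a = 2) (hH : 3 ≤ eCount H) :
    ∃ K n₀ : ℕ, ∀ (n I : ℕ) (B : ℝ), 100 * I ≤ n → 100 ≤ n → 16 * (I * (K + 1)) ≤ n →
      n₀ + I ≤ n → (∀ (V : Type) [Fintype V] (G : SimpleGraph V) (χ : Sym2 V → ℕ),
        ProperEdgeColoring G χ → Fintype.card V + I = n → ∃ N : ℕ, HasPack H G χ N ∧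
          (eCount G : ℝ) - (eCount H - 1) * N ≤ B) →
      ∀ (i l : ℕ), l + i = I → ∀ (V : Type) [Fintype V] (G : SimpleGraph V) (χ : Sym2 V → ℕ),
        ProperEdgeColoring G χ → Fintype.card V + l = n →
        (∀ v, 7 * n ≤ 8 * (dg G v + l * (K + 1))) →
        (eCount G : ℝ) ≤ (n : ℝ) ^ 2 / 2 - 9 / 8 * l * (n - I) + l / 2 →
        ∃ N : ℕ, HasPack H G χ N ∧ (eCount G : ℝ) - (eCount H - 1) * N ≤
          B + ((I - l) * (n + 1) - 0.6 * (I * (I - 1) - l * (l - 1))) / 2 := by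
  obtain ⟨K, n₀, hK⟩ := hcp.exists_peel ha hH
  refine ⟨K, n₀, fun n I B h1 h2 h3 h4 hB i => ?_⟩
  induction i with
  | zero =>
    intro l hl V _ G χ hχ hV _ _
    obtain rfl : l = I := by omega
    obtain ⟨N, hN, hb⟩ := hB V G χ hχ hV
    exact ⟨N, hN, hb.trans (by simp)⟩
  | succ i ih =>
    intro l hl V _ G χ hχ hV hdeg he
    have hlI : l * (K + 1) ≤ I * (K + 1) := Nat.mul_le_mul_right _ (by omega)
    obtain ⟨V', _, G', χ', d, j, hχ', hV', hpk, hdg, hd2, hdj, hd3, hee⟩ :=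
      hK V G χ hχ (by omega) (by omega) (by
        intro v
        have h5 := hdeg v
        have h6 : 3 * Fintype.card V ≤ 4 * dg G v := by omega
        have : (3 : ℝ) * Fintype.card V ≤ 4 * dg G v := by exact_mod_cast h6
        linarith)
    have hnV : (Fintype.card V : ℝ) = n - l := by
      rw [← hV]; push_cast; ring
    have hlI' : (l : ℝ) + i + 1 = I := by exact_mod_cast hl
    have h1' : (100 : ℝ) * I ≤ n := by exact_mod_cast h1
    have h2' : (100 : ℝ) ≤ n := by exact_mod_cast h2
    have hl0 : (0 : ℝ) ≤ l := Nat.cast_nonneg _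
    have hi0 : (0 : ℝ) ≤ i := Nat.cast_nonneg _
    have hee' : (eCount G' : ℝ) + eCount H * j + d = eCount G + 2 * j := by exact_mod_cast hee
    have hdj' : (d : ℝ) ≤ 2 * j + 1 := by exact_mod_cast hdj
    have hH' : (3 : ℝ) ≤ eCount H := by exact_mod_cast hH
    have hd2' : (d : ℝ) * (n - l) ≤ 2 * eCount G := by rw [← hnV]; exact_mod_cast hd2
    rw [hnV] at hd3
    have hkj : 3 * (j : ℝ) ≤ eCount H * j := by gcongr
    obtain ⟨N, hN, hb⟩ := ih (l + 1) (by omega) V' G' χ' hχ' (by omega) (by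
      intro v
      have h5 : (l + 1) * (K + 1) ≤ I * (K + 1) := Nat.mul_le_mul_right _ (by omega)
      have h6 : (l + 1) * (K + 1) = l * (K + 1) + (K + 1) := by ring
      have h7 := hdg ((7 * n + 7) / 8 - (l + 1) * (K + 1)) (fun u => by
        have := hdeg u
        omega) v
      omega) (by
        push_cast
        have : (3 / 4 : ℝ) * (n - l) ≥ 3 / 4 * (n - I) := by linarith
        linarith)
    refine ⟨j + N, hpk N hN, ?_⟩
    have hdn : (d : ℝ) ≤ n - 1.2 * l := by
      by_contra hcon
      push Not at hcon
      have h5 : 0 < (n : ℝ) - l := by linarith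
      have h6 : (n - 1.2 * l) * ((n : ℝ) - l) < d * (n - l) := by gcongr
      nlinarith
    push_cast at hb ⊢
    linarith

lemma CenterPackTwo.exists_pack_of_dense [Fintype W] {a : W} (hcp : CenterPackTwo H a)
    (ha : dg H a = 2) (hH : 3 ≤ eCount H) :
    ∃ (γ : ℝ) (n₁ : ℕ), 0 < γ ∧ ∀ (V : Type) [Fintype V] (G : SimpleGraph V) (χ : Sym2 V → ℕ),
      ProperEdgeColoring G χ → n₁ ≤ Fintype.card V →
      (∀ v, 7 * Fintype.card V ≤ 8 * dg G v) →
      ∃ N : ℕ, HasPack H G χ N ∧ (eCount G : ℝ) - (eCount H - 1) * N + γ * N ≤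
        (Fintype.card V : ℝ) ^ 2 / 4 := by
  obtain ⟨K, n₀, hK⟩ := hcp.exists_pack_of_dense_aux ha hH
  set T : ℕ := 100 * (K + 1) with hT
  have hTpos : (0 : ℝ) < T := by rw [hT]; push_cast; positivity
  set η : ℝ := 1 / (2 * T) with hη
  have hηp : 0 < η := by positivity
  obtain ⟨C, hC⟩ := hcp.packBound_zero ha (by omega) (0.01 * η ^ 2) (by positivity)
  obtain ⟨n₂, hn₂⟩ := exists_nat_gt ((|C| + 3) / (0.01 * η ^ 2))
  refine ⟨0.01 * η ^ 2, max (max n₂ (2 * T)) (2 * n₀ + 100), by positivity,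
    fun V _ G χ hχ hn hdeg => ?_⟩
  obtain ⟨n, hnV⟩ : ∃ n, n = Fintype.card V := ⟨_, rfl⟩
  rw [← hnV] at hn hdeg ⊢
  have hn1 : n₂ ≤ n := by omega
  have hn2 : 2 * T ≤ n := by omega
  have hn3 : 2 * n₀ + 100 ≤ n := by omega
  obtain ⟨I, hI⟩ : ∃ I, I = n / T := ⟨_, rfl⟩
  have hI1 : I * T ≤ n := by rw [hI]; exact Nat.div_mul_le_self n T
  have hIT : I * T = 100 * (I * (K + 1)) := by rw [hT]; ring
  have hIK : I ≤ I * (K + 1) := Nat.le_mul_of_pos_right _ (by omega)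
  have hI2 : η * n ≤ I := by
    have h1 : n < T * (I + 1) := by
      rw [hI]
      exact Nat.lt_mul_div_succ n (by rw [hT]; positivity)
    have h1' : (n : ℝ) < T * (I + 1) := by exact_mod_cast h1
    have h2 : (2 : ℝ) * T ≤ n := by exact_mod_cast hn2
    rw [hη, div_mul_eq_mul_div, div_le_iff₀ (by positivity)]
    nlinarith
  have hI1' : (100 : ℝ) * I ≤ n := by exact_mod_cast (by omega : 100 * I ≤ n)
  have hn0 : (0 : ℝ) ≤ n := Nat.cast_nonneg _
  have hI0 : (0 : ℝ) ≤ I := Nat.cast_nonneg _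
  obtain ⟨N, hN, hb⟩ := hK n I (((n : ℝ) - I) ^ 2 / 4 + 0.01 * η ^ 2 * (n - I) ^ 2 + C)
    (by omega) (by omega) (by omega) (by omega) (by
      intro V _ G χ hχ hV
      obtain ⟨N, hN, hb⟩ := hC V G χ hχ
      have hV' : (Fintype.card V : ℝ) = n - I := by rw [← hV]; push_cast; ring
      refine ⟨N, hN, ?_⟩
      rw [hV'] at hb
      norm_num at hb ⊢
      linarith) I 0 (by omega) V G χ hχ (by omega) (by intro v; have := hdeg v; omega) (by
      have := two_mul_eCount_le G
      rw [← hnV] at this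
      have : (2 : ℝ) * eCount G ≤ n ^ 2 := by exact_mod_cast this
      simp only [Nat.cast_zero]
      linarith)
  refine ⟨N, hN, ?_⟩
  have hNn : (N : ℝ) ≤ n ^ 2 / 2 := by
    obtain ⟨F, hF, rfl⟩ := hN
    have h1 := hF.eCount_restG
    have h2 := two_mul_eCount_le G
    rw [← hnV] at h2
    have h3 : 1 * #F ≤ eCount H * #F := Nat.mul_le_mul_right _ (by omega)
    have : (2 * #F : ℝ) ≤ n ^ 2 := by exact_mod_cast (by omega : 2 * #F ≤ n ^ 2)
    linarith
  have h1 : 0.01 * η ^ 2 * N ≤ 0.01 * η ^ 2 * (n ^ 2 / 2) := by gcongr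
  have h2 : 0.01 * η ^ 2 * ((n : ℝ) - I) ^ 2 ≤ 0.01 * η ^ 2 * n ^ 2 := by
    gcongr
    · linarith
    · linarith
  have h3 : (η * n) ^ 2 ≤ (I : ℝ) ^ 2 := by gcongr
  have h4 : |C| + 3 ≤ 0.01 * η ^ 2 * n := by
    rw [div_lt_iff₀ (by positivity)] at hn₂
    have : (n₂ : ℝ) ≤ n := by exact_mod_cast hn1
    have : (n₂ : ℝ) * (0.01 * η ^ 2) ≤ n * (0.01 * η ^ 2) := by gcongr
    linarith
  have h5 : (|C| + 3) * n ≤ 0.01 * η ^ 2 * n * n := by gcongr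
  have h6 : C ≤ |C| * n := by
    have : (1 : ℝ) ≤ n := by
      have : (100 : ℝ) ≤ n := by exact_mod_cast (by omega : 100 ≤ n)
      linarith
    have := le_abs_self C
    have := abs_nonneg C
    nlinarith
  push_cast at hb
  nlinarith

theorem CenterPackTwo.exists_packBound [Fintype W] {a : W} (hcp : CenterPackTwo H a)
    (ha : dg H a = 2) (hH : 3 ≤ eCount H) : ∃ γ : ℝ, 0 < γ ∧ PackBound H 2 γ := by
  obtain ⟨γ, n₁, hγ, hd⟩ := hcp.exists_pack_of_dense ha hH
  refine ⟨min γ (1 / 8), by positivity, ?_⟩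
  refine packBound_of_step (by omega) 2 (by omega) _ a fun ε hε => ?_
  obtain ⟨n₀, hn₀⟩ := hcp.exists_step ha (γ := min γ (1 / 8)) (by positivity)
    ((min_le_right _ _).trans (by norm_num)) hε
  refine ⟨max n₀ n₁ + 1, fun V _ G χ hχ hn => ?_⟩
  have : Nonempty V := Fintype.card_pos_iff.1 (by omega)
  by_cases hdeg : ∀ v, 7 * Fintype.card V ≤ 8 * dg G v
  · left
    obtain ⟨N, hN, hb⟩ := hd V G χ hχ (by omega) hdeg
    refine ⟨N, hN, ?_⟩
    have h1 : min γ (1 / 8) * N ≤ γ * N := by gcongr; exact min_le_left _ _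
    have h2 : 0 ≤ ε * (Fintype.card V : ℝ) ^ 2 := by positivity
    push_cast
    linarith
  · right
    obtain ⟨x, hx⟩ := exists_min_dg G
    push Not at hdeg
    obtain ⟨v, hv⟩ := hdeg
    have hxv := hx v
    obtain ⟨F, hF, hFx, hb⟩ := hn₀ V G χ x hχ (by omega) hx (by
      have h1 : (8 : ℝ) * dg G x ≤ 7 * Fintype.card V := by
        exact_mod_cast (by omega : 8 * dg G x ≤ 7 * Fintype.card V)
      have h2 : (dg G x : ℝ) * (1 + min γ (1 / 8)) ≤ dg G x * (1 + 1 / 8) := by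
        gcongr; exact min_le_right _ _
      have : (0 : ℝ) ≤ Fintype.card V := Nat.cast_nonneg _
      linarith)
    exact ⟨x, F, hF, hFx, hb⟩
end

section
open Finset
open scoped Classical
variable {H : SimpleGraph W} {G : SimpleGraph V} {χ : Sym2 V → ℕ}

/-- `ab` is an edge of the graph `H`, of chromatic number `s + 1`, and `c` is a proper
`s`-coloring of `H - ab`. -/
structure CritEdge (H : SimpleGraph W) (s : ℕ) (a b : W) (c : W → Fin s) : Prop where
  two_le : 2 ≤ s
  adj : H.Adj a b
  col : ∀ u v, H.Adj u v → s(u, v) ≠ s(a, b) → c u ≠ c v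
  not_col : ¬ H.Colorable s

lemma exists_critEdge {r : ℕ} (hr : 3 ≤ r) (hχH : H.chromaticNumber = (r : ℕ∞))
    (hcrit : ∃ a b : W, H.Adj a b ∧
      (H.deleteEdges {s(a, b)}).chromaticNumber < H.chromaticNumber) :
    ∃ (a b : W) (c : W → Fin (r - 1)), CritEdge H (r - 1) a b c := by
  obtain ⟨a, b, hab, h⟩ := hcrit
  have h1 : (H.deleteEdges {s(a, b)}).chromaticNumber ≤ ((r - 1 : ℕ) : ℕ∞) := by
    rw [hχH] at h
    refine Order.le_of_lt_add_one ?_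
    have : ((r - 1 : ℕ) : ℕ∞) + 1 = r := by
      exact_mod_cast (by omega : r - 1 + 1 = r)
    rwa [this]
  obtain ⟨c⟩ := SimpleGraph.chromaticNumber_le_iff_colorable.1 h1
  refine ⟨a, b, c, by omega, hab, fun u v huv hne => c.valid ?_, fun hcol => ?_⟩
  · rw [SimpleGraph.deleteEdges_adj]
    exact ⟨huv, hne⟩
  · have := SimpleGraph.chromaticNumber_le_iff_colorable.2 hcol
    rw [hχH] at this
    have : r ≤ r - 1 := by exact_mod_cast this
    omega

namespace CritEdge
variable {s : ℕ} {a b : W} {c : W → Fin s}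

lemma color_eq (h : CritEdge H s a b c) : c a = c b := by
  by_contra hne
  refine h.not_col ⟨SimpleGraph.Coloring.mk c fun {u v} huv => ?_⟩
  by_cases he : s(u, v) = s(a, b)
  · rcases Sym2.eq_iff.1 he with ⟨rfl, rfl⟩ | ⟨rfl, rfl⟩
    · exact hne
    · exact Ne.symm hne
  · exact h.col u v huv he

lemma color_ne (h : CritEdge H s a b c) {u v : W} (huv : H.Adj u v) (hu : u ≠ a)
    (hv : v ≠ a) : c u ≠ c v := by
  refine h.col u v huv fun he => ?_
  rcases Sym2.eq_iff.1 he with ⟨rfl, -⟩ | ⟨-, rfl⟩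
  · exact hu rfl
  · exact hv rfl

lemma color_ne_left (h : CritEdge H s a b c) {v : W} (hv : H.Adj a v) (hvb : v ≠ b) :
    c v ≠ c a := by
  refine (h.col a v hv fun he => ?_).symm
  exact hvb (Sym2.congr_right.1 he)

lemma exists_adj (h : CritEdge H s a b c) {i : Fin s} (hi : i ≠ c a) :
    ∃ u, H.Adj a u ∧ c u = i := by
  by_contra! hno
  refine h.not_col ⟨SimpleGraph.Coloring.mk (Function.update c a i) fun {u v} huv => ?_⟩
  by_cases hu : u = a
  · subst hu
    have hv : v ≠ u := (SimpleGraph.Adj.ne huv).symm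
    rw [Function.update_self, Function.update_of_ne hv]
    exact (hno v huv).symm
  · by_cases hv : v = a
    · subst hv
      rw [Function.update_self, Function.update_of_ne hu]
      exact hno u (SimpleGraph.Adj.symm huv)
    · rw [Function.update_of_ne hu, Function.update_of_ne hv]
      exact h.color_ne huv hu hv

lemma le_dg [Fintype W] (h : CritEdge H s a b c) : s ≤ dg H a := by
  have h1 : (univ : Finset (Fin s)) ⊆ image c ({w | H.Adj a w} : Finset W) := by
    intro i _
    by_cases hi : i = c a
    · exact mem_image.2 ⟨b, by simpa using h.adj, by rw [hi, h.color_eq]⟩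
    · obtain ⟨u, hu, rfl⟩ := h.exists_adj hi
      exact mem_image_of_mem _ (by simpa using hu)
  have h2 := (card_le_card h1).trans card_image_le
  rwa [card_univ, Fintype.card_fin] at h2

lemma dg_lt_eCount [Fintype W] (h : CritEdge H s a b c) : dg H a < eCount H := by
  have h0 := RainbowDecomp.eCount_delV H a
  suffices 0 < eCount (delV H a) by omega
  by_contra hpos
  have hno : ∀ u v, H.Adj u v → u ≠ a → v ≠ a → False := by
    intro u v huv hu hv
    have h1 : s(⟨u, hu⟩, ⟨v, hv⟩) ∈ (delV H a).edgeSet := huv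
    rw [eCount, Nat.not_lt, Nat.le_zero, Set.ncard_eq_zero (Set.toFinite _)] at hpos
    rw [hpos] at h1
    exact h1
  have hs := h.two_le
  refine h.not_col ⟨SimpleGraph.Coloring.mk
    (fun u => if u = a then (⟨0, by omega⟩ : Fin s) else ⟨1, by omega⟩) fun {u v} huv => ?_⟩
  by_cases hu : u = a
  · have hv : v ≠ a := fun hv => SimpleGraph.Adj.ne huv (hu.trans hv.symm)
    simp [hu, hv]
  · by_cases hv : v = a
    · simp [hu, hv]
    · exact (hno u v huv hu hv).elim

theorem exists_packBound [Fintype W] (h : CritEdge H s a b c) :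
    ∃ γ : ℝ, 0 < γ ∧ PackBound H s γ := by
  have h2 := h.two_le
  have h3 := h.le_dg
  have h4 := h.dg_lt_eCount
  by_cases h5 : 3 ≤ dg H a
  · obtain ⟨p, rfl⟩ : ∃ p, s = p + 1 := ⟨s - 1, by omega⟩
    exact ⟨1 / 2, by norm_num, packBound_of_three_le p (by omega) a h5 (by omega) c
      (fun u v huv hu hv => h.color_ne huv hu hv) h3⟩
  · obtain rfl : s = 2 := by omega
    have h6 : dg H a = 2 := by omega
    have hb : b ∈ ({w | H.Adj a w} : Finset W) := by simpa using h.adj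
    obtain ⟨b', hb', hN⟩ : ∃ b', b ≠ b' ∧ ({w | H.Adj a w} : Finset W) = {b, b'} := by
      obtain ⟨x, y, hxy, he⟩ := card_eq_two.1 h6
      rw [he, mem_insert, mem_singleton] at hb
      rcases hb with rfl | rfl
      · exact ⟨y, hxy, he⟩
      · exact ⟨x, hxy.symm, by rw [he, pair_comm]⟩
    have hN' : ∀ u, H.Adj a u ↔ u = b ∨ u = b' := by
      intro u
      have : u ∈ ({w | H.Adj a w} : Finset W) ↔ u ∈ ({b, b'} : Finset W) := by rw [hN]
      simpa using this
    have hcp : CenterPackTwo H a := fun β hβ =>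
      exists_center_packing_two (by omega) a b b' hb' hN' c
        (fun u v huv hu hv => h.color_ne huv hu hv)
        (by
          rw [← h.color_eq]
          exact (h.color_ne_left ((hN' b').2 (Or.inr rfl)) hb'.symm).symm) β hβ
    exact hcp.exists_packBound h6 (by omega)

end CritEdge
end

section
open Finset
open scoped Classical
variable {H : SimpleGraph W} {G : SimpleGraph V} {χ : Sym2 V → ℕ}
variable {s : ℕ} {a b : W} {c : W → Fin s}

lemma CritEdge.exists_emb_one [Fintype W] (h : CritEdge H s a b c) (hχ : ProperEdgeColoring G χ)
    (u : V) (X : Fin s → Finset V) (q : ℕ)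
    (hX : ∀ i j, i ≠ j → ∀ y ∈ X i, #{z ∈ X j | ¬ G.Adj y z} ≤ q)
    (hu : ∀ i, Fintype.card W * q + Fintype.card W + Fintype.card W ^ 3 <
      #{z ∈ X i | G.Adj u z}) :
    ∃ f, RainbowEmb H G χ f ∧ f a = u ∧ ∀ w, w ≠ a → f w ∈ X (c w) := by
  obtain ⟨f, hf, h1, h2⟩ := exists_rainbow_extension H G χ hχ {a} (fun _ => u)
    (by simp) (by
      intro x hx y hy hxy
      rw [mem_singleton.1 hx, mem_singleton.1 hy] at hxy
      exact absurd hxy (H.loopless.irrefl _))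
    (by
      intro x hx y hy _ _ _ _ hxy
      rw [mem_singleton.1 hx, mem_singleton.1 hy] at hxy
      exact absurd hxy (H.loopless.irrefl _))
    (fun w => {z ∈ X (c w) | G.Adj u z}) q
    (by
      intro w hw w' hw' hww y hy
      refine (card_le_card ?_).trans (hX (c w') (c w)
        (h.color_ne hww (by simpa using hw') (by simpa using hw)) y (mem_filter.1 hy).1)
      exact filter_subset_filter _ (filter_subset _ _))
    (fun w _ w' _ _ z hz => (mem_filter.1 hz).2)
    (fun w _ => hu (c w))
  exact ⟨f, hf, h1 a (mem_singleton_self a), fun w hw =>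
    (mem_filter.1 (h2 w (by simpa using hw))).1⟩

lemma CritEdge.exists_emb_two [Fintype W] (h : CritEdge H s a b c) (hχ : ProperEdgeColoring G χ)
    (u v : V) (huv : G.Adj u v) (X : Fin s → Finset V) (q : ℕ)
    (hX : ∀ i j, i ≠ j → ∀ y ∈ X i, #{z ∈ X j | ¬ G.Adj y z} ≤ q)
    (hXa : Fintype.card W * q + Fintype.card W + Fintype.card W ^ 3 < #(X (c a)))
    (hu : ∀ i, i ≠ c a → Fintype.card W * q + Fintype.card W + Fintype.card W ^ 3 <
      #{z ∈ X i | G.Adj u z ∧ G.Adj v z}) :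
    ∃ f, RainbowEmb H G χ f ∧ f a = u ∧ f b = v ∧ ∀ w, w ≠ a → w ≠ b → f w ∈ X (c w) := by
  have hba : b ≠ a := (SimpleGraph.Adj.ne h.adj).symm
  set f₀ : W → V := fun w => if w = a then u else v with hf₀
  have hfa : f₀ a = u := by simp [hf₀]
  have hfb : f₀ b = v := by simp [hf₀, hba]
  have hm : ∀ w, w ∈ ({a, b} : Finset W) ↔ w = a ∨ w = b := by simp
  have hinj : Set.InjOn f₀ ({a, b} : Finset W) := by
    intro x hx y hy hxy
    have := SimpleGraph.Adj.ne huv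
    rcases (hm x).1 hx with rfl | rfl <;> rcases (hm y).1 hy with rfl | rfl
    · rfl
    · rw [hfa, hfb] at hxy; exact absurd hxy this
    · rw [hfa, hfb] at hxy; exact absurd hxy.symm this
    · rfl
  have hadj : ∀ x ∈ ({a, b} : Finset W), ∀ y ∈ ({a, b} : Finset W), H.Adj x y →
      G.Adj (f₀ x) (f₀ y) := by
    intro x hx y hy hxy
    rcases (hm x).1 hx with rfl | rfl <;> rcases (hm y).1 hy with rfl | rfl
    · exact absurd hxy (H.loopless.irrefl _)
    · rw [hfa, hfb]; exact huv
    · rw [hfa, hfb]; exact SimpleGraph.Adj.symm huv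
    · exact absurd hxy (H.loopless.irrefl _)
  have hcol : ∀ w, w ∉ ({a, b} : Finset W) → ∀ w' ∈ ({a, b} : Finset W), H.Adj w' w →
      c w ≠ c a := by
    intro w hw w' hw' hww
    rw [hm, not_or] at hw
    rcases (hm w').1 hw' with rfl | rfl
    · exact h.color_ne_left hww hw.2
    · rw [h.color_eq]
      exact (h.color_ne hww hba hw.1).symm
  have hsub : ∀ w, (if c w = c a then X (c w) else
      ({z ∈ X (c w) | G.Adj u z ∧ G.Adj v z} : Finset V)) ⊆ X (c w) := by
    intro w
    split_ifs
    · exact Subset.rfl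
    · exact filter_subset _ _
  obtain ⟨f, hf, h1, h2⟩ := exists_rainbow_extension H G χ hχ {a, b} f₀ hinj hadj
    (fun x hx y hy w hw z hz hxy hwz he =>
      hχ.eq_of_share hinj hx hy hw hz (hadj x hx y hy hxy) (hadj w hw z hz hwz)
        (share_of_card_le_three (S := {a, b}) (card_le_two.trans (by omega)) hx hy hw hz
          (SimpleGraph.Adj.ne hxy) (SimpleGraph.Adj.ne hwz)) he)
    (fun w => if c w = c a then X (c w) else
      ({z ∈ X (c w) | G.Adj u z ∧ G.Adj v z} : Finset V)) q
    (by
      intro w hw w' hw' hww y hy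
      rw [hm, not_or] at hw hw'
      refine (card_le_card ?_).trans (hX (c w') (c w) (h.color_ne hww hw'.1 hw.1) y
        (hsub w' hy))
      exact filter_subset_filter _ (hsub w))
    (by
      intro w hw w' hw' hww z hz
      have h3 := hcol w hw w' hw' hww
      simp only [h3, if_false] at hz
      have h4 := (mem_filter.1 hz).2
      rcases (hm w').1 hw' with rfl | rfl
      · rw [hfa]; exact h4.1
      · rw [hfb]; exact h4.2)
    (by
      intro w hw
      split_ifs with h3
      · rw [h3]; exact hXa
      · exact hu _ h3)
  refine ⟨f, hf, (h1 a (by simp)).trans hfa, (h1 b (by simp)).trans hfb, fun w hwa hwb =>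
    hsub w (h2 w ?_)⟩
  rw [hm, not_or]
  exact ⟨hwa, hwb⟩

/-- The edges of `G` inside the classes of `P`. -/
def insG (G : SimpleGraph V) (P : V → Fin s) : SimpleGraph V where
  Adj u v := G.Adj u v ∧ P u = P v
  symm := ⟨fun _ _ h => ⟨SimpleGraph.Adj.symm h.1, h.2.symm⟩⟩
  loopless := ⟨fun _ h => G.loopless.irrefl _ h.1⟩

lemma eCount_le_of_packBound [Fintype W] {γ : ℝ} (hγ : 0 < γ) (hs : 0 < s)
    (hb : PackBound H s γ) (ε : ℝ) (hε : 0 < ε) :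
    ∃ n₀ : ℕ, ∀ (V : Type) [Fintype V] (G : SimpleGraph V) (χ : Sym2 V → ℕ),
      ProperEdgeColoring G χ → n₀ ≤ Fintype.card V →
      (∀ N, HasPack H G χ N → tn s (Fintype.card V) + (eCount H - 1) * N ≤ eCount G) →
      (eCount G : ℝ) ≤ tn s (Fintype.card V) + ε * (Fintype.card V) ^ 2 := by
  set k : ℝ := (eCount H : ℝ) with hk
  have hk0 : 0 ≤ k := Nat.cast_nonneg _
  obtain ⟨C, hC⟩ := hb (ε * γ / (2 * (γ + k))) (by positivity)
  set e₁ := ε * γ / (2 * (γ + k)) with he₁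
  have he₁p : 0 < e₁ := by positivity
  obtain ⟨n₀, hn₀⟩ := exists_nat_gt ((|C| + s) / e₁)
  refine ⟨n₀ + 1, fun V _ G χ hχ hn hp => ?_⟩
  obtain ⟨N, hN, hb⟩ := hC V G χ hχ
  have h1 := hp N hN
  obtain ⟨n, hnV⟩ : ∃ n, n = Fintype.card V := ⟨_, rfl⟩
  rw [← hnV] at hn h1 hb ⊢
  have h2 : (tn s n : ℝ) + (k - 1) * N ≤ eCount G := by
    have h3 : ((tn s n + (eCount H - 1) * N : ℕ) : ℝ) ≤ eCount G := by exact_mod_cast h1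
    refine le_trans ?_ h3
    push_cast
    have h4 : k - 1 ≤ ((eCount H - 1 : ℕ) : ℝ) := by
      have : eCount H ≤ (eCount H - 1) + 1 := by omega
      have : (eCount H : ℝ) ≤ ((eCount H - 1 : ℕ) : ℝ) + 1 := by exact_mod_cast this
      linarith
    gcongr
  have h3 := le_tn s n hs
  have h4 : |C| + s ≤ e₁ * n ^ 2 := by
    rw [div_lt_iff₀ he₁p] at hn₀
    have h5 : ((n₀ + 1 : ℕ) : ℝ) ≤ n := by exact_mod_cast hn
    push_cast at h5
    have h6 : (0 : ℝ) ≤ n₀ := Nat.cast_nonneg _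
    have h7 : (n₀ : ℝ) ≤ n ^ 2 := by nlinarith
    have : (n₀ : ℝ) * e₁ ≤ n ^ 2 * e₁ := by gcongr
    linarith
  have h5 := le_abs_self C
  have h6 : γ * N ≤ 2 * e₁ * n ^ 2 := by linarith
  have h7 : (eCount G : ℝ) ≤ tn s n + 2 * e₁ * n ^ 2 + (k - 1 - γ) * N := by linarith
  have h8 : k * (γ * N) ≤ k * (2 * e₁ * n ^ 2) := by gcongr
  have h9 : γ * (2 * e₁ * n ^ 2) + k * (2 * e₁ * n ^ 2) = γ * (ε * n ^ 2) := by
    rw [he₁]; field_simp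
  have h10 : γ * ((eCount G : ℝ) - tn s n) ≤ γ * (ε * n ^ 2) := by
    have : γ * ((eCount G : ℝ) - tn s n) ≤ γ * (2 * e₁ * n ^ 2 + (k - 1 - γ) * N) := by
      gcongr; linarith
    have hN0 : (0 : ℝ) ≤ N := Nat.cast_nonneg _
    nlinarith [mul_nonneg (mul_nonneg hγ.le hγ.le) hN0, mul_nonneg hγ.le hN0]
  have := le_of_mul_le_mul_left h10 hγ
  linarith
end

section
open Finset
open scoped Classical
variable {H : SimpleGraph W} {G : SimpleGraph V} {χ : Sym2 V → ℕ}
variable {s : ℕ} {a b : W} {c : W → Fin s}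

lemma le_of_tn_le {n d : ℕ} (hs : 0 < s) (hn : 0 < n) (h : tn s n ≤ tn s (n - 1) + d) :
    (1 - 1 / (s : ℝ)) * n - (s + 1) ≤ d := by
  have h1 := le_tn s n hs
  have h2 := tn_le s (n - 1) hs
  have h3 : (tn s n : ℝ) ≤ tn s (n - 1) + d := by exact_mod_cast h
  rw [Nat.cast_sub hn, Nat.cast_one] at h2
  have h4 : (0 : ℝ) < s := by exact_mod_cast hs
  have h5 : (0 : ℝ) < 1 / (s : ℝ) := by positivity
  nlinarith

lemma card_filter_not_add [Fintype V] (G : SimpleGraph V) (v : V) (A : Finset V) :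
    #{u ∈ A | ¬ G.Adj v u} + #{u ∈ A | G.Adj v u} = #A := by
  rw [add_comm]
  exact card_filter_add_card_filter_not (s := A) (fun u => G.Adj v u)

/-- The number of vertices of `U` not adjacent to `v`. -/
noncomputable def defi (G : SimpleGraph V) (U : Fin s → Finset V) (v : V) : ℕ :=
  ∑ i, #{u ∈ U i | ¬ G.Adj v u}

lemma sum_defi [Fintype V] (G : SimpleGraph V) (U : Fin s → Finset V) :
    ∑ v, defi G U v = ∑ i, ∑ u ∈ U i, #{v | ¬ G.Adj u v} := by
  unfold defi
  rw [sum_comm]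
  refine sum_congr rfl fun i _ => ?_
  simp only [card_filter]
  rw [sum_comm]
  refine sum_congr rfl fun u _ => sum_congr rfl fun v _ => ?_
  rw [SimpleGraph.adj_comm]

lemma card_filter_and (A : Finset V) (p q : V → Prop) :
    #A ≤ #{z ∈ A | p z ∧ q z} + #{z ∈ A | ¬ p z} + #{z ∈ A | ¬ q z} := by
  refine le_trans (card_le_card (t := ({z ∈ A | p z ∧ q z} : Finset V) ∪
    ({z ∈ A | ¬ p z} : Finset V) ∪ ({z ∈ A | ¬ q z} : Finset V)) ?_) ?_
  · intro z hz
    simp only [mem_union, mem_filter, hz, true_and]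
    tauto
  · exact (card_union_le _ _).trans (Nat.add_le_add_right (card_union_le _ _) _)

lemma CritEdge.exists_assignment [Fintype W] [Fintype V] (h : CritEdge H s a b c)
    (hχ : ProperEdgeColoring G χ) (hno : ∀ f, ¬ RainbowEmb H G χ f) (U : Fin s → Finset V)
    (L M : ℕ) (hM : Fintype.card W + Fintype.card W ^ 3 = M) (hL : 6 * M < L)
    (hU : ∀ i, #(U i) = L)
    (hadj : ∀ i j, i ≠ j → ∀ u ∈ U i, ∀ v ∈ U j, G.Adj u v) :
    ∃ (P : V → Fin s) (X : Finset V), (∀ u v, G.Adj u v → P u = P v → u ∈ X ∨ v ∈ X) ∧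
      4 * Fintype.card V * L + #X * L ≤ 4 * ∑ v, defi G U v + 4 * Fintype.card V * M := by
  have hq : ∀ i j, i ≠ j → ∀ y ∈ U i, #{z ∈ U j | ¬ G.Adj y z} ≤ 0 := by
    intro i j hij y hy
    rw [Nat.le_zero, card_eq_zero, filter_eq_empty_iff]
    intro z hz
    exact not_not.2 (hadj i j hij y hy z hz)
  have h1 : ∀ v, ∃ i, #{u ∈ U i | G.Adj v u} ≤ M := by
    intro v
    by_contra! hc
    obtain ⟨f, hf, -⟩ := h.exists_emb_one hχ v U 0 hq (fun i => by
      rw [mul_zero, zero_add, hM]; exact hc i)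
    exact hno f hf
  choose P hP using h1
  have h2 : ∀ v, L ≤ #{u ∈ U (P v) | ¬ G.Adj v u} + M := by
    intro v
    have := card_filter_not_add G v (U (P v))
    have := hP v
    have := hU (P v)
    omega
  have h3 : ∀ v j, j ≠ P v → #{u ∈ U j | ¬ G.Adj v u} + L ≤ defi G U v + M := by
    intro v j hj
    have h4 : #{u ∈ U j | ¬ G.Adj v u} + #{u ∈ U (P v) | ¬ G.Adj v u} ≤ defi G U v := by
      unfold defi
      rw [← sum_pair hj (f := fun i => #{u ∈ U i | ¬ G.Adj v u})]
      exact sum_le_sum_of_subset (subset_univ _)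
    have := h2 v
    omega
  obtain ⟨X, hX⟩ : ∃ X : Finset V, ∀ v, v ∈ X ↔ 5 * L ≤ 4 * defi G U v :=
    ⟨univ.filter fun v => 5 * L ≤ 4 * defi G U v, by simp⟩
  refine ⟨P, X, ?_, ?_⟩
  · intro u v huv hPuv
    by_contra! hc
    rw [hX, hX] at hc
    obtain ⟨f, hf, -⟩ := h.exists_emb_two hχ u v huv (fun i => U (Equiv.swap (c a) (P u) i)) 0
      (fun i j hij => hq _ _ (fun he => hij ((Equiv.swap (c a) (P u)).injective he)))
      (by rw [mul_zero, zero_add, hM, hU]; omega)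
      (by
        intro i hi
        rw [mul_zero, zero_add, hM]
        have hne : Equiv.swap (c a) (P u) i ≠ P u := by
          intro he
          apply hi
          apply (Equiv.swap (c a) (P u)).injective
          rw [he, Equiv.swap_apply_left]
        obtain ⟨j, hj⟩ : ∃ j, j = Equiv.swap (c a) (P u) i := ⟨_, rfl⟩
        rw [← hj] at hne ⊢
        have h5 := h3 u j hne
        have h6 := h3 v j (hPuv ▸ hne)
        have h7 := card_filter_and (U j) (fun z => G.Adj u z) (fun z => G.Adj v z)
        have h8 := hU j
        omega)
    exact hno f hf
  · have h4 : ∀ v, 4 * L + (if v ∈ X then L else 0) ≤ 4 * defi G U v + 4 * M := by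
      intro v
      split_ifs with hv
      · have := (hX v).1 hv
        omega
      · have h5 : #{u ∈ U (P v) | ¬ G.Adj v u} ≤ defi G U v :=
          single_le_sum (f := fun i => #{u ∈ U i | ¬ G.Adj v u}) (fun _ _ => Nat.zero_le _)
            (mem_univ (P v))
        have := h2 v
        omega
    have h5 := sum_le_sum (s := univ) fun v _ => h4 v
    rw [sum_add_distrib, sum_add_distrib, ← mul_sum, ← mul_sum, sum_const, sum_const, card_univ,
      ← sum_filter, sum_const, smul_eq_mul, smul_eq_mul, smul_eq_mul, filter_mem_eq_inter,
      univ_inter] at h5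
    linarith

lemma IsPacking.eCount_insG_le [Fintype W] [Fintype V] {F : Finset (W → V)}
    (hF : IsPacking H G χ F) (P : V → Fin s) (X : Finset V)
    (hX : ∀ u v, (restG H G F).Adj u v → P u = P v → u ∈ X ∨ v ∈ X) :
    eCount (insG G P) ≤ eCount H * #F + #X * Fintype.card V := by
  have h1 : (insG G P).edgeSet ⊆ usedE H F ∪
      (fun p : V × V => s(p.1, p.2)) '' ((X ×ˢ univ : Finset (V × V)) : Set (V × V)) := by
    intro e
    induction e using Sym2.ind with | _ u v
    intro he
    obtain ⟨h1, h2⟩ : G.Adj u v ∧ P u = P v := he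
    by_cases h3 : s(u, v) ∈ usedE H F
    · exact Or.inl h3
    · right
      rcases hX u v (restG_adj.2 ⟨h1, h3⟩) h2 with h | h
      · exact ⟨(u, v), by simpa using h, rfl⟩
      · exact ⟨(v, u), by simpa using h, Sym2.eq_swap⟩
  unfold eCount
  refine (Set.ncard_le_ncard h1 (Set.toFinite _)).trans ((Set.ncard_union_le _ _).trans ?_)
  refine Nat.add_le_add (le_of_eq hF.ncard_usedE) ?_
  refine (Set.ncard_image_le (Set.toFinite _)).trans ?_
  rw [Set.ncard_coe_finset, card_product, card_univ]
end

section
open Finset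
open scoped Classical
variable {H : SimpleGraph W} {G : SimpleGraph V} {χ : Sym2 V → ℕ}
variable {s : ℕ} {a b : W} {c : W → Fin s}

lemma exists_max_packing [Fintype W] [Fintype V] (hH : 0 < eCount H) :
    ∃ F, IsPacking H G χ F ∧ ∀ f, ¬ RainbowEmb H (restG H G F) χ f := by
  obtain ⟨S, hS⟩ : ∃ S : Finset (Finset (W → V)), ∀ F, F ∈ S ↔ IsPacking H G χ F :=
    ⟨univ.filter fun F => IsPacking H G χ F, by simp⟩
  obtain ⟨F, hF, hmax⟩ := exists_max_image S (fun F => #F) ⟨∅, (hS _).2 isPacking_empty⟩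
  refine ⟨F, (hS F).1 hF, fun f hf => ?_⟩
  obtain ⟨F', h1, h2, -⟩ := ((hS F).1 hF).exists_insert hH hf
  have := hmax F' ((hS F').2 h1)
  omega

lemma card_filter_not_adj [Fintype V] (G : SimpleGraph V) (v : V) :
    #{u | ¬ G.Adj v u} + dg G v = Fintype.card V := by
  have := card_filter_not_add G v univ
  rwa [card_univ] at this

/-- Vertices of large remaining degree span a blow-up of the complete graph on `s` vertices. -/
lemma exists_blowup_restG (hs : 2 ≤ s) (η : ℝ) (hη : 0 < η) (hη2 : η * (8 * s ^ 2) ≤ 1) (L : ℕ) :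
    ∃ n₀ : ℕ, ∀ (V : Type) [Fintype V] (G G' : SimpleGraph V),
      n₀ ≤ Fintype.card V →
      (∀ v, (1 - 1 / (s : ℝ)) * Fintype.card V - (s + 1) ≤ dg G v) → ∀ (g : V → ℕ),
      (∀ v, dg G' v + g v = dg G v) → (∑ v, g v : ℝ) ≤ η ^ 2 * (Fintype.card V : ℝ) ^ 2 →
      ∃ U : Fin s → Finset V, (∀ i, #(U i) = L) ∧
        (∀ i j, i ≠ j → ∀ u ∈ U i, ∀ v ∈ U j, G'.Adj u v) ∧
        ∀ i, ∀ u ∈ U i, (1 - 1 / (s : ℝ) - η) * Fintype.card V - (s + 1) ≤ dg G' u := by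
  obtain ⟨p, rfl⟩ : ∃ p, s = p + 1 := ⟨s - 1, by omega⟩
  have hp : 1 ≤ p := by omega
  have hp' : (1 : ℝ) ≤ p := by exact_mod_cast hp
  obtain ⟨N₀, hN₀⟩ := exists_blowup_of_degree (ε := 1 / (2 * ((p : ℝ) + 1) ^ 2))
    (by positivity) p L
  obtain ⟨n₁, hn₁⟩ := exists_nat_gt (4 * ((p : ℝ) + 1) ^ 2 * (p + 2))
  refine ⟨2 * N₀ + n₁ + 1, fun V _ G G' hn hd g hg hsum => ?_⟩
  obtain ⟨n, hnV⟩ : ∃ n, n = Fintype.card V := ⟨_, rfl⟩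
  rw [← hnV] at hn hd hsum ⊢
  push_cast at hd hη2 ⊢
  have hn0 : 0 < (n : ℝ) := by exact_mod_cast (by omega : 0 < n)
  have hnn : (n₁ : ℝ) ≤ n := by exact_mod_cast (by omega : n₁ ≤ n)
  obtain ⟨A, hA⟩ : ∃ A : Finset V, ∀ z, z ∈ A ↔ (g z : ℝ) < η * n :=
    ⟨univ.filter fun z => (g z : ℝ) < η * n, by simp⟩
  have hη8 : η ≤ 1 / 8 := by nlinarith
  have hAc : (n : ℝ) - #A ≤ η * n := by
    have h1 := card_filter_mul_le univ g (η * n)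
    have h2 : (univ.filter fun y => η * n ≤ (g y : ℝ)) = Aᶜ := by
      ext z; simp [hA, not_lt]
    rw [h2] at h1
    push_cast at h1
    have h3 : (#Aᶜ : ℝ) * (η * n) ≤ (η * n) * (η * n) := by
      refine h1.trans (hsum.trans (le_of_eq (by ring)))
    have h4 := le_of_mul_le_mul_right h3 (by positivity)
    have h5 : #Aᶜ + #A = n := by rw [hnV]; exact card_compl_add_card A
    have h6 : (#Aᶜ : ℝ) + #A = n := by exact_mod_cast h5
    linarith
  have hAn : (#A : ℝ) ≤ n := by
    have : #A ≤ n := hnV ▸ card_le_univ A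
    exact_mod_cast this
  have hdA : ∀ v ∈ A, (1 - 1 / ((p : ℝ) + 1) - η) * n - (p + 1 + 1) ≤ dg G' v := by
    intro v hv
    have h1 := (hA v).1 hv
    have h2 := hd v
    have h3 : (dg G' v : ℝ) + g v = dg G v := by exact_mod_cast hg v
    linarith
  obtain ⟨U, hU1, hU2⟩ := hN₀ G' A (by
      have h1 : (N₀ : ℝ) ≤ #A := by
        have : (2 * N₀ : ℝ) ≤ n := by exact_mod_cast (by omega : 2 * N₀ ≤ n)
        nlinarith
      exact_mod_cast h1) (by
    intro v hv
    have h1 := hdA v hv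
    have h2 := dg_inter G' A v
    rw [← hnV] at h2
    have h3 : (#A : ℝ) + dg G' v ≤ #{w ∈ A | G'.Adj v w} + n := by exact_mod_cast h2
    have h4 : (1 - 1 / ((p : ℝ) + 1) - 2 * η) * n - (p + 2) ≤ #{w ∈ A | G'.Adj v w} := by
      linarith
    refine le_trans ?_ h4
    have h5 : 1 / (p : ℝ) - 1 / (p + 1) = 1 / (p * (p + 1)) := by field_simp; ring
    have h6 : 1 / ((p : ℝ) + 1) ^ 2 ≤ 1 / (p * (p + 1)) := by
      apply one_div_le_one_div_of_le (by positivity)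
      nlinarith
    have h7 : 1 / (2 * ((p : ℝ) + 1) ^ 2) = (1 / ((p : ℝ) + 1) ^ 2) / 2 := by
      field_simp
    have h8 : 2 * η ≤ 1 / ((p : ℝ) + 1) ^ 2 / 4 := by
      rw [div_div, le_div_iff₀ (by positivity)]
      linarith
    have h9 : (p : ℝ) + 2 ≤ 1 / ((p : ℝ) + 1) ^ 2 / 4 * n := by
      rw [div_div, div_mul_eq_mul_div, le_div_iff₀ (by positivity)]
      linarith
    have h10 : 0 ≤ 1 - 1 / (p : ℝ) + 1 / (2 * ((p : ℝ) + 1) ^ 2) := by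
      have : 1 / (p : ℝ) ≤ 1 := by rw [div_le_one (by positivity)]; exact hp'
      have : 0 ≤ 1 / (2 * ((p : ℝ) + 1) ^ 2) := by positivity
      linarith
    calc (1 - 1 / (p : ℝ) + 1 / (2 * ((p : ℝ) + 1) ^ 2)) * #A
        ≤ (1 - 1 / (p : ℝ) + 1 / (2 * ((p : ℝ) + 1) ^ 2)) * n := by gcongr
      _ ≤ (1 - 1 / ((p : ℝ) + 1) - 2 * η) * n - 1 / ((p : ℝ) + 1) ^ 2 / 4 * n := by
          rw [← sub_mul]
          apply mul_le_mul_of_nonneg_right _ hn0.le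
          rw [h7]
          linarith
      _ ≤ _ := by linarith)
  exact ⟨U, fun i => (hU1 i).2, hU2, fun i u hu => hdA u ((hU1 i).1 hu)⟩
end

section
open Finset
open scoped Classical
variable {H : SimpleGraph W} {G : SimpleGraph V} {χ : Sym2 V → ℕ}
variable {s : ℕ} {a b : W} {c : W → Fin s}

lemma sum_defi_le [Fintype V] (U : Fin s → Finset V) (L : ℕ) (hU : ∀ i, #(U i) = L) (d : ℝ)
    (hd : ∀ i, ∀ u ∈ U i, (Fintype.card V : ℝ) - d ≤ dg G u) :
    (∑ v, defi G U v : ℝ) ≤ s * (L * d) := by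
  have h1 : (∑ v, defi G U v : ℝ) = ∑ i, ∑ u ∈ U i, (#{v | ¬ G.Adj u v} : ℝ) := by
    exact_mod_cast sum_defi G U
  rw [h1]
  have h2 : ∀ i, ∑ u ∈ U i, (#{v | ¬ G.Adj u v} : ℝ) ≤ L * d := by
    intro i
    rw [← hU i, ← nsmul_eq_mul]
    refine sum_le_card_nsmul _ _ _ fun u hu => ?_
    have h3 := hd i u hu
    have h4 : (#{v | ¬ G.Adj u v} : ℝ) + dg G u = Fintype.card V := by
      exact_mod_cast card_filter_not_adj G u
    linarith
  refine (sum_le_sum fun i _ => h2 i).trans ?_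
  simp

set_option maxHeartbeats 1000000 in
theorem CritEdge.exists_partition [Fintype W] (h : CritEdge H s a b c) (ε : ℝ) (hε : 0 < ε) :
    ∃ n₀ : ℕ, ∀ (V : Type) [Fintype V] (G : SimpleGraph V) (χ : Sym2 V → ℕ),
      ProperEdgeColoring G χ → n₀ ≤ Fintype.card V →
      (∀ v, tn s (Fintype.card V) ≤ tn s (Fintype.card V - 1) + dg G v) →
      (∀ N, HasPack H G χ N → tn s (Fintype.card V) + (eCount H - 1) * N ≤ eCount G) →
      (eCount G : ℝ) ≤ tn s (Fintype.card V) + ε * (Fintype.card V) ^ 2 ∧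
      ∃ P : V → Fin s, (eCount (insG G P) : ℝ) ≤ ε * (Fintype.card V) ^ 2 := by
  have hs2 : 2 ≤ s := h.two_le
  have hs : 0 < s := by omega
  have hsr : (2 : ℝ) ≤ s := by exact_mod_cast hs2
  have hk : 2 ≤ eCount H := by
    have := h.le_dg
    have := h.dg_lt_eCount
    omega
  obtain ⟨M, hM⟩ : ∃ M, Fintype.card W + Fintype.card W ^ 3 = M := ⟨_, rfl⟩
  have hM1 : 1 ≤ M := by
    have : 0 < Fintype.card W := Fintype.card_pos_iff.2 ⟨a⟩
    omega
  have hMr : (1 : ℝ) ≤ M := by exact_mod_cast hM1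
  obtain ⟨q, hq⟩ := exists_nat_gt (16 / ε)
  obtain ⟨L, hL⟩ : ∃ L, L = M * (q + 7) := ⟨_, rfl⟩
  have hLM : 6 * M < L := by rw [hL]; nlinarith
  have hLr : 16 * M ≤ ε * (L : ℝ) := by
    rw [div_lt_iff₀ hε] at hq
    rw [hL]
    push_cast
    have : (16 : ℝ) ≤ ε * (q + 7) := by nlinarith
    calc 16 * (M : ℝ) ≤ ε * (q + 7) * M := by gcongr
      _ = _ := by ring
  have hLp : (0 : ℝ) < L := by exact_mod_cast (by omega : 0 < L)
  obtain ⟨η, hη, hη8, hηε⟩ : ∃ η : ℝ, 0 < η ∧ η * (8 * s ^ 2) ≤ 1 ∧ η * (16 * s) ≤ ε := by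
    refine ⟨min (1 / (8 * s ^ 2)) (ε / (16 * s)), by positivity, ?_, ?_⟩
    · rw [← le_div_iff₀ (by positivity)]; exact min_le_left _ _
    · rw [← le_div_iff₀ (by positivity)]; exact min_le_right _ _
  have hη1 : η ≤ 1 := by nlinarith
  have hηε' : η ≤ ε / 16 := by nlinarith
  obtain ⟨γ, hγ, hb⟩ := h.exists_packBound
  obtain ⟨n₁, hn₁⟩ := eCount_le_of_packBound hγ hs hb (η ^ 2 / 4) (by positivity)
  obtain ⟨n₂, hn₂⟩ := exists_blowup_restG hs2 η hη hη8 L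
  obtain ⟨n₃, hn₃⟩ := exists_nat_gt (16 * (s : ℝ) * (s + 1) / ε)
  refine ⟨n₁ + n₂ + n₃ + 1, fun V _ G χ hχ hn hdeg hp => ?_⟩
  have he := hn₁ V G χ hχ (by omega) hp
  obtain ⟨F, hF, hno⟩ := exists_max_packing (H := H) (G := G) (χ := χ) (by omega)
  have hpF := hp #F ⟨F, hF, rfl⟩
  have hsum := hF.sum_udg
  have hdr := hF.dg_restG
  obtain ⟨n, hnV⟩ : ∃ n, n = Fintype.card V := ⟨_, rfl⟩
  have hB := hn₂ V G (restG H G F) (by omega) (fun v => le_of_tn_le hs (by omega) (hdeg v))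
    (fun v => ∑ f ∈ F, udg H f v) hdr
  rw [← hnV] at hn hdeg he hpF hB ⊢
  have hn0 : 0 < (n : ℝ) := by exact_mod_cast (by omega : 0 < n)
  have hkF : (eCount H * #F : ℝ) ≤ η ^ 2 / 2 * n ^ 2 := by
    have h1 : eCount H * #F ≤ 2 * ((eCount H - 1) * #F) := by
      rw [← mul_assoc]
      exact Nat.mul_le_mul_right _ (by omega)
    have h2 : (eCount H * #F : ℝ) ≤ 2 * ((eCount H - 1 : ℕ) * #F : ℝ) := by exact_mod_cast h1
    have h3 : (tn s n : ℝ) + (eCount H - 1 : ℕ) * #F ≤ eCount G := by exact_mod_cast hpF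
    linarith
  obtain ⟨U, hU, hUadj, hUd⟩ := hB (by
    have h1 : (∑ v, ((∑ f ∈ F, udg H f v : ℕ) : ℝ)) = 2 * (eCount H * #F) := by
      exact_mod_cast hsum
    rw [h1]
    linarith)
  refine ⟨he.trans ?_, ?_⟩
  · have : η ^ 2 / 4 ≤ ε := by nlinarith
    gcongr
  have hχ' : ProperEdgeColoring (restG H G F) χ := hχ.mono (restG_le F)
  obtain ⟨P, X, hX, hcard⟩ := h.exists_assignment hχ' hno U L M hM hLM hU hUadj
  refine ⟨P, ?_⟩
  have h1 := hF.eCount_insG_le P X hX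
  have h2 := sum_defi_le (G := restG H G F) U L hU ((1 / (s : ℝ) + η) * n + (s + 1))
    (by
      intro i u hu
      have := hUd i u hu
      rw [← hnV]
      linarith)
  rw [← hnV] at hcard h1
  have h3 : 4 * (n : ℝ) * L + #X * L ≤ 4 * (∑ v, defi (restG H G F) U v : ℝ) + 4 * n * M := by
    exact_mod_cast hcard
  have h4 : (s : ℝ) * (L * ((1 / (s : ℝ) + η) * n + (s + 1))) =
      L * n + L * (s * η * n) + L * (s * (s + 1)) := by
    field_simp
  have h5 : (#X : ℝ) * L ≤ (4 * (s * η * n) + 4 * (s * (s + 1)) + ε * n / 4) * L := by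
    have : 16 * (M : ℝ) * n ≤ ε * L * n := by gcongr
    linarith
  have h6 := le_of_mul_le_mul_right h5 hLp
  have h7 : (s : ℝ) * (s + 1) ≤ ε * n / 16 := by
    have : (n₃ : ℝ) ≤ n := by exact_mod_cast (by omega : n₃ ≤ n)
    rw [div_lt_iff₀ hε] at hn₃
    have : (n₃ : ℝ) * ε ≤ n * ε := by gcongr
    linarith
  have h8 : (s : ℝ) * η * n ≤ ε * n / 16 := by
    have : η * (16 * s) * n ≤ ε * n := by gcongr
    linarith
  have h9 : (#X : ℝ) ≤ 3 / 4 * ε * n := by linarith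
  have h10 : (eCount (insG G P) : ℝ) ≤ eCount H * #F + #X * n := by exact_mod_cast h1
  have h11 : (#X : ℝ) * n ≤ 3 / 4 * ε * n * n := by gcongr
  have h12 : η ^ 2 / 2 * n ^ 2 ≤ ε / 16 * n ^ 2 := by
    have : η ^ 2 / 2 ≤ ε / 16 := by nlinarith
    gcongr
  have h13 : 0 ≤ ε * (n : ℝ) ^ 2 := by positivity
  linarith
end

section
open Finset
open scoped Classical
variable {H : SimpleGraph W} {G : SimpleGraph V} {χ : Sym2 V → ℕ}
variable {s : ℕ} {a b : W} {c : W → Fin s}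

lemma eCount_iso {V' : Type*} [Fintype V] [Fintype V'] {G' : SimpleGraph V'} (f : G ≃g G') :
    eCount G = eCount G' := by
  rw [eCount_eq_card, eCount_eq_card]
  exact f.card_edgeFinset_eq

lemma eCount_le_tn [Fintype V] (hs : 0 < s) (hG : G.Colorable s) :
    eCount G ≤ tn s (Fintype.card V) := by
  obtain ⟨J, _, hJ⟩ := SimpleGraph.exists_isTuranMaximal (V := V) hs
  obtain ⟨f⟩ := hJ.nonempty_iso_turanGraph
  unfold tn
  rw [← eCount_iso f, eCount_eq_card, eCount_eq_card]
  convert hJ.2 (hG.cliqueFree (Nat.lt_succ_self s))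

lemma nonempty_iso_of_tn_le [Fintype V] (hs : 0 < s) (hG : G.Colorable s)
    (h : tn s (Fintype.card V) ≤ eCount G) :
    Nonempty (G ≃g SimpleGraph.turanGraph (Fintype.card V) s) := by
  obtain ⟨J, _, hJ⟩ := SimpleGraph.exists_isTuranMaximal (V := V) hs
  obtain ⟨f⟩ := hJ.nonempty_iso_turanGraph
  unfold tn at h
  rw [← eCount_iso f, eCount_eq_card, eCount_eq_card] at h
  have : G.IsTuranMaximal s := by
    refine ⟨hG.cliqueFree (Nat.lt_succ_self s), fun K _ hK => ?_⟩
    have h1 := hJ.2 hK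
    refine h1.trans (le_trans (le_of_eq ?_) (h.trans (le_of_eq ?_))) <;> congr!
  exact this.nonempty_iso_turanGraph

/-- The complete multipartite graph with classes given by `P`. -/
def crossG (P : V → Fin s) : SimpleGraph V where
  Adj u v := P u ≠ P v
  symm := ⟨fun _ _ h => h.symm⟩
  loopless := ⟨fun _ h => h rfl⟩

lemma eCount_crossG_le [Fintype V] (hs : 0 < s) (P : V → Fin s) :
    eCount (crossG P) ≤ tn s (Fintype.card V) :=
  eCount_le_tn hs ⟨SimpleGraph.Coloring.mk P fun h => h⟩

lemma eCount_le_insG_add [Fintype V] (P : V → Fin s) :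
    eCount G ≤ eCount (insG G P) + eCount (crossG P) := by
  unfold eCount
  refine (Set.ncard_le_ncard ?_ (Set.toFinite _)).trans (Set.ncard_union_le _ _)
  intro e
  induction e using Sym2.ind with | _ u v
  intro he
  by_cases h : P u = P v
  · exact Or.inl ⟨he, h⟩
  · exact Or.inr h

lemma colorable_of_eCount_insG [Fintype V] (P : V → Fin s) (h : eCount (insG G P) = 0) :
    G.Colorable s := by
  refine ⟨SimpleGraph.Coloring.mk P fun {u v} huv he => ?_⟩
  have h1 : s(u, v) ∈ (insG G P).edgeSet := ⟨huv, he⟩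
  rw [eCount, Set.ncard_eq_zero (Set.toFinite _)] at h
  rw [h] at h1
  exact h1

/-- A partition minimizing the number of inner edges satisfies a local minimality property. -/
lemma exists_local_min [Fintype V] (P₀ : V → Fin s) :
    ∃ P : V → Fin s, eCount (insG G P) ≤ eCount (insG G P₀) ∧
      ∀ x i, dg (insG G P) x ≤ #{y | P y = i ∧ G.Adj x y} := by
  obtain ⟨P, -, hP⟩ := exists_min_image (univ : Finset (V → Fin s))
    (fun P => eCount (insG G P)) ⟨P₀, mem_univ _⟩
  refine ⟨P, hP P₀ (mem_univ _), fun x i => ?_⟩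
  obtain ⟨Q, hQ⟩ : ∃ Q, Q = Function.update P x i := ⟨_, rfl⟩
  have hQx : Q x = i := by rw [hQ, Function.update_self]
  have hQy : ∀ y, y ≠ x → Q y = P y := fun y hy => by rw [hQ, Function.update_of_ne hy]
  have h1 := hP Q (mem_univ _)
  have h2 : delV (insG G P) x = delV (insG G Q) x := by
    ext ⟨u, hu⟩ ⟨v, hv⟩
    change G.Adj u v ∧ P u = P v ↔ G.Adj u v ∧ Q u = Q v
    rw [hQy u hu, hQy v hv]
  have h3 := eCount_delV (insG G P) x
  have h4 := eCount_delV (insG G Q) x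
  rw [h2] at h3
  have h5 : dg (insG G Q) x ≤ #{y | P y = i ∧ G.Adj x y} := by
    refine card_le_card fun y hy => ?_
    rw [mem_filter] at hy ⊢
    obtain ⟨h6, h7⟩ : G.Adj x y ∧ Q x = Q y := hy.2
    rw [hQx, hQy y (SimpleGraph.Adj.ne h6).symm] at h7
    exact ⟨mem_univ _, h7.symm, h6⟩
  omega

lemma dg_crossG [Fintype V] (P : V → Fin s) (v : V) :
    dg (crossG P) v + #{y | P y = P v} = Fintype.card V := by
  have h := card_filter_not_adj (crossG P) v
  rw [add_comm]
  convert h using 3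
  ext y
  rw [mem_filter, mem_filter]
  change _ ∧ P y = P v ↔ _ ∧ ¬ (P v ≠ P y)
  rw [not_not, eq_comm (a := P y)]

lemma sum_classes [Fintype V] (P : V → Fin s) : ∑ i, #{y | P y = i} = Fintype.card V := by
  rw [← card_univ, card_eq_sum_card_fiberwise (f := P) (t := univ) (fun _ _ => mem_univ _)]

lemma sum_classes_sq [Fintype V] (P : V → Fin s) :
    2 * eCount (crossG P) + ∑ i, #{y | P y = i} ^ 2 = Fintype.card V ^ 2 := by
  have h1 : ∑ i, #{y | P y = i} ^ 2 = ∑ v, #{y | P y = P v} := by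
    rw [← sum_fiberwise univ P]
    refine sum_congr rfl fun i _ => ?_
    rw [sum_congr rfl (g := fun _ => #{y | P y = i})
      (fun v hv => by rw [(mem_filter.1 hv).2]), sum_const, smul_eq_mul, sq]
  rw [h1, ← sum_dg, ← sum_add_distrib, sum_congr rfl fun v _ => dg_crossG P v, sum_const,
    card_univ, smul_eq_mul, sq]

lemma class_card_ge [Fintype V] (hs : 0 < s) (P : V → Fin s) (ε : ℝ) (hε : 0 ≤ ε)
    (h : (1 - 1 / (s : ℝ)) * (Fintype.card V : ℝ) ^ 2 / 2 - ε ^ 2 / 2 * (Fintype.card V : ℝ) ^ 2 ≤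
      eCount (crossG P)) (i : Fin s) :
    (Fintype.card V : ℝ) / s - ε * Fintype.card V ≤ #{y | P y = i} := by
  have h1 : (∑ i, (#{y | P y = i} : ℝ)) = Fintype.card V := by exact_mod_cast sum_classes P
  have h2 : 2 * (eCount (crossG P) : ℝ) + ∑ i, (#{y | P y = i} : ℝ) ^ 2 =
      (Fintype.card V : ℝ) ^ 2 := by exact_mod_cast sum_classes_sq P
  obtain ⟨n, hn⟩ : ∃ n, n = Fintype.card V := ⟨_, rfl⟩
  rw [← hn] at h h1 h2 ⊢
  have hs' : (0 : ℝ) < s := by exact_mod_cast hs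
  have h3 : ∑ i, ((#{y | P y = i} : ℝ) - n / s) ^ 2 =
      ∑ i, (#{y | P y = i} : ℝ) ^ 2 - n ^ 2 / s := by
    simp only [sub_sq]
    rw [sum_add_distrib, sum_sub_distrib, ← sum_mul, ← mul_sum, h1, sum_const, card_univ,
      Fintype.card_fin, nsmul_eq_mul]
    field_simp
    ring
  have h4 : ((#{y | P y = i} : ℝ) - n / s) ^ 2 ≤
      ∑ i, ((#{y | P y = i} : ℝ) - n / s) ^ 2 :=
    single_le_sum (f := fun i => ((#{y | P y = i} : ℝ) - n / s) ^ 2)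
      (fun _ _ => sq_nonneg _) (mem_univ i)
  have h5 : ((#{y | P y = i} : ℝ) - n / s) ^ 2 ≤ (ε * n) ^ 2 := by
    rw [h3] at h4
    refine h4.trans ?_
    have : (1 - 1 / (s : ℝ)) * (n : ℝ) ^ 2 = n ^ 2 - n ^ 2 / s := by ring
    nlinarith
  have := abs_le_of_sq_le_sq' h5 (by positivity)
  linarith [this.1]

lemma missing_le [Fintype V] (P : V → Fin s) (x : V) (i : Fin s) (hi : i ≠ P x) :
    #{y | P y = i ∧ ¬ G.Adj x y} + dg G x + #{y | P y = P x} ≤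
      Fintype.card V + dg (insG G P) x := by
  have h1 : dg G x = dg (insG G P) x + #{y | P y ≠ P x ∧ G.Adj x y} := by
    unfold dg
    rw [← card_filter_add_card_filter_not (s := univ.filter fun w => G.Adj x w)
      (fun w => P x = P w), filter_filter, filter_filter]
    congr 1
    · refine congrArg _ (filter_congr fun y _ => ?_)
      exact Iff.rfl
    · refine congrArg _ (filter_congr fun y _ => ?_)
      rw [and_comm, eq_comm (a := P x)]
  have h2 : #{y | P y = i ∧ ¬ G.Adj x y} + #{y | P y ≠ P x ∧ G.Adj x y} +
      #{y | P y = P x} ≤ Fintype.card V := by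
    rw [← card_univ, ← card_union_of_disjoint, ← card_union_of_disjoint]
    · exact card_le_univ _
    · rw [disjoint_left]
      intro y hy hy'
      have h3 := (mem_filter.1 hy').2
      rcases mem_union.1 hy with h | h
      · exact hi ((mem_filter.1 h).2.1.symm.trans h3)
      · exact (mem_filter.1 h).2.1 h3
    · rw [disjoint_left]
      intro y hy hy'
      exact (mem_filter.1 hy).2.2 (mem_filter.1 hy').2.2
  omega

/-- A partition of the vertices that is close to the one of a Turán graph. -/
structure GoodPart [Fintype V] (G : SimpleGraph V) (P : V → Fin s) (ε : ℝ) : Prop where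
  ins_le : (eCount (insG G P) : ℝ) ≤ ε * (Fintype.card V) ^ 2
  eCount_le : eCount G ≤ tn s (Fintype.card V) + eCount (insG G P)
  class_ge : ∀ i, (Fintype.card V : ℝ) / s - ε * Fintype.card V ≤ #{y | P y = i}
  dg_le : ∀ x i, dg (insG G P) x ≤ #{y | P y = i ∧ G.Adj x y}
  missing : ∀ x i, i ≠ P x → (#{y | P y = i ∧ ¬ G.Adj x y} : ℝ) ≤
    ε * Fintype.card V + dg (insG G P) x

theorem CritEdge.exists_goodPart [Fintype W] (h : CritEdge H s a b c) (ε : ℝ) (hε : 0 < ε) :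
    ∃ n₀ : ℕ, ∀ (V : Type) [Fintype V] (G : SimpleGraph V) (χ : Sym2 V → ℕ),
      ProperEdgeColoring G χ → n₀ ≤ Fintype.card V →
      (∀ v, tn s (Fintype.card V) ≤ tn s (Fintype.card V - 1) + dg G v) →
      (∀ N, HasPack H G χ N → tn s (Fintype.card V) + (eCount H - 1) * N ≤ eCount G) →
      ∃ P : V → Fin s, GoodPart G P ε := by
  have hs2 : 2 ≤ s := h.two_le
  have hs : 0 < s := by omega
  have hsr : (2 : ℝ) ≤ s := by exact_mod_cast hs2
  obtain ⟨n₁, hn₁⟩ := h.exists_partition (min ε (ε ^ 2 / 16)) (by positivity)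
  obtain ⟨n₂, hn₂⟩ := exists_nat_gt (16 * (s : ℝ) / ε ^ 2)
  obtain ⟨n₃, hn₃⟩ := exists_nat_gt (2 * ((s : ℝ) + 1) / ε)
  refine ⟨n₁ + n₂ + n₃ + 1, fun V _ G χ hχ hn hdeg hp => ?_⟩
  obtain ⟨-, P₀, hP₀⟩ := hn₁ V G χ hχ (by omega) hdeg hp
  obtain ⟨P, hP, hloc⟩ := exists_local_min (G := G) P₀
  have h1 := eCount_le_insG_add (G := G) P
  have h2 := eCount_crossG_le hs P
  have h3 := hp 0 hasPack_zero
  have hdr : ∀ v, (1 - 1 / (s : ℝ)) * Fintype.card V - (s + 1) ≤ dg G v := fun v =>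
    le_of_tn_le hs (by omega) (hdeg v)
  have hmiss := missing_le (G := G) P
  have hcl := class_card_ge hs P (ε / 2) (by positivity)
  refine ⟨P, ?_, by omega, ?_, hloc, ?_⟩
  all_goals
    obtain ⟨n, hnV⟩ : ∃ n, n = Fintype.card V := ⟨_, rfl⟩
    rw [← hnV] at hn hP₀ h3 hdr hmiss hcl ⊢
    have hn0 : (1 : ℝ) ≤ n := by exact_mod_cast (by omega : 1 ≤ n)
    have hP' : (eCount (insG G P) : ℝ) ≤ eCount (insG G P₀) := by exact_mod_cast hP
  · refine hP'.trans (hP₀.trans ?_)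
    gcongr
    exact min_le_left _ _
  all_goals
    replace hcl := hcl (by
      have h4 := le_tn s n hs
      have h5 : (tn s n : ℝ) ≤ eCount (insG G P) + eCount (crossG P) := by
        exact_mod_cast (by omega : tn s n ≤ eCount (insG G P) + eCount (crossG P))
      have h6 : min ε (ε ^ 2 / 16) * (n : ℝ) ^ 2 ≤ ε ^ 2 / 16 * (n : ℝ) ^ 2 := by
        gcongr
        exact min_le_right _ _
      have h7 : (s : ℝ) ≤ ε ^ 2 / 16 * (n : ℝ) ^ 2 := by
        have : (n₂ : ℝ) ≤ n := by exact_mod_cast (by omega : n₂ ≤ n)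
        rw [div_lt_iff₀ (by positivity)] at hn₂
        have h8 : (n₂ : ℝ) * ε ^ 2 ≤ n * ε ^ 2 := by gcongr
        have h9 : (n : ℝ) * ε ^ 2 ≤ n ^ 2 * ε ^ 2 := by
          gcongr
          nlinarith
        linarith
      linarith)
  · intro i
    have := hcl i
    have : 0 ≤ ε * n := by positivity
    linarith
  · intro x i hi
    have h4 : (#{y | P y = i ∧ ¬ G.Adj x y} : ℝ) + dg G x + #{y | P y = P x} ≤
        n + dg (insG G P) x := by exact_mod_cast hmiss x i hi
    have h5 := hcl (P x)
    have h6 := hdr x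
    have h7 : (s : ℝ) + 1 ≤ ε / 2 * n := by
      have : (n₃ : ℝ) ≤ n := by exact_mod_cast (by omega : n₃ ≤ n)
      rw [div_lt_iff₀ (by positivity)] at hn₃
      have h8 : (n₃ : ℝ) * ε ≤ n * ε := by gcongr
      linarith
    have h8 : (1 - 1 / (s : ℝ)) * (n : ℝ) = n - n / s := by ring
    linarith
end

section
open Finset
open scoped Classical
variable {H : SimpleGraph W} {G : SimpleGraph V} {χ : Sym2 V → ℕ}
variable {s : ℕ} {a b : W} {c : W → Fin s} {P : V → Fin s}

/-- A map that follows the colour classes of `c` and respects the sets `T` (typical vertices) and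
`Z` (vertices of large inner degree). -/
structure GoodCopy (P : V → Fin s) (c : W → Fin s) (a b : W) (T Z : Finset V) (f : W → V) :
    Prop where
  col : ∀ u v, P (f u) = P (f v) ↔ c u = c v
  mem_T : ∀ w, w ≠ a → w ≠ b → f w ∈ T
  pos : (f a ∉ Z ∧ f b ∉ Z) ∨ (f a ∈ Z ∧ f b ∈ T)

lemma fills_pair {v : V} {f : W → V} :
    Fills ({a, b} : Finset W) v f ↔ ∃ w, w ≠ a ∧ w ≠ b ∧ f w = v := by
  unfold Fills
  simp only [mem_insert, mem_singleton, not_or, and_assoc]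

lemma exists_max_good [Fintype W] [Fintype V] (hH : 0 < eCount H) (T Z : Finset V) (K : ℕ) :
    ∃ F, IsPacking H G χ F ∧ (∀ f ∈ F, GoodCopy P c a b T Z f) ∧
      (∀ v, fillCount {a, b} F v ≤ K) ∧
      ∀ f, RainbowEmb H (restG H G F) χ f → GoodCopy P c a b T Z f →
        (∀ w, w ≠ a → w ≠ b → fillCount {a, b} F (f w) < K) → False := by
  obtain ⟨S, hS⟩ : ∃ S : Finset (Finset (W → V)), ∀ F, F ∈ S ↔ IsPacking H G χ F ∧
      (∀ f ∈ F, GoodCopy P c a b T Z f) ∧ ∀ v, fillCount {a, b} F v ≤ K :=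
    ⟨univ.filter fun F => IsPacking H G χ F ∧
      (∀ f ∈ F, GoodCopy P c a b T Z f) ∧ ∀ v, fillCount {a, b} F v ≤ K, by simp⟩
  obtain ⟨F, hF, hmax⟩ := exists_max_image S (fun F => #F)
    ⟨∅, (hS _).2 ⟨isPacking_empty, by simp, by simp [fillCount]⟩⟩
  obtain ⟨h1, h2, h3⟩ := (hS F).1 hF
  refine ⟨F, h1, h2, h3, fun f hf hg hw => ?_⟩
  obtain ⟨F', h4, h5, h6, -⟩ := h1.exists_insert hH hf
  have h7 : F' ∈ S := by
    refine (hS F').2 ⟨h4, fun g hgF => ?_, fun v => ?_⟩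
    · rcases (h6 g).1 hgF with rfl | h
      · exact hg
      · exact h2 g h
    · obtain ⟨h8, h9⟩ := fillCount_insert_le (S₀ := {a, b}) h6 v
      by_cases hv : ∃ w, w ≠ a ∧ w ≠ b ∧ f w = v
      · obtain ⟨w, hwa, hwb, rfl⟩ := hv
        have := hw w hwa hwb
        omega
      · refine (h9 fun w hw he => hv ⟨w, ?_, ?_, he⟩).trans (h3 v)
        · rintro rfl; simp at hw
        · rintro rfl; simp at hw
  have := hmax F' h7
  omega

lemma CritEdge.inner_eq (h : CritEdge H s a b c) {f : W → V}
    (hcol : ∀ u v, P (f u) = P (f v) ↔ c u = c v) {x y : V} (hP : P x = P y)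
    (he : s(x, y) ∈ imgE H f) : s(x, y) = s(f a, f b) := by
  obtain ⟨u, v, huv, rfl, rfl⟩ := mk_mem_imgE.1 he
  have h1 := (hcol u v).1 hP
  by_contra hne
  refine h.col u v huv (fun he => hne ?_) h1
  have := congrArg (Sym2.map f) he
  simpa using this

lemma CritEdge.mem_imgE (h : CritEdge H s a b c) (f : W → V) : s(f a, f b) ∈ imgE H f :=
  mk_mem_imgE.2 ⟨a, b, h.adj, rfl, rfl⟩

lemma CritEdge.insG_adj (h : CritEdge H s a b c) {f : W → V} (hf : RainbowEmb H G χ f)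
    (hcol : ∀ u v, P (f u) = P (f v) ↔ c u = c v) : (insG G P).Adj (f a) (f b) :=
  ⟨hf.imgE_subset (h.mem_imgE f), (hcol a b).2 h.color_eq⟩

lemma CritEdge.eq_of_mk_eq (h : CritEdge H s a b c) {F : Finset (W → V)}
    (hF : IsPacking H G χ F) {f g : W → V} (hf : f ∈ F) (hg : g ∈ F)
    (he : s(f a, f b) = s(g a, g b)) : f = g := by
  by_contra hne
  exact Set.disjoint_left.1 (hF.2 f hf g hg hne) (h.mem_imgE f) (he ▸ h.mem_imgE g)

lemma CritEdge.card_le_dg [Fintype V] (h : CritEdge H s a b c) {F : Finset (W → V)}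
    (hF : IsPacking H G χ F) (hcol : ∀ f ∈ F, ∀ u v, P (f u) = P (f v) ↔ c u = c v) (y : V) :
    #{f ∈ F | f a = y ∨ f b = y} ≤ dg (insG G P) y := by
  unfold dg
  refine card_le_card_of_injOn (fun f => if f a = y then f b else f a) ?_ ?_
  · intro f hf
    obtain ⟨hfF, hf⟩ := mem_filter.1 hf
    have h1 := h.insG_adj (hF.1 f hfF) (hcol f hfF)
    refine mem_filter.2 ⟨mem_univ _, ?_⟩
    dsimp only
    split_ifs with h2
    · rw [← h2]; exact h1
    · rw [← hf.resolve_left h2]; exact SimpleGraph.Adj.symm h1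
  · intro f hf g hg hfg
    obtain ⟨hfF, hf⟩ := mem_filter.1 hf
    obtain ⟨hgF, hg⟩ := mem_filter.1 hg
    refine h.eq_of_mk_eq hF hfF hgF ?_
    have h1 : ∀ f : W → V, f a = y ∨ f b = y →
        s(f a, f b) = s(y, if f a = y then f b else f a) := by
      intro f hf
      split_ifs with h2
      · rw [h2]
      · rw [hf.resolve_left h2]; exact Sym2.eq_swap
    rw [h1 f hf, h1 g hg]
    exact congrArg _ hfg

lemma CritEdge.used_le [Fintype W] [Fintype V] (h : CritEdge H s a b c) {F : Finset (W → V)}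
    (hF : IsPacking H G χ F) (hcol : ∀ f ∈ F, ∀ u v, P (f u) = P (f v) ↔ c u = c v) (y : V) :
    ∑ f ∈ F, udg H f y ≤ Fintype.card W * (fillCount {a, b} F y + dg (insG G P) y) := by
  have h1 := h.card_le_dg hF hcol y
  obtain ⟨F₁, hF₁⟩ : ∃ F₁ : Finset (W → V), ∀ f, f ∈ F₁ ↔ f ∈ F ∧ ∃ w, f w = y :=
    ⟨F.filter fun f => ∃ w, f w = y, by simp⟩
  have h2 : ∑ f ∈ F, udg H f y = ∑ f ∈ F₁, udg H f y := by
    symm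
    refine sum_subset (fun f hf => ((hF₁ f).1 hf).1) fun f hf hf1 => udg_of_notMem fun u hu => ?_
    exact hf1 ((hF₁ f).2 ⟨hf, u, hu⟩)
  have h3 : #F₁ ≤ fillCount {a, b} F y + #{f ∈ F | f a = y ∨ f b = y} := by
    unfold fillCount
    refine (card_le_card fun f hf => ?_).trans (card_union_le _ _)
    obtain ⟨hfF, w, hw⟩ := (hF₁ f).1 hf
    rw [mem_union, mem_filter, mem_filter, fills_pair]
    by_cases hwa : w = a
    · exact Or.inr ⟨hfF, Or.inl (hwa ▸ hw)⟩
    by_cases hwb : w = b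
    · exact Or.inr ⟨hfF, Or.inr (hwb ▸ hw)⟩
    exact Or.inl ⟨hfF, w, hwa, hwb, hw⟩
  rw [h2]
  refine (sum_le_card_nsmul _ _ _ fun f hf =>
    udg_le (hF.1 f ((hF₁ f).1 hf).1).1 y).trans ?_
  rw [smul_eq_mul, mul_comm]
  exact Nat.mul_le_mul_left _ (h3.trans (Nat.add_le_add_left h1 _))

lemma CritEdge.card_le_eCount [Fintype W] [Fintype V] (h : CritEdge H s a b c)
    {F : Finset (W → V)} (hF : IsPacking H G χ F)
    (hcol : ∀ f ∈ F, ∀ u v, P (f u) = P (f v) ↔ c u = c v) : #F ≤ eCount (insG G P) := by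
  rw [← Set.ncard_coe_finset]
  exact Set.ncard_le_ncard_of_injOn (fun f => s(f a, f b))
    (fun f hf => h.insG_adj (hF.1 f hf) (hcol f hf))
    (fun f hf g hg he => h.eq_of_mk_eq hF hf hg he) (Set.toFinite _)

lemma missing_restG_le [Fintype V] {F : Finset (W → V)} (hF : IsPacking H G χ F) (y : V)
    (i : Fin s) : #{z | P z = i ∧ ¬ (restG H G F).Adj y z} ≤
      #{z | P z = i ∧ ¬ G.Adj y z} + ∑ f ∈ F, udg H f y := by
  rw [← card_usedE_nbrs hF y]
  refine (card_le_card fun z hz => ?_).trans (card_union_le _ _)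
  have h1 := (mem_filter.1 hz).2
  rw [restG_adj] at h1
  rw [mem_union, mem_filter, mem_filter]
  by_cases h2 : s(y, z) ∈ usedE H F
  · exact Or.inr ⟨mem_univ _, h2⟩
  · exact Or.inl ⟨mem_univ _, h1.1, fun h3 => h1.2 ⟨h3, h2⟩⟩

lemma card_sub_compl_le [Fintype V] (A S : Finset V) : #A ≤ #{z ∈ A | z ∈ S} + #Sᶜ := by
  rw [← card_filter_add_card_filter_not (s := A) (fun z => z ∈ S)]
  refine Nat.add_le_add_left (card_le_card fun z hz => ?_) _
  exact mem_compl.2 (mem_filter.1 hz).2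

lemma CritEdge.exists_copy_one [Fintype W] [Fintype V] (h : CritEdge H s a b c)
    (hχ : ProperEdgeColoring G χ) (S : Finset V) (q : ℕ)
    (hq : ∀ y ∈ S, ∀ i, i ≠ P y → #{z | P z = i ∧ ¬ G.Adj y z} ≤ q) (u : V)
    (hu : ∀ i, Fintype.card W * q + Fintype.card W + Fintype.card W ^ 3 + #Sᶜ <
      #{z | P z = i ∧ G.Adj u z}) :
    ∃ f, RainbowEmb H G χ f ∧ f a = u ∧ (∀ w, w ≠ a → f w ∈ S) ∧
      ∀ x y, P (f x) = P (f y) ↔ c x = c y := by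
  obtain ⟨σ, hσ⟩ : ∃ σ, σ = Equiv.swap (c a) (P u) := ⟨_, rfl⟩
  have hσa : σ (c a) = P u := by rw [hσ, Equiv.swap_apply_left]
  obtain ⟨X, hX⟩ : ∃ X : Fin s → Finset V, ∀ i z, z ∈ X i ↔ z ∈ S ∧ P z = σ i :=
    ⟨fun i => univ.filter fun z => z ∈ S ∧ P z = σ i, by simp⟩
  obtain ⟨f, hf, hfa, hfw⟩ := h.exists_emb_one hχ u X q
    (by
      intro i j hij y hy
      obtain ⟨h1, h2⟩ := (hX i y).1 hy
      refine le_trans (card_le_card fun z hz => ?_) (hq y h1 (σ j) ?_)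
      · obtain ⟨h3, h4⟩ := mem_filter.1 hz
        exact mem_filter.2 ⟨mem_univ _, ((hX j z).1 h3).2, h4⟩
      · rw [h2]; exact fun he => hij (σ.injective he).symm)
    (by
      intro i
      have h1 := hu (σ i)
      have h2 := card_sub_compl_le ({z | P z = σ i ∧ G.Adj u z} : Finset V) S
      have h3 : #{z ∈ ({z | P z = σ i ∧ G.Adj u z} : Finset V) | z ∈ S} ≤
          #{z ∈ X i | G.Adj u z} := by
        refine card_le_card fun z hz => ?_
        obtain ⟨h4, h5⟩ := mem_filter.1 hz
        obtain ⟨-, h6, h7⟩ := mem_filter.1 h4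
        exact mem_filter.2 ⟨(hX i z).2 ⟨h5, h6⟩, h7⟩
      omega)
  have hP : ∀ w, P (f w) = σ (c w) := by
    intro w
    by_cases hw : w = a
    · rw [hw, hfa, hσa]
    · exact ((hX _ _).1 (hfw w hw)).2
  refine ⟨f, hf, hfa, fun w hw => ((hX _ _).1 (hfw w hw)).1, fun x y => ?_⟩
  rw [hP, hP, σ.injective.eq_iff]

lemma CritEdge.exists_copy_two [Fintype W] [Fintype V] (h : CritEdge H s a b c)
    (hχ : ProperEdgeColoring G χ) (S : Finset V) (q : ℕ)
    (hq : ∀ y ∈ S, ∀ i, i ≠ P y → #{z | P z = i ∧ ¬ G.Adj y z} ≤ q) (u v : V)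
    (huv : G.Adj u v) (hPuv : P u = P v)
    (hu : ∀ i, Fintype.card W * q + Fintype.card W + Fintype.card W ^ 3 + #Sᶜ < #{z | P z = i})
    (hu' : ∀ i, i ≠ P u → Fintype.card W * q + Fintype.card W + Fintype.card W ^ 3 + #Sᶜ +
      #{z | P z = i ∧ ¬ G.Adj u z} + #{z | P z = i ∧ ¬ G.Adj v z} < #{z | P z = i}) :
    ∃ f, RainbowEmb H G χ f ∧ f a = u ∧ f b = v ∧ (∀ w, w ≠ a → w ≠ b → f w ∈ S) ∧
      ∀ x y, P (f x) = P (f y) ↔ c x = c y := by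
  obtain ⟨σ, hσ⟩ : ∃ σ, σ = Equiv.swap (c a) (P u) := ⟨_, rfl⟩
  have hσa : σ (c a) = P u := by rw [hσ, Equiv.swap_apply_left]
  obtain ⟨X, hX⟩ : ∃ X : Fin s → Finset V, ∀ i z, z ∈ X i ↔ z ∈ S ∧ P z = σ i :=
    ⟨fun i => univ.filter fun z => z ∈ S ∧ P z = σ i, by simp⟩
  have hXc : ∀ i, #{z | P z = σ i} ≤ #(X i) + #Sᶜ := by
    intro i
    refine (card_sub_compl_le ({z | P z = σ i} : Finset V) S).trans (Nat.add_le_add_right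
      (card_le_card fun z hz => ?_) _)
    obtain ⟨h4, h5⟩ := mem_filter.1 hz
    exact (hX i z).2 ⟨h5, (mem_filter.1 h4).2⟩
  have hXn : ∀ i w, #{z ∈ X i | ¬ G.Adj w z} ≤ #{z | P z = σ i ∧ ¬ G.Adj w z} := by
    intro i w
    refine card_le_card fun z hz => ?_
    obtain ⟨h3, h4⟩ := mem_filter.1 hz
    exact mem_filter.2 ⟨mem_univ _, ((hX i z).1 h3).2, h4⟩
  obtain ⟨f, hf, hfa, hfb, hfw⟩ := h.exists_emb_two hχ u v huv X q
    (by
      intro i j hij y hy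
      obtain ⟨h1, h2⟩ := (hX i y).1 hy
      refine le_trans (hXn j y) (hq y h1 (σ j) ?_)
      rw [h2]; exact fun he => hij (σ.injective he).symm)
    (by
      have h1 := hu (σ (c a))
      have h2 := hXc (c a)
      omega)
    (by
      intro i hi
      have h1 := hu' (σ i) (by rw [← hσa]; exact fun he => hi (σ.injective he))
      have h2 := hXc i
      have h3 := card_filter_and (X i) (fun z => G.Adj u z) (fun z => G.Adj v z)
      have h4 := hXn i u
      have h5 := hXn i v
      omega)
  have hP : ∀ w, P (f w) = σ (c w) := by
    intro w
    by_cases hw : w = a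
    · rw [hw, hfa, hσa]
    by_cases hwb : w = b
    · rw [hwb, hfb, ← h.color_eq, hσa, hPuv]
    · exact ((hX _ _).1 (hfw w hw hwb)).2
  refine ⟨f, hf, hfa, hfb, fun w hw hwb => ((hX _ _).1 (hfw w hw hwb)).1, fun x y => ?_⟩
  rw [hP, hP, σ.injective.eq_iff]
end

section
open Finset
open scoped Classical
variable {H : SimpleGraph W} {G : SimpleGraph V} {χ : Sym2 V → ℕ}
variable {s : ℕ} {a b : W} {c : W → Fin s} {P : V → Fin s}

lemma CritEdge.card_class_lt [Fintype W] (h : CritEdge H s a b c) {f : W → V}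
    (hcol : ∀ u v, P (f u) = P (f v) ↔ c u = c v) (i : Fin s) :
    #{y | H.Adj a y ∧ P (f y) = i} < dg H a := by
  refine card_lt_card (ssubset_iff_of_subset (fun y hy => ?_) |>.2 ?_)
  · exact mem_filter.2 ⟨mem_univ _, (mem_filter.1 hy).2.1⟩
  · by_cases hi : i = P (f a)
    · have hs : 1 < s := h.two_le
      have : Nontrivial (Fin s) := Fin.nontrivial_iff_two_le.2 hs
      obtain ⟨j, hj⟩ := exists_ne (c a)
      obtain ⟨y, hy, hyj⟩ := h.exists_adj hj
      refine ⟨y, mem_filter.2 ⟨mem_univ _, hy⟩, fun hy2 => ?_⟩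
      have h1 := (mem_filter.1 hy2).2.2
      rw [hi, hcol] at h1
      exact hj (hyj ▸ h1)
    · refine ⟨b, mem_filter.2 ⟨mem_univ _, h.adj⟩, fun hy2 => ?_⟩
      have h1 := (mem_filter.1 hy2).2.2
      exact hi (h1.symm.trans ((hcol b a).2 h.color_eq.symm))

lemma GoodCopy.eq_center {T Z : Finset V} (hTZ : Disjoint T Z) {f : W → V}
    (hf : GoodCopy P c a b T Z f) {u : V} (hu : u ∈ Z) {x : W} (hx : f x = u) : x = a := by
  by_contra hxa
  have hT : u ∉ T := fun h1 => disjoint_left.1 hTZ h1 hu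
  by_cases hxb : x = b
  · subst hxb
    rcases hf.pos with h1 | h1
    · exact h1.2 (hx ▸ hu)
    · exact hT (hx ▸ h1.2)
  · exact hT (hx ▸ hf.mem_T x hxa hxb)

lemma CritEdge.class_adj_le [Fintype W] [Fintype V] (h : CritEdge H s a b c)
    {F : Finset (W → V)} {T Z : Finset V} (hTZ : Disjoint T Z)
    (hgood : ∀ f ∈ F, GoodCopy P c a b T Z f) {u : V} (hu : u ∈ Z) (i : Fin s) :
    #{z | P z = i ∧ G.Adj u z} ≤ #{z | P z = i ∧ (restG H G F).Adj u z} +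
      (dg H a - 1) * #{f ∈ F | f a = u} := by
  have h1 : #(({f ∈ F | f a = u} : Finset (W → V)).biUnion fun f =>
      ({y | H.Adj a y ∧ P (f y) = i} : Finset W).image f) ≤
      #{f ∈ F | f a = u} * (dg H a - 1) := by
    refine card_biUnion_le_card_mul _ _ _ fun f hf => ?_
    refine card_image_le.trans ?_
    have := h.card_class_lt (hgood f (mem_filter.1 hf).1).col i
    omega
  rw [mul_comm]
  refine le_trans ?_ (Nat.add_le_add_left h1 _)
  refine (card_le_card fun z hz => ?_).trans (card_union_le _ _)
  obtain ⟨-, h2, h3⟩ := mem_filter.1 hz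
  rw [mem_union]
  by_cases h4 : s(u, z) ∈ usedE H F
  · right
    obtain ⟨f, hf, hfe⟩ := mem_usedE.1 h4
    obtain ⟨x, y, hxy, hxu, hyz⟩ := mk_mem_imgE.1 hfe
    obtain rfl := (hgood f hf).eq_center hTZ hu hxu
    refine mem_biUnion.2 ⟨f, mem_filter.2 ⟨hf, hxu⟩, mem_image.2 ⟨y, ?_, hyz⟩⟩
    exact mem_filter.2 ⟨mem_univ _, hxy, hyz ▸ h2⟩
  · left
    exact mem_filter.2 ⟨mem_univ _, h2, restG_adj.2 ⟨h3, h4⟩⟩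

lemma CritEdge.dg_insG_add_le [Fintype V] (h : CritEdge H s a b c) {F : Finset (W → V)}
    (hF : IsPacking H G χ F) (hcol : ∀ f ∈ F, ∀ u v, P (f u) = P (f v) ↔ c u = c v) (u : V) :
    dg (insG (restG H G F) P) u + #{f ∈ F | f a = u} ≤ dg (insG G P) u := by
  have h1 : #{f ∈ F | f a = u} ≤ #{z | (insG G P).Adj u z ∧ s(u, z) ∈ usedE H F} := by
    refine card_le_card_of_injOn (fun f => f b) ?_ ?_
    · intro f hf
      obtain ⟨hfF, hfa⟩ := mem_filter.1 hf
      refine mem_filter.2 ⟨mem_univ _, ?_, ?_⟩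
      · rw [← hfa]; exact h.insG_adj (hF.1 f hfF) (hcol f hfF)
      · rw [← hfa]; exact mem_usedE.2 ⟨f, hfF, h.mem_imgE f⟩
    · intro f hf g hg hfg
      obtain ⟨hfF, hfa⟩ := mem_filter.1 hf
      obtain ⟨hgF, hga⟩ := mem_filter.1 hg
      refine h.eq_of_mk_eq hF hfF hgF ?_
      rw [hfa, hga]
      exact congrArg _ hfg
  refine (Nat.add_le_add_left h1 _).trans ?_
  unfold dg
  rw [← card_union_of_disjoint]
  · refine card_le_card fun z hz => ?_
    refine mem_filter.2 ⟨mem_univ _, ?_⟩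
    rcases mem_union.1 hz with h2 | h2
    · obtain ⟨-, h3, h4⟩ := mem_filter.1 h2
      exact ⟨restG_le F h3, h4⟩
    · exact (mem_filter.1 h2).2.1
  · rw [disjoint_left]
    intro z hz hz'
    obtain ⟨-, h3, h4⟩ := mem_filter.1 hz
    exact (restG_adj.1 h3).2 (mem_filter.1 hz').2.2

lemma CritEdge.eCount_insG_le_add [Fintype V] (h : CritEdge H s a b c) {F : Finset (W → V)}
    (hcol : ∀ f ∈ F, ∀ u v, P (f u) = P (f v) ↔ c u = c v) :
    eCount (insG G P) ≤ #F + eCount (insG (restG H G F) P) := by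
  have h1 : (insG G P).edgeSet ⊆ (fun f => s(f a, f b)) '' (F : Set (W → V)) ∪
      (insG (restG H G F) P).edgeSet := by
    intro e
    induction e using Sym2.ind with | _ u v
    rintro ⟨h1, h2⟩
    by_cases h3 : s(u, v) ∈ usedE H F
    · obtain ⟨f, hf, hfe⟩ := mem_usedE.1 h3
      exact Or.inl ⟨f, hf, (h.inner_eq (hcol f hf) h2 hfe).symm⟩
    · exact Or.inr ⟨restG_adj.2 ⟨h1, h3⟩, h2⟩
  unfold eCount
  refine (Set.ncard_le_ncard h1 (Set.toFinite _)).trans ((Set.ncard_union_le _ _).trans ?_)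
  refine Nat.add_le_add_right ?_ _
  rw [← Set.ncard_coe_finset F]
  exact Set.ncard_image_le F.finite_toSet

lemma eCount_le_sum_dg [Fintype V] (G : SimpleGraph V) (Z : Finset V)
    (hZ : ∀ u v, G.Adj u v → u ∈ Z ∨ v ∈ Z) : eCount G ≤ ∑ u ∈ Z, dg G u := by
  have h1 : G.edgeFinset ⊆ Z.biUnion fun u =>
      ({w | G.Adj u w} : Finset V).image fun w => s(u, w) := by
    intro e
    induction e using Sym2.ind with | _ u v
    intro he
    have he : G.Adj u v := by simpa using he
    rcases hZ u v he with h | h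
    · exact mem_biUnion.2 ⟨u, h, mem_image.2 ⟨v, by simpa using he, rfl⟩⟩
    · exact mem_biUnion.2 ⟨v, h, mem_image.2
        ⟨u, by simpa using SimpleGraph.Adj.symm he, Sym2.eq_swap⟩⟩
  rw [eCount_eq_card]
  refine (card_le_card h1).trans (card_biUnion_le.trans (sum_le_sum fun u _ => ?_))
  exact card_image_le

lemma CritEdge.eCount_insG_eq_zero [Fintype W] [Fintype V] (h : CritEdge H s a b c)
    {F : Finset (W → V)} (hF : IsPacking H G χ F)
    (hcol : ∀ f ∈ F, ∀ u v, P (f u) = P (f v) ↔ c u = c v) (Z : Finset V)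
    (hZ : ∀ u v, (insG (restG H G F) P).Adj u v → u ∈ Z ∨ v ∈ Z)
    (hquota : ∀ u ∈ Z, (2 * dg H a - 1) * dg (insG G P) u ≤
      2 * dg H a * (dg H a - 1) * #{f ∈ F | f a = u})
    (hle : (eCount H - 1) * #F ≤ eCount (insG G P)) : eCount (insG G P) = 0 := by
  have h1 := h.eCount_insG_le_add (G := G) hcol
  have h2 := eCount_le_sum_dg _ Z hZ
  have h3 : ∑ u ∈ Z, #{f ∈ F | f a = u} ≤ #F := by
    rw [← card_biUnion]
    · exact card_le_card (biUnion_subset.2 fun u _ => filter_subset _ _)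
    · intro u _ v _ huv
      rw [Function.onFun, disjoint_left]
      intro f hf hf'
      exact huv ((mem_filter.1 hf).2.symm.trans (mem_filter.1 hf').2)
  have hD : 2 ≤ dg H a := h.two_le.trans h.le_dg
  have hDk := h.dg_lt_eCount
  obtain ⟨d, hd⟩ : ∃ d, dg H a = d + 2 := ⟨dg H a - 2, by omega⟩
  rw [hd] at hquota hDk
  have h4 : ∀ u ∈ Z, (2 * d + 3) * dg (insG (restG H G F) P) u ≤
      (2 * d ^ 2 + 4 * d + 1) * #{f ∈ F | f a = u} := by
    intro u hu
    have h5 := hquota u hu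
    rw [show 2 * (d + 2) - 1 = 2 * d + 3 by omega, show d + 2 - 1 = d + 1 by omega] at h5
    have h6 := Nat.mul_le_mul_left (2 * d + 3) (h.dg_insG_add_le hF hcol u)
    nlinarith
  have h5 : (2 * d + 3) * ∑ u ∈ Z, dg (insG (restG H G F) P) u ≤
      (2 * d ^ 2 + 4 * d + 1) * ∑ u ∈ Z, #{f ∈ F | f a = u} := by
    rw [mul_sum, mul_sum]
    exact sum_le_sum h4
  have h6 : (2 * d ^ 2 + 4 * d + 1) * ∑ u ∈ Z, #{f ∈ F | f a = u} ≤
      (2 * d ^ 2 + 4 * d + 1) * #F := Nat.mul_le_mul_left _ h3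
  have h7 : (d + 2) * #F ≤ eCount (insG G P) :=
    le_trans (Nat.mul_le_mul_right _ (by omega)) hle
  have h8 : (2 * d + 3) * eCount (insG G P) ≤ (2 * d + 3) * (#F +
      ∑ u ∈ Z, dg (insG (restG H G F) P) u) := Nat.mul_le_mul_left _ (by omega)
  have h9 : (2 * d + 3) * ((d + 2) * #F) ≤ (2 * d + 3) * eCount (insG G P) :=
    Nat.mul_le_mul_left _ h7
  have h10 : #F = 0 := by nlinarith
  rw [h10] at h8 h6
  have h11 : (2 * d + 3) * eCount (insG G P) ≤ 0 := by nlinarith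
  have h12 := Nat.le_zero.1 h11
  rcases Nat.mul_eq_zero.1 h12 with h | h
  · omega
  · exact h
end

section
open Finset
open scoped Classical
variable {H : SimpleGraph W} {G : SimpleGraph V} {χ : Sym2 V → ℕ}
variable {s : ℕ} {a b : W} {c : W → Fin s} {P : V → Fin s}

set_option maxHeartbeats 1000000 in
lemma CritEdge.colorable_of_goodPart [Fintype W] [Fintype V] (h : CritEdge H s a b c)
    (hχ : ProperEdgeColoring G χ) (δ ω τ ε : ℝ) (hτ0 : 0 < τ)
    (hδ : δ * (16 * s * Fintype.card W) = 1) (hω : ω * (16 * dg H a) = δ)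
    (hτ : τ * (Fintype.card W : ℝ) ^ 2 = ω) (hε : ε * (8 * Fintype.card W) = ω * τ)
    (hP : GoodPart G P ε)
    (hn : 3 * (Fintype.card W : ℝ) + (Fintype.card W : ℝ) ^ 3 ≤ ω * Fintype.card V)
    (hp : ∀ N, HasPack H G χ N → tn s (Fintype.card V) + (eCount H - 1) * N ≤ eCount G) :
    G.Colorable s := by
  have hs2 : (2 : ℝ) ≤ s := by exact_mod_cast h.two_le
  have hD : (2 : ℝ) ≤ dg H a := by exact_mod_cast h.two_le.trans h.le_dg
  have hw1 : (1 : ℝ) ≤ Fintype.card W := by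
    have : 0 < Fintype.card W := Fintype.card_pos_iff.2 ⟨a⟩
    exact_mod_cast this
  have hH : 0 < eCount H := by have := h.dg_lt_eCount; omega
  obtain ⟨Z, hZ⟩ : ∃ Z : Finset V, ∀ v, v ∈ Z ↔ δ * Fintype.card V ≤ dg (insG G P) v :=
    ⟨univ.filter fun v => δ * Fintype.card V ≤ dg (insG G P) v, by simp⟩
  obtain ⟨T, hT⟩ : ∃ T : Finset V, ∀ v, v ∈ T ↔ dg (insG G P) v ≤ τ * Fintype.card V :=
    ⟨univ.filter fun v => dg (insG G P) v ≤ τ * Fintype.card V, by simp⟩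
  obtain ⟨F, hF, hgood, hfill, hmax⟩ := exists_max_good (G := G) (χ := χ) (P := P) (c := c)
    (a := a) (b := b) hH T Z ⌈τ * Fintype.card V⌉₊
  have hcol : ∀ f ∈ F, ∀ u v, P (f u) = P (f v) ↔ c u = c v := fun f hf => (hgood f hf).col
  obtain ⟨S, hS⟩ : ∃ S : Finset V, ∀ v, v ∈ S ↔
      ((dg (insG G P) v + fillCount {a, b} F v : ℕ) : ℝ) < τ * Fintype.card V :=
    ⟨univ.filter fun v =>
      ((dg (insG G P) v + fillCount {a, b} F v : ℕ) : ℝ) < τ * Fintype.card V, by simp⟩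
  have hcardF := h.card_le_eCount hF hcol
  have hχ1 : ProperEdgeColoring (restG H G F) χ := hχ.mono (restG_le F)
  have hS2 := card_filter_mul_le univ (fun v => dg (insG G P) v + fillCount {a, b} F v)
    (τ * Fintype.card V)
  have hSc : (univ.filter fun v =>
      τ * Fintype.card V ≤ ((dg (insG G P) v + fillCount {a, b} F v : ℕ) : ℝ)) = Sᶜ := by
    ext v; simp only [mem_filter, mem_univ, true_and, mem_compl, hS, not_lt]
  rw [hSc, sum_add_distrib, sum_dg] at hS2
  have hsf := sum_fillCount_le ({a, b} : Finset W) F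
  have hused := h.used_le hF hcol
  have hmiss := missing_restG_le (P := P) hF
  have hpF := hp #F ⟨F, hF, rfl⟩
  have hEle := hP.eCount_le
  have hins := hP.ins_le
  have hcls := hP.class_ge
  have hdle := hP.dg_le
  have hPm := hP.missing
  obtain ⟨n, hnV⟩ : ∃ n, n = Fintype.card V := ⟨_, rfl⟩
  obtain ⟨m, hmW⟩ : ∃ m, m = Fintype.card W := ⟨_, rfl⟩
  obtain ⟨D, hDD⟩ : ∃ D, D = dg H a := ⟨_, rfl⟩
  rw [← hnV] at hn hpF hEle hins hcls hPm hZ hT hfill hS hS2 hmax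
  rw [← hmW] at hδ hτ hε hn hw1 hsf hused
  rw [← hDD] at hω hD
  have hω0 : 0 < ω := by rw [← hτ]; positivity
  have hδ0 : 0 < δ := by rw [← hω]; positivity
  have hε0 : 0 < ε := by
    by_contra hc
    have : ε * (8 * m) ≤ 0 := mul_nonpos_of_nonpos_of_nonneg (not_lt.1 hc) (by positivity)
    have : 0 < ω * τ := by positivity
    linarith
  have hm3 : 0 ≤ (m : ℝ) ^ 3 := by positivity
  have hn0 : (0 : ℝ) < n := by
    by_contra hc
    have : ω * n ≤ 0 := mul_nonpos_of_nonneg_of_nonpos hω0.le (not_lt.1 hc)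
    linarith
  have hωδ : ω * 32 ≤ δ := by
    rw [← hω]
    have : ω * 32 ≤ ω * (16 * D) := by gcongr; linarith
    linarith
  have hmτ : m * τ ≤ ω := by
    rw [← hτ]
    have : (m : ℝ) * τ * 1 ≤ m * τ * m := by gcongr
    linarith
  have hτω : τ ≤ ω := by
    have : 1 * τ ≤ m * τ := by gcongr
    linarith
  have hω1 : ω * (512 * s) ≤ 1 := by
    rw [← hδ]
    have h1 : ω * 32 * (16 * s * 1) ≤ δ * (16 * s * m) := by gcongr
    linarith
  have hω1' : ω ≤ 1 := by nlinarith
  have hεm : m * ε * 8 ≤ τ := by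
    have : ω * τ ≤ 1 * τ := by gcongr
    linarith
  have hετ : ε * 8 ≤ τ := by
    have : 1 * (ε * 8) ≤ m * (ε * 8) := by gcongr
    linarith
  have hωn : 0 < ω * n := by positivity
  have hτn : τ * n ≤ ω * n := by gcongr
  have hεn : ε * n * 8 ≤ τ * n := by
    have : ε * 8 * n ≤ τ * n := by gcongr
    linarith
  -- few vertices are unavailable
  have hSc' : (#Sᶜ : ℝ) ≤ ω * n := by
    have h1 : ((2 * eCount (insG G P) + ∑ v, fillCount {a, b} F v : ℕ) : ℝ) ≤
        3 * m * (ε * n ^ 2) := by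
      have h2 : ((∑ v, fillCount {a, b} F v : ℕ) : ℝ) ≤ m * eCount (insG G P) := by
        exact_mod_cast hsf.trans (Nat.mul_le_mul_left m hcardF)
      have h3 : (m : ℝ) * eCount (insG G P) ≤ m * (ε * n ^ 2) := by gcongr
      have h4 : 1 * (ε * (n : ℝ) ^ 2) ≤ m * (ε * n ^ 2) := by gcongr
      have h5 : ((2 * eCount (insG G P) + ∑ v, fillCount {a, b} F v : ℕ) : ℝ) =
        2 * eCount (insG G P) + ((∑ v, fillCount {a, b} F v : ℕ) : ℝ) := by push_cast; rfl
      rw [h5]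
      linarith
    have h2 : (#Sᶜ : ℝ) * (τ * n) ≤ ω * n * (τ * n) := by
      refine (hS2.trans h1).trans ?_
      have h3 : 0 ≤ ω * τ * (n : ℝ) ^ 2 := by positivity
      have h4 : ε * (8 * m) * (n : ℝ) ^ 2 = ω * τ * n ^ 2 := by rw [hε]
      linarith
    exact le_of_mul_le_mul_right h2 (by positivity)
  have hmissR : ∀ y i, i ≠ P y → (#{z | P z = i ∧ ¬ (restG H G F).Adj y z} : ℝ) ≤
      ε * n + dg (insG G P) y + m * (fillCount {a, b} F y + dg (insG G P) y) := by
    intro y i hi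
    have h1 := hPm y i hi
    have h2 : (#{z | P z = i ∧ ¬ (restG H G F).Adj y z} : ℝ) ≤
        #{z | P z = i ∧ ¬ G.Adj y z} + m * (fillCount {a, b} F y + dg (insG G P) y) := by
      exact_mod_cast (hmiss y i).trans (Nat.add_le_add_left (hused y) _)
    linarith
  have hST : ∀ v ∈ S, (dg (insG G P) v : ℝ) + fillCount {a, b} F v < τ * n := by
    intro v hv
    have := (hS v).1 hv
    push_cast at this
    exact this
  have hST' : S ⊆ T := by
    intro v hv
    rw [hT]
    have := hST v hv
    have : (0 : ℝ) ≤ fillCount {a, b} F v := Nat.cast_nonneg _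
    linarith
  have hSK : ∀ v ∈ S, fillCount {a, b} F v < ⌈τ * n⌉₊ := by
    intro v hv
    rw [Nat.lt_ceil]
    have := hST v hv
    have : (0 : ℝ) ≤ dg (insG G P) v := Nat.cast_nonneg _
    linarith
  have hq : ∀ y ∈ S, ∀ i, i ≠ P y →
      #{z | P z = i ∧ ¬ (restG H G F).Adj y z} ≤ ⌊3 * m * τ * n⌋₊ := by
    intro y hy i hi
    refine Nat.le_floor ((hmissR y i hi).trans ?_)
    have h1 := hST y hy
    have h2 : (0 : ℝ) ≤ fillCount {a, b} F y := Nat.cast_nonneg _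
    have h3 : (m : ℝ) * (fillCount {a, b} F y + dg (insG G P) y) ≤ m * (τ * n) := by
      gcongr
      linarith
    have h4 : 1 * (τ * n) ≤ m * (τ * n) := by gcongr
    have h5 : 0 < τ * n := by positivity
    linarith
  obtain ⟨q, hqq⟩ : ∃ q, q = ⌊3 * m * τ * n⌋₊ := ⟨_, rfl⟩
  rw [← hqq] at hq
  have hq' : (m : ℝ) * q ≤ 3 * (ω * n) := by
    have h1 : (q : ℝ) ≤ 3 * m * τ * n := by
      rw [hqq]; exact Nat.floor_le (by positivity)
    calc (m : ℝ) * q ≤ m * (3 * m * τ * n) := by gcongr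
      _ = 3 * (τ * m ^ 2 * n) := by ring
      _ = _ := by rw [hτ]
  have hTZ : Disjoint T Z := by
    rw [disjoint_left]
    intro v hv hv'
    have h1 := (hT v).1 hv
    have h2 := (hZ v).1 hv'
    have : δ * n ≤ ω * n := by linarith
    have := le_of_mul_le_mul_right this hn0
    linarith
  have hzero : eCount (insG G P) = 0 := by
    refine h.eCount_insG_eq_zero hF hcol Z ?_ ?_ (by omega)
    · intro u v huv
      by_contra! hc
      obtain ⟨hu, hv⟩ := hc
      have hsmall : ∀ y, y ∉ Z → ∀ i, i ≠ P y →
          (#{z | P z = i ∧ ¬ (restG H G F).Adj y z} : ℝ) ≤ n / (8 * s) + 2 * (ω * n) + m := by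
        intro y hy i hi
        refine (hmissR y i hi).trans ?_
        rw [hZ, not_le] at hy
        have h1 : (fillCount {a, b} F y : ℝ) ≤ τ * n + 1 := by
          have h2 : (fillCount {a, b} F y : ℝ) ≤ ⌈τ * n⌉₊ := by exact_mod_cast hfill y
          exact h2.trans (Nat.ceil_lt_add_one (by positivity)).le
        have h2 : (m : ℝ) * (fillCount {a, b} F y + dg (insG G P) y) ≤
            m * ((τ * n + 1) + δ * n) := by gcongr
        have h3 : m * τ * n ≤ ω * n := by gcongr
        have h4 : m * δ * n = n / (16 * s) := by
          rw [eq_div_iff (by positivity)]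
          linear_combination (n : ℝ) * hδ
        have h5 : δ * n ≤ m * δ * n := by
          have : 1 * (δ * n) ≤ m * (δ * n) := by gcongr
          linarith
        have h6 : (n : ℝ) / (8 * s) = n / (16 * s) + n / (16 * s) := by
          field_simp; norm_num
        rw [h6]
        have : 0 < τ * n := by positivity
        linarith
      have hns : (512 : ℝ) * (ω * n) ≤ n / s := by
        rw [le_div_iff₀ (by positivity)]
        have : ω * (512 * s) * n ≤ 1 * n := by gcongr
        linarith
      have hns8 : (n : ℝ) / (8 * s) = n / s / 8 := by rw [mul_comm, div_div]
      rw [hns8] at hsmall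
      have hP2 : P u = P v := huv.2
      obtain ⟨f, hf, hfa, hfb, hfw, hfc⟩ := h.exists_copy_two hχ1 S q hq u v huv.1 hP2
        (by
          intro i
          have h1 := hcls i
          rw [← hmW]
          have h2 : (m : ℝ) * q + m + m ^ 3 + #Sᶜ < #{z | P z = i} := by linarith
          exact_mod_cast h2)
        (by
          intro i hi
          have h1 := hcls i
          have h3 := hsmall u hu i hi
          have h4 := hsmall v hv i (hP2 ▸ hi)
          rw [← hmW]
          have h2 : (m : ℝ) * q + m + m ^ 3 + #Sᶜ +
              #{z | P z = i ∧ ¬ (restG H G F).Adj u z} +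
              #{z | P z = i ∧ ¬ (restG H G F).Adj v z} < #{z | P z = i} := by linarith
          exact_mod_cast h2)
      exact hmax f hf ⟨hfc, fun w hwa hwb => hST' (hfw w hwa hwb),
        Or.inl ⟨hfa ▸ hu, hfb ▸ hv⟩⟩ fun w hwa hwb => hSK _ (hfw w hwa hwb)
    · intro u hu
      by_contra! hc
      have hba : b ≠ a := (SimpleGraph.Adj.ne h.adj).symm
      obtain ⟨f, hf, hfa, hfw, hfc⟩ := h.exists_copy_one hχ1 S q hq u
        (by
          intro i
          have h1 := hdle u i
          have h2 := h.class_adj_le (G := G) hTZ hgood hu i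
          have h3 : (dg (insG G P) u : ℝ) ≤ #{z | P z = i ∧ (restG H G F).Adj u z} +
              (D - 1 : ℕ) * #{f ∈ F | f a = u} := by
            rw [hDD]; exact_mod_cast h1.trans h2
          rw [← hDD] at hc
          have hD1 : 1 ≤ D := by
            have : (1 : ℝ) ≤ D := by linarith
            exact_mod_cast this
          have h4 : ((2 * D * (D - 1) * #{f ∈ F | f a = u} : ℕ) : ℝ) <
              ((2 * D - 1) * dg (insG G P) u : ℕ) := by exact_mod_cast hc
          push_cast [Nat.cast_sub hD1, Nat.cast_sub (by omega : 1 ≤ 2 * D)] at h3 h4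
          have h5 := (hZ u).1 hu
          have h6 : 2 * (D : ℝ) * (8 * (ω * n)) <
              2 * D * #{z | P z = i ∧ (restG H G F).Adj u z} := by
            have h7 : 2 * (D : ℝ) * (8 * (ω * n)) = δ * n := by rw [← hω]; ring
            rw [h7]
            have h8 : 2 * (D : ℝ) * dg (insG G P) u ≤
                2 * D * (#{z | P z = i ∧ (restG H G F).Adj u z} +
                (D - 1) * #{f ∈ F | f a = u}) := by gcongr
            linarith
          have h7 := lt_of_mul_lt_mul_left h6 (by positivity)
          rw [← hmW]
          have h2 : (m : ℝ) * q + m + m ^ 3 + #Sᶜ <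
              #{z | P z = i ∧ (restG H G F).Adj u z} := by linarith
          exact_mod_cast h2)
      exact hmax f hf ⟨hfc, fun w hwa hwb => hST' (hfw w hwa),
        Or.inr ⟨hfa ▸ hu, hST' (hfw b hba)⟩⟩ fun w hwa hwb => hSK _ (hfw w hwa)
  exact colorable_of_eCount_insG P hzero

theorem CritEdge.exists_core [Fintype W] (h : CritEdge H s a b c) :
    ∃ n₁ : ℕ, ∀ (V : Type) [Fintype V] (G : SimpleGraph V) (χ : Sym2 V → ℕ),
      ProperEdgeColoring G χ → n₁ ≤ Fintype.card V →
      (∀ v, tn s (Fintype.card V) ≤ tn s (Fintype.card V - 1) + dg G v) →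
      (∀ N, HasPack H G χ N → tn s (Fintype.card V) + (eCount H - 1) * N ≤ eCount G) →
      G.Colorable s := by
  have hs : (0 : ℝ) < s := by
    have := h.two_le
    exact_mod_cast (by omega : 0 < s)
  have hD : (0 : ℝ) < dg H a := by
    have := h.two_le.trans h.le_dg
    exact_mod_cast (by omega : 0 < dg H a)
  have hw : (0 : ℝ) < Fintype.card W := by
    exact_mod_cast Fintype.card_pos_iff.2 ⟨a⟩
  obtain ⟨δ, hδ0, hδ⟩ : ∃ δ : ℝ, 0 < δ ∧ δ * (16 * s * Fintype.card W) = 1 :=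
    ⟨1 / (16 * s * Fintype.card W), by positivity, by field_simp⟩
  obtain ⟨ω, hω0, hω⟩ : ∃ ω : ℝ, 0 < ω ∧ ω * (16 * dg H a) = δ :=
    ⟨δ / (16 * dg H a), by positivity, by field_simp⟩
  obtain ⟨τ, hτ0, hτ⟩ : ∃ τ : ℝ, 0 < τ ∧ τ * (Fintype.card W : ℝ) ^ 2 = ω :=
    ⟨ω / (Fintype.card W : ℝ) ^ 2, by positivity, by field_simp⟩
  obtain ⟨ε, hε0, hε⟩ : ∃ ε : ℝ, 0 < ε ∧ ε * (8 * Fintype.card W) = ω * τ :=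
    ⟨ω * τ / (8 * Fintype.card W), by positivity, by field_simp⟩
  obtain ⟨n₁, hn₁⟩ := h.exists_goodPart ε hε0
  obtain ⟨n₂, hn₂⟩ := exists_nat_gt
    ((3 * (Fintype.card W : ℝ) + (Fintype.card W : ℝ) ^ 3) / ω)
  refine ⟨n₁ + n₂, fun V _ G χ hχ hn hdeg hp => ?_⟩
  obtain ⟨P, hP⟩ := hn₁ V G χ hχ (by omega) hdeg hp
  refine h.colorable_of_goodPart hχ δ ω τ ε hτ0 hδ hω hτ hε hP ?_ hp
  rw [div_lt_iff₀ hω0] at hn₂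
  have h1 : (n₂ : ℝ) ≤ Fintype.card V := by exact_mod_cast (by omega : n₂ ≤ Fintype.card V)
  have h2 : (n₂ : ℝ) * ω ≤ Fintype.card V * ω := by gcongr
  linarith
end

section
open Finset
open scoped Classical
variable {H : SimpleGraph W} {G : SimpleGraph V} {χ : Sym2 V → ℕ}
variable {s : ℕ} {a b : W} {c : W → Fin s}

theorem CritEdge.exists_colorable [Fintype W] (h : CritEdge H s a b c) :
    ∃ n₀ : ℕ, ∀ (V : Type) [Fintype V] (G : SimpleGraph V) (χ : Sym2 V → ℕ),
      ProperEdgeColoring G χ → n₀ ≤ Fintype.card V →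
      (∀ N, HasPack H G χ N → tn s (Fintype.card V) + (eCount H - 1) * N ≤ eCount G) →
      G.Colorable s := by
  obtain ⟨n₁, hn₁⟩ := h.exists_core
  have hs : 0 < s := by
    have := h.two_le
    omega
  have key : ∀ (p : ℕ) (V : Type) [Fintype V] (G : SimpleGraph V) (χ : Sym2 V → ℕ) (q : ℕ),
      Fintype.card V = p → ProperEdgeColoring G χ →
      (∀ N, HasPack H G χ N → tn s p + q + (eCount H - 1) * N ≤ eCount G) →
      (q = 0 ∧ G.Colorable s) ∨ q + p ≤ n₁ + n₁ ^ 2 := by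
    intro p
    induction p with
    | zero =>
      intro V _ G χ q hp hχ hN
      have h0 := hN 0 hasPack_zero
      have h1 := eCount_le_sq G
      rw [hp] at h1
      right
      simp only [mul_zero] at h0
      have : eCount G = 0 := by simpa using h1
      omega
    | succ p ih =>
      intro V _ G χ q hp hχ hN
      have h0 := hN 0 hasPack_zero
      have h1 := eCount_le_sq G
      rw [hp] at h1
      by_cases hsm : p + 1 < n₁
      · right
        have : (p + 1) ^ 2 ≤ n₁ ^ 2 := Nat.pow_le_pow_left hsm.le 2
        omega
      · push Not at hsm
        by_cases hd : ∀ v, tn s (Fintype.card V) ≤ tn s (Fintype.card V - 1) + dg G v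
        · left
          have hc : G.Colorable s := by
            refine hn₁ V G χ hχ (by omega) hd fun N hN' => ?_
            have := hN N hN'
            rw [hp]
            omega
          have h2 := eCount_le_tn hs hc
          rw [hp] at h2
          exact ⟨by omega, hc⟩
        · push Not at hd
          obtain ⟨x, hx⟩ := hd
          rw [hp, Nat.add_sub_cancel] at hx
          have hcd := card_delV x
          have hed := eCount_delV G x
          rcases ih ({x}ᶜ : Set V) (delV G x) (χ ∘ Sym2.map Subtype.val) (q + 1) (by omega)
            (hχ.comap _ Subtype.val_injective) (fun N hN' => by
              have := hN N (HasPack.of_comap _ Subtype.val_injective hN')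
              omega) with h3 | h3
          · exact absurd h3.1 (Nat.succ_ne_zero q)
          · right
            omega
  refine ⟨n₁ + n₁ ^ 2 + 1, fun V _ G χ hχ hc hN => ?_⟩
  rcases key _ V G χ 0 rfl hχ (by simpa using hN) with h1 | h1
  · exact h1.2
  · omega

lemma exists_properEdgeColoring [Fintype V] (G : SimpleGraph V) :
    ∃ χ : Sym2 V → ℕ, ProperEdgeColoring G χ :=
  ⟨fun e => Fintype.equivFin _ e, fun _ _ _ _ hef _ hc =>
    hef ((Fintype.equivFin _).injective (Fin.val_injective hc))⟩

lemma colorable_of_containsCopy (hc : ContainsCopy H G) (hG : G.Colorable s) : H.Colorable s := by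
  obtain ⟨f, -, hf⟩ := hc
  exact hG.of_hom ⟨f, fun h => hf h⟩

lemma turanGraph_colorable (n : ℕ) (hs : 0 < s) : (SimpleGraph.turanGraph n s).Colorable s :=
  ⟨SimpleGraph.Coloring.mk (fun v => ⟨v % s, Nat.mod_lt _ hs⟩) fun h he =>
    h (congrArg Fin.val he)⟩

theorem CritEdge.phiRmax_eq [Fintype W] (h : CritEdge H s a b c) :
    ∃ n₀ : ℕ, ∀ n : ℕ, n₀ ≤ n →
      phiRmax n H = exNum n H ∧
      ∀ (V : Type) [Fintype V] (G : SimpleGraph V), Fintype.card V = n →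
        ∀ χ : Sym2 V → ℕ, ProperEdgeColoring G χ →
          phiR G H χ = phiRmax n H →
          Nonempty (G ≃g SimpleGraph.turanGraph n s) := by
  obtain ⟨n₀, hn₀⟩ := h.exists_colorable
  have hs : 0 < s := by
    have := h.two_le
    omega
  have hH : 0 < eCount H := by
    have := h.dg_lt_eCount
    omega
  have hcol : ∀ (V : Type) [Fintype V] (G : SimpleGraph V) (χ : Sym2 V → ℕ),
      ProperEdgeColoring G χ → n₀ ≤ Fintype.card V → tn s (Fintype.card V) ≤ phiR G H χ →
      phiR G H χ ≤ eCount G ∧ G.Colorable s := by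
    intro V _ G χ hχ hn ht
    have hN : ∀ N, HasPack H G χ N → phiR G H χ + (eCount H - 1) * N ≤ eCount G := by
      rintro N ⟨F, hF, rfl⟩
      exact hF.phiR_add_le hH
    refine ⟨by simpa using hN 0 hasPack_zero, hn₀ V G χ hχ hn fun N hN' => ?_⟩
    have := hN N hN'
    omega
  have hle : ∀ (V : Type) [Fintype V] (G : SimpleGraph V) (χ : Sym2 V → ℕ),
      ProperEdgeColoring G χ → n₀ ≤ Fintype.card V → phiR G H χ ≤ tn s (Fintype.card V) := by
    intro V _ G χ hχ hn
    by_contra hlt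
    push Not at hlt
    obtain ⟨h1, h2⟩ := hcol V G χ hχ hn hlt.le
    have := eCount_le_tn hs h2
    omega
  refine ⟨n₀, fun n hn => ?_⟩
  have hfree : ¬ ContainsCopy H (SimpleGraph.turanGraph n s) := fun hc =>
    h.not_col (colorable_of_containsCopy hc (turanGraph_colorable n hs))
  have hphi : phiRmax n H = tn s n := by
    refine IsGreatest.csSup_eq ⟨?_, ?_⟩
    · obtain ⟨χ, hχ⟩ := exists_properEdgeColoring (SimpleGraph.turanGraph n s)
      exact ⟨_, χ, hχ, phiR_eq_of_free hH hfree⟩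
    · rintro _ ⟨G, χ, hχ, rfl⟩
      simpa using hle (Fin n) G χ hχ (by simpa using hn)
  have hex : exNum n H = tn s n := by
    refine IsGreatest.csSup_eq ⟨⟨_, hfree, rfl⟩, ?_⟩
    rintro _ ⟨G, hG, rfl⟩
    obtain ⟨χ, hχ⟩ := exists_properEdgeColoring G
    rw [← phiR_eq_of_free (χ := χ) hH hG]
    simpa using hle (Fin n) G χ hχ (by simpa using hn)
  refine ⟨hphi.trans hex.symm, ?_⟩
  rintro V _ G rfl χ hχ hG
  rw [hphi] at hG
  obtain ⟨h1, h2⟩ := hcol V G χ hχ hn hG.ge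
  exact nonempty_iso_of_tn_le hs h2 (by omega)

end
theorem stmt13 {W : Type*} [Fintype W] (H : SimpleGraph W) (r : ℕ) (hr : 3 ≤ r)
    (hχH : H.chromaticNumber = (r : ℕ∞))
    (hcrit : ∃ a b : W, H.Adj a b ∧
      (H.deleteEdges {s(a, b)}).chromaticNumber < H.chromaticNumber) :
    ∃ n₀ : ℕ, ∀ n : ℕ, n₀ ≤ n →
      phiRmax n H = exNum n H ∧
      ∀ (V : Type) [Fintype V] (G : SimpleGraph V), Fintype.card V = n →
        ∀ χ : Sym2 V → ℕ, ProperEdgeColoring G χ →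
          phiR G H χ = phiRmax n H →
          Nonempty (G ≃g SimpleGraph.turanGraph n (r - 1)) := by
  obtain ⟨a, b, c, h⟩ := exists_critEdge hr hχH hcrit
  exact h.phiRmax_eq

end RainbowDecomp
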